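/- arXiv:math/9403207 — 11 statements merged into one kernel-verified Lean document; each statement's English description precedes it below -/
import Mathlib

section
/- Let d ≥ 3 be a natural number and let X = (Fin d → ℝ) carry a 1-unconditional, strictly monotone norm which is one-p-convex for some p with 2 < p < ∞. Then every 1-complemented linear subspace F of X of finite codimension n contains all but at most 2n of the standard basis vectors; that is, the set {i : e_i ∉ F} has at most 2n elements. -/
structure GoodNorm (d : ℕ) (N : (Fin d → ℝ) → ℝ) (p : ℝ) : Prop where
  add : ∀ x y, N (x + y) ≤ N x + N y
  smul : ∀ (c : ℝ) (x), N (c • x) = |c| * N x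
  defn : ∀ x, N x = 0 → x = 0
  uncond : ∀ x y : Fin d → ℝ, (∀ i, |x i| ≤ |y i|) → N x ≤ N y
  strict : ∀ x y : Fin d → ℝ, (∀ i, |x i| ≤ |y i|) → (∃ i, |x i| < |y i|) → N x < N y
  hp : 2 < p
  pconv : ∀ (m : ℕ) (xs : Fin m → (Fin d → ℝ)),
      N (fun i => (∑ j, |xs j i| ^ p) ^ (1 / p)) ≤ (∑ j, N (xs j) ^ p) ^ (1 / p)

lemma scal_aux {p A B w : ℝ} (hp : 2 < p) (hA : 0 ≤ A) (hB : 0 ≤ B) (hw : 0 ≤ w)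
    (h : 2 * w ^ 2 ≤ A ^ 2 + B ^ 2) : 2 * w ^ p ≤ A ^ p + B ^ p := by
  have key : ∀ t : ℝ, 0 ≤ t → (t ^ 2) ^ (p / 2) = t ^ p := by
    intro t ht
    rw [← Real.rpow_natCast, ← Real.rpow_mul ht]
    congr 1
    push_cast
    ring
  have hcv : ConvexOn ℝ (Set.Ici 0) fun x : ℝ => x ^ (p / 2) := convexOn_rpow (by linarith)
  have h1 := hcv.2 (Set.mem_Ici.2 (sq_nonneg A)) (Set.mem_Ici.2 (sq_nonneg B))
    (by norm_num : (0 : ℝ) ≤ 1 / 2) (by norm_num : (0 : ℝ) ≤ 1 / 2) (by norm_num)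
  simp only [smul_eq_mul] at h1
  rw [key A hA, key B hB] at h1
  have h2 : (w ^ 2) ^ (p / 2) ≤ (1 / 2 * A ^ 2 + 1 / 2 * B ^ 2) ^ (p / 2) :=
    Real.rpow_le_rpow (by positivity) (by linarith) (by linarith)
  rw [key w hw] at h2
  linarith

namespace GoodNorm
variable {d : ℕ} {N : (Fin d → ℝ) → ℝ} {p : ℝ}

lemma zero (h : GoodNorm d N p) : N 0 = 0 := by
  have := h.smul 0 0
  simpa using this

lemma nonneg (h : GoodNorm d N p) (x) : 0 ≤ N x := by
  rw [← h.zero]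
  exact h.uncond _ _ (by intro i; simp)

lemma two (h : GoodNorm d N p) (u v w : Fin d → ℝ)
    (hw : ∀ i, |w i| ^ p ≤ |u i| ^ p + |v i| ^ p) : N w ^ p ≤ N u ^ p + N v ^ p := by
  have hp := h.hp
  have h1 := h.pconv 2 ![u, v]
  simp only [Fin.sum_univ_two, Matrix.cons_val_zero, Matrix.cons_val_one] at h1
  have hu := Real.rpow_nonneg (h.nonneg u) p
  have hv := Real.rpow_nonneg (h.nonneg v) p
  have h2 : N w ≤ (N u ^ p + N v ^ p) ^ (1 / p) := by
    refine le_trans (h.uncond _ _ ?_) h1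
    intro i
    have a1 := Real.rpow_nonneg (abs_nonneg (u i)) p
    have a2 := Real.rpow_nonneg (abs_nonneg (v i)) p
    rw [abs_of_nonneg (a := (_ : ℝ) ^ (1 / p)) (by positivity), one_div,
      Real.le_rpow_inv_iff_of_pos (abs_nonneg _) (by positivity) (by linarith)]
    exact hw i
  rwa [one_div, Real.le_rpow_inv_iff_of_pos (h.nonneg _) (by positivity) (by linarith)] at h2

lemma bump (h : GoodNorm d N p) (x : Fin d → ℝ) (i : Fin d) (hx : x i ≠ 0) :
    ∃ δ > 0, ∀ s > 0, N x + δ * s ≤ N (Function.update (fun j => |x j|) i (|x i| + s)) := by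
  have hr : 0 < |x i| := abs_pos.2 hx
  have hlt : N (Function.update x i 0) < N x := by
    apply h.strict
    · intro j
      by_cases hj : j = i
      · subst hj; simp
      · simp [hj]
    · exact ⟨i, by simpa using hx⟩
  refine ⟨(N x - N (Function.update x i 0)) / |x i|, div_pos (by linarith) hr, ?_⟩
  intro s hs
  set w := Function.update (fun j => |x j|) i (|x i| + s) with hwdef
  have h1 : (|x i| + s) * N x ≤ |x i| * N w + s * N (Function.update x i 0) := by
    have e1 := h.smul (|x i| + s) x
    have e2 := h.smul (|x i|) w
    have e3 := h.smul s (fun j => |Function.update x i 0 j|)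
    have e4 : N (fun j => |Function.update x i 0 j|) ≤ N (Function.update x i 0) :=
      h.uncond _ _ (by intro j; simp)
    rw [abs_of_pos (a := |x i| + s) (by positivity)] at e1
    rw [abs_abs] at e2
    rw [abs_of_pos hs] at e3
    have e5 := h.add (|x i| • w) (s • (fun j => |Function.update x i 0 j|))
    have e6 : N ((|x i| + s) • x) ≤ N (|x i| • w + s • (fun j => |Function.update x i 0 j|)) := by
      apply h.uncond
      intro j
      by_cases hj : j = i
      · subst hj
        simp [hwdef, abs_mul]
        rw [mul_comm]
      · simp [hwdef, hj, abs_mul]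
        rw [← add_mul, abs_mul, abs_abs]
    have e7 := mul_le_mul_of_nonneg_left e4 hs.le
    linarith
  rw [div_mul_eq_mul_div, ← le_sub_iff_add_le', div_le_iff₀ hr]
  linarith

lemma key (h : GoodNorm d N p) (Q : (Fin d → ℝ) →ₗ[ℝ] (Fin d → ℝ))
    (hc : ∀ x, N (Q x) ≤ N x) (x y : Fin d → ℝ) (hx : Q x = x)
    (hd : ∀ i, x i ≠ 0 → y i = 0) (i : Fin d) (hi : x i ≠ 0) : Q y i = 0 := by
  by_contra hz
  have hp := h.hp
  set z := Q y with hzdef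
  obtain ⟨δ, hδ, hb⟩ := h.bump x i hi
  have hr : 0 < |x i| := abs_pos.2 hi
  have ha : 0 < N x := by
    rcases (h.nonneg x).lt_or_eq with h1 | h1
    · exact h1
    · exact absurd (congrFun (h.defn x h1.symm) i) hi
  obtain ⟨c, hc0, hc1⟩ : ∃ c > 0, 2 * c * |x i| + c ^ 2 ≤ z i ^ 2 := by
    have hz2 : 0 < z i ^ 2 := by positivity
    refine ⟨min 1 (z i ^ 2 / (2 * |x i| + 1)), by positivity, ?_⟩
    set c := min 1 (z i ^ 2 / (2 * |x i| + 1)) with hcd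
    have c0 : 0 < c := by positivity
    have c1 : c ≤ 1 := min_le_left _ _
    have c2 : c ≤ z i ^ 2 / (2 * |x i| + 1) := min_le_right _ _
    rw [le_div_iff₀ (by positivity)] at c2
    nlinarith
  have dis : ∀ t : ℝ, N (x + t • z) ^ p ≤ N x ^ p + |t| ^ p * N y ^ p := by
    intro t
    have e1 : N (x + t • z) ≤ N (x + t • y) := by
      have := hc (x + t • y)
      rwa [map_add, map_smul, hx] at this
    have e2 := Real.rpow_le_rpow (h.nonneg _) e1 (by linarith : 0 ≤ p)
    refine e2.trans ?_
    have e3 := h.two x (t • y) (x + t • y) (by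
      intro j
      by_cases hj : x j = 0
      · simp [hj, Real.zero_rpow (by linarith : p ≠ 0)]
      · simp [hd j hj, Real.zero_rpow (by linarith : p ≠ 0)])
    rwa [h.smul, Real.mul_rpow (abs_nonneg _) (h.nonneg _)] at e3
  have main : ∀ t : ℝ, 0 < t → t ≤ 1 →
      (N x + δ * (c * t ^ 2)) ^ p ≤ N x ^ p + t ^ p * N y ^ p := by
    intro t ht ht1
    set w := Function.update (fun j => |x j|) i (|x i| + c * t ^ 2) with hwdef
    have f1 := hb (c * t ^ 2) (by positivity)
    have f2 := Real.rpow_le_rpow (by positivity) f1 (by linarith : 0 ≤ p)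
    refine f2.trans ?_
    have f3 := h.two (x + t • z) (x + (-t) • z) ((2 : ℝ) ^ (1 / p) • w) (by
      intro j
      rw [Pi.smul_apply, smul_eq_mul, abs_mul, Real.mul_rpow (abs_nonneg _) (abs_nonneg _),
        abs_of_nonneg (a := (2 : ℝ) ^ (1 / p)) (by positivity), ← Real.rpow_mul (by norm_num),
        one_div_mul_cancel (by linarith), Real.rpow_one]
      apply scal_aux hp (abs_nonneg _) (abs_nonneg _) (abs_nonneg _)
      simp only [sq_abs, Pi.add_apply, Pi.smul_apply, smul_eq_mul]
      by_cases hj : j = i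
      · subst hj
        simp only [hwdef, Function.update_self]
        have g1 : t ^ 4 ≤ t ^ 2 := pow_le_pow_of_le_one ht.le ht1 (by norm_num)
        have g2 := mul_le_mul_of_nonneg_left g1 (sq_nonneg c)
        have g3 := mul_le_mul_of_nonneg_right hc1 (sq_nonneg t)
        have g4 := sq_abs (x j)
        nlinarith
      · simp only [hwdef, Function.update_of_ne hj, sq_abs]
        nlinarith [sq_nonneg (t * z j)])
    rw [h.smul, Real.mul_rpow (abs_nonneg _) (h.nonneg _),
        abs_of_nonneg (a := (2 : ℝ) ^ (1 / p)) (by positivity), ← Real.rpow_mul (by norm_num),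
        one_div_mul_cancel (by linarith), Real.rpow_one] at f3
    have f4 := dis t
    have f5 := dis (-t)
    rw [abs_neg] at f5
    rw [abs_of_pos ht] at f4 f5
    linarith
  have fin : ∀ t : ℝ, 0 < t → t ≤ 1 →
      N x ^ p * (p * (δ * c / N x)) ≤ t ^ (p - 2) * N y ^ p := by
    intro t ht ht1
    have g1 := main t ht ht1
    have g2 : N x + δ * (c * t ^ 2) = N x * (1 + δ * c * t ^ 2 / N x) := by
      field_simp
    have pos : 0 ≤ δ * c * t ^ 2 / N x := by positivity
    rw [g2, Real.mul_rpow ha.le (by positivity)] at g1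
    have g3 := one_add_mul_self_le_rpow_one_add (s := δ * c * t ^ 2 / N x) (by linarith)
      (p := p) (by linarith)
    have g4 := mul_le_mul_of_nonneg_left g3 (Real.rpow_nonneg ha.le p)
    have g5 : t ^ p = t ^ (p - 2) * t ^ 2 := by
      rw [← Real.rpow_natCast, ← Real.rpow_add ht]
      congr 1
      push_cast
      ring
    rw [g5] at g1
    have t2 : 0 < t ^ 2 := by positivity
    refine le_of_mul_le_mul_right ?_ t2
    have g6 : N x ^ p * (1 + p * (δ * c * t ^ 2 / N x)) =
      N x ^ p + N x ^ p * (p * (δ * c / N x)) * t ^ 2 := by ring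
    nlinarith
  have K : 0 < N x ^ p * (p * (δ * c / N x)) := by
    have := Real.rpow_pos_of_pos ha p
    have : 0 < p := by linarith
    positivity
  have lim : Filter.Tendsto (fun t : ℝ => t ^ (p - 2) * N y ^ p) (nhdsWithin 0 (Set.Ioi 0))
      (nhds 0) := by
    have c1 : ContinuousAt (fun t : ℝ => t ^ (p - 2) * N y ^ p) 0 :=
      (Real.continuousAt_rpow_const 0 (p - 2) (Or.inr (by linarith))).mul_const _
    have c2 := c1.tendsto
    simp only [Real.zero_rpow (by linarith : p - 2 ≠ 0), zero_mul] at c2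
    exact c2.mono_left nhdsWithin_le_nhds
  have ev : ∀ᶠ t : ℝ in nhdsWithin 0 (Set.Ioi 0),
      N x ^ p * (p * (δ * c / N x)) ≤ t ^ (p - 2) * N y ^ p := by
    filter_upwards [Ioc_mem_nhdsGT (zero_lt_one (α := ℝ))] with t ht using fin t ht.1 ht.2
  have := ge_of_tendsto lim ev
  linarith

/-- coordinate restriction -/
noncomputable def R (A : Finset (Fin d)) : (Fin d → ℝ) →ₗ[ℝ] (Fin d → ℝ) where
  toFun x i := if i ∈ A then x i else 0
  map_add' x y := by ext i; simp only [Pi.add_apply]; split_ifs <;> simp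
  map_smul' c x := by ext i; simp

lemma R_apply (A : Finset (Fin d)) (x : Fin d → ℝ) (i) : R A x i = if i ∈ A then x i else 0 := rfl

lemma R_contr (h : GoodNorm d N p) (A : Finset (Fin d)) (x) : N (R A x) ≤ N x := by
  apply h.uncond
  intro i
  rw [R_apply]
  split_ifs <;> simp

lemma R_single (A : Finset (Fin d)) (i) (hi : i ∈ A) :
    R A (Pi.single i 1) = Pi.single i 1 := by
  ext j
  rw [R_apply]
  by_cases hj : j = i
  · subst hj; simp [hi]
  · simp [hj]

lemma base (Q : (Fin d → ℝ) →ₗ[ℝ] (Fin d → ℝ)) (hQ : Q ∘ₗ Q = Q) (A : Finset (Fin d))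
    (hA : ∀ x i, i ∉ A → Q x i = 0)
    (hs : ∀ x, Q x = x → x ≠ 0 → ∀ i ∈ A, x i ≠ 0) (a : Fin d) (ha : a ∈ A) :
    ∑ i ∈ A, Q (Pi.single i 1) i ≤ 1 := by
  have h1 : ∑ i ∈ A, Q (Pi.single i 1) i = LinearMap.trace ℝ _ Q := by
    rw [LinearMap.trace_eq_matrix_trace ℝ (Pi.basisFun ℝ (Fin d)), Matrix.trace]
    simp only [Matrix.diag, LinearMap.toMatrix_apply, Pi.basisFun_apply, Pi.basisFun_repr]
    exact Finset.sum_subset (Finset.subset_univ _) (fun i _ hi => hA _ _ hi)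
  have hid : IsIdempotentElem Q := hQ
  have h2 : LinearMap.trace ℝ _ Q = Module.finrank ℝ (LinearMap.range Q) := by
    exact LinearMap.IsProj.trace (LinearMap.IsIdempotentElem.isProj_range _ hid)
  rw [h1, h2]
  have h3 : Module.finrank ℝ (LinearMap.range Q) ≤ Module.finrank ℝ ℝ := by
    refine LinearMap.finrank_le_finrank_of_injective
      (f := (LinearMap.proj a).comp (LinearMap.range Q).subtype) ?_
    rw [injective_iff_map_eq_zero]
    rintro ⟨x, u, rfl⟩ hx
    by_contra hne
    refine hs (Q u) (LinearMap.congr_fun hQ u) (fun h0 => hne (Subtype.ext h0)) a ha ?_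
    exact hx
  rw [Module.finrank_self] at h3
  exact_mod_cast h3

lemma induct (h : GoodNorm d N p) (D : Fin d → ℝ) (A : Finset (Fin d)) :
    ∀ (Q : (Fin d → ℝ) →ₗ[ℝ] (Fin d → ℝ)), Q ∘ₗ Q = Q → (∀ x, N (Q x) ≤ N x) →
    (∀ x i, i ∉ A → Q x i = 0) → (∀ i ∈ A, Q (Pi.single i 1) i = D i) →
    (((A.filter (fun i => D i ≠ 1)).card : ℕ) : ℝ) ≤ 2 * ∑ i ∈ A, (1 - D i) := by
  induction A using Finset.strongInduction with
  | H A ih =>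
  intro Q hQ hc hA hD
  have hQ' : ∀ x, Q (Q x) = Q x := fun x => LinearMap.congr_fun hQ x
  by_cases hs : ∀ x, Q x = x → x ≠ 0 → ∀ i ∈ A, x i ≠ 0
  · rcases A.eq_empty_or_nonempty with rfl | ⟨a, ha⟩
    · simp
    have hb := base Q hQ A hA hs a ha
    rw [Finset.sum_congr rfl hD] at hb
    by_cases h1 : A.card ≤ 1
    · have hAa : A = {a} := Finset.eq_singleton_iff_unique_mem.2
        ⟨ha, fun b hb => Finset.card_le_one.1 h1 b hb a ha⟩
      subst hAa
      have e : Q (Pi.single a 1) = D a • Pi.single a 1 := by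
        ext j
        by_cases hj : j = a
        · subst hj; simp [hD]
        · simp [hj, hA _ j (by simpa using hj)]
      have e2 := hQ' (Pi.single a 1)
      rw [e, map_smul, e] at e2
      have e3 := congrFun e2 a
      simp only [Pi.smul_apply, Pi.single_eq_same, smul_eq_mul, mul_one] at e3
      have e4 : D a = 0 ∨ D a = 1 := by
        rcases eq_or_ne (D a) 0 with h0 | h0
        · exact Or.inl h0
        · exact Or.inr (mul_left_cancel₀ h0 (by linarith))
      rcases e4 with e3 | e3 <;> simp [e3, Finset.filter_singleton]
    · have h2 : (2 : ℝ) ≤ A.card := by exact_mod_cast (by omega : 2 ≤ A.card)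
      have h3 : ((A.filter (fun i => D i ≠ 1)).card : ℝ) ≤ A.card := by
        exact_mod_cast Finset.card_filter_le _ _
      rw [Finset.sum_sub_distrib]
      simp only [Finset.sum_const, nsmul_eq_mul, mul_one]
      linarith
  · push Not at hs
    obtain ⟨x, hx, hx0, b, hbA, hb⟩ := hs
    have hxA : ∀ i, x i ≠ 0 → i ∈ A := by
      intro i hi
      by_contra hiA
      exact hi (by rw [← hx]; exact hA _ _ hiA)
    set S := A.filter (fun i => x i ≠ 0) with hS
    set T := A.filter (fun i => ¬ x i ≠ 0) with hT
    have memS : ∀ i, i ∈ S ↔ x i ≠ 0 := fun i => by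
      rw [hS, Finset.mem_filter]; exact ⟨fun q => q.2, fun q => ⟨hxA i q, q⟩⟩
    have memT : ∀ i, i ∈ T ↔ i ∈ A ∧ x i = 0 := fun i => by
      rw [hT, Finset.mem_filter, not_not]
    have kk : ∀ y : Fin d → ℝ, (∀ i ∈ S, y i = 0) → ∀ i ∈ S, Q y i = 0 := by
      intro y hy i hi
      exact h.key Q hc x y hx (fun j hj => hy j ((memS j).2 hj)) i ((memS i).1 hi)
    have hSA : S ⊂ A := by
      refine Finset.ssubset_iff_subset_ne.2 ⟨Finset.filter_subset _ _, ?_⟩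
      intro he
      rw [← he] at hbA
      exact (memS b).1 hbA hb
    have hTA : T ⊂ A := by
      refine Finset.ssubset_iff_subset_ne.2 ⟨Finset.filter_subset _ _, ?_⟩
      intro he
      apply hx0
      ext i
      by_contra hi
      have := hxA i hi
      rw [← he] at this
      exact hi ((memT i).1 this).2
    have i1 := ih S hSA (R S ∘ₗ Q ∘ₗ R S) (by
        refine LinearMap.ext fun v => ?_
        simp only [LinearMap.comp_apply]
        ext i
        simp only [R_apply]
        split_ifs with hi
        · have e1 := kk (Q (R S v) - R S (R S (Q (R S v)))) (by
            intro j hj; simp [R_apply, hj]) i hi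
          rw [map_sub, hQ'] at e1
          have e2 : R S (R S (Q (R S v))) = R S (Q (R S v)) := by
            ext j; simp only [R_apply]; split_ifs <;> rfl
          first
          | (rw [e2] at e1 ⊢; simp only [Pi.sub_apply] at e1; linarith)
          | (simp only [Pi.sub_apply] at e1; linarith)
        · rfl)
      (fun y => (R_contr h S _).trans ((hc _).trans (R_contr h S _)))
      (fun y i hi => by simp [R_apply, hi])
      (fun i hi => by
        simp only [LinearMap.comp_apply]
        rw [R_single S i hi, R_apply, if_pos hi]
        exact hD i (hSA.1 hi))
    have RT : ∀ y, R T (Q (R T y)) = Q (R T y) := by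
      intro y
      ext i
      rw [R_apply]
      split_ifs with hi
      · rfl
      · by_cases hiA : i ∈ A
        · refine (kk _ ?_ i ?_).symm
          · intro j hj
            rw [R_apply, if_neg]
            intro hj2
            exact (memS j).1 hj ((memT j).1 hj2).2
          · rw [memS]
            intro h0
            exact hi ((memT i).2 ⟨hiA, h0⟩)
        · exact (hA _ _ hiA).symm
    have i2 := ih T hTA (R T ∘ₗ Q ∘ₗ R T) (by
        refine LinearMap.ext fun v => ?_
        simp only [LinearMap.comp_apply]
        rw [RT, RT, RT, hQ'])
      (fun y => (R_contr h T _).trans ((hc _).trans (R_contr h T _)))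
      (fun y i hi => by simp [R_apply, hi])
      (fun i hi => by
        simp only [LinearMap.comp_apply]
        rw [R_single T i hi, R_apply, if_pos hi]
        exact hD i (hTA.1 hi))
    have s1 : ∑ i ∈ S, (1 - D i) + ∑ i ∈ T, (1 - D i) = ∑ i ∈ A, (1 - D i) :=
      Finset.sum_filter_add_sum_filter_not _ _ _
    have s2 : (S.filter (fun i => D i ≠ 1)).card + (T.filter (fun i => D i ≠ 1)).card
        = (A.filter (fun i => D i ≠ 1)).card := by
      simp only [Finset.card_filter]
      exact Finset.sum_filter_add_sum_filter_not _ _ _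
    rw [← s1, ← s2]
    push_cast
    linarith

end GoodNorm


theorem stmt0 (d n : ℕ) (hd : 3 ≤ d)
    (N : (Fin d → ℝ) → ℝ)
    (hN_add : ∀ x y, N (x + y) ≤ N x + N y)
    (hN_smul : ∀ (c : ℝ) (x), N (c • x) = |c| * N x)
    (hN_def : ∀ x, N x = 0 → x = 0)
    (hN_uncond : ∀ x y : Fin d → ℝ, (∀ i, |x i| ≤ |y i|) → N x ≤ N y)
    (hN_strict : ∀ x y : Fin d → ℝ, (∀ i, |x i| ≤ |y i|) →
      (∃ i, |x i| < |y i|) → N x < N y)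
    (p : ℝ) (hp : 2 < p)
    (hN_pconv : ∀ (m : ℕ) (xs : Fin m → (Fin d → ℝ)),
      N (fun i => (∑ j, |xs j i| ^ p) ^ (1 / p)) ≤
        (∑ j, N (xs j) ^ p) ^ (1 / p))
    (F : Submodule ℝ (Fin d → ℝ))
    (P : (Fin d → ℝ) →ₗ[ℝ] (Fin d → ℝ))
    (hP_proj : P ∘ₗ P = P)
    (hP_range : LinearMap.range P = F)
    (hP_contr : ∀ x, N (P x) ≤ N x)
    (h_codim : Module.finrank ℝ ((Fin d → ℝ) ⧸ F) = n) :
    {i : Fin d | (Pi.single i 1 : Fin d → ℝ) ∉ F}.ncard ≤ 2 * n := by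
  have h : GoodNorm d N p := ⟨hN_add, hN_smul, hN_def, hN_uncond, hN_strict, hp, hN_pconv⟩
  have hid : IsIdempotentElem P := hP_proj
  have i1 := h.induct (fun i => P (Pi.single i 1) i) Finset.univ P hP_proj hP_contr
    (by simp) (by simp)
  have h1 : ∑ i, P (Pi.single i 1) i = LinearMap.trace ℝ _ P := by
    rw [LinearMap.trace_eq_matrix_trace ℝ (Pi.basisFun ℝ (Fin d)), Matrix.trace]
    simp only [Matrix.diag, LinearMap.toMatrix_apply, Pi.basisFun_apply, Pi.basisFun_repr]
  have h2 : LinearMap.trace ℝ _ P = Module.finrank ℝ (LinearMap.range P) := by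
    exact LinearMap.IsProj.trace (LinearMap.IsIdempotentElem.isProj_range _ hid)
  have h3 := Submodule.finrank_quotient_add_finrank F
  rw [h_codim, Module.finrank_fin_fun] at h3
  have h4 : (n : ℝ) + Module.finrank ℝ F = d := by exact_mod_cast h3
  rw [Finset.sum_sub_distrib, h1, h2, hP_range] at i1
  simp only [Finset.sum_const, Finset.card_univ, Fintype.card_fin, nsmul_eq_mul, mul_one] at i1
  have h5 : {i : Fin d | (Pi.single i 1 : Fin d → ℝ) ∉ F} ⊆
      ((Finset.univ.filter (fun i => P (Pi.single i 1) i ≠ 1) : Finset (Fin d)) : Set (Fin d)) := by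
    intro i hi
    simp only [Finset.coe_filter, Finset.mem_univ, true_and, Set.mem_setOf_eq] at hi ⊢
    intro h1
    apply hi
    rw [← hP_range]
    refine ⟨Pi.single i 1, ?_⟩
    by_contra hne
    refine absurd (hP_contr (Pi.single i 1)) (not_le.2 (hN_strict _ _ ?_ ?_))
    · intro j
      by_cases hj : j = i
      · subst hj; simp [h1]
      · simp [hj]
    · by_contra hno
      push Not at hno
      apply hne
      ext j
      by_cases hj : j = i
      · subst hj; simp [h1]
      · have := hno j
        simpa [hj] using this
  have h6 := Set.ncard_le_ncard h5 (Finset.finite_toSet _)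
  rw [Set.ncard_coe_finset] at h6
  refine h6.trans ?_
  have : (((Finset.univ.filter (fun i => P (Pi.single i 1) i ≠ 1) : Finset (Fin d)).card : ℕ) : ℝ)
      ≤ ((2 * n : ℕ) : ℝ) := by
    push_cast
    linarith
  exact_mod_cast this
end

section
/- Let d ≥ 3 be a natural number and let X = (Fin d → ℝ) carry a 1-unconditional, strictly monotone norm which is one-q-concave for some q with 1 < q < 2 and which is smooth at each standard basis vector e_i. Then every 1-complemented linear subspace F of X of finite codimension n contains all but at most 2n of the standard basis vectors; that is, the set {i : e_i ∉ F} has at most 2n elements. -/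
lemma aux_scalar (q : ℝ) (hq1 : 1 < q) (hq2 : q < 2) (a b c : ℝ) (hb : b ^ 2 ≤ c * a ^ 2) (hc : 0 ≤ c) :
    |a + b| ^ q + |a - b| ^ q ≤ 2 * (1 + c) * |a| ^ q := by
  have hq0 : 0 < q := by linarith
  have h1 : ((1/2:ℝ) * |a + b| ^ q + (1/2) * |a - b| ^ q) ^ (2 / q) ≤
      (1/2) * (|a + b| ^ q) ^ (2 / q) + (1/2) * (|a - b| ^ q) ^ (2 / q) :=
    (convexOn_rpow (p := 2 / q) (by rw [le_div_iff₀ hq0]; linarith)).2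
      (Set.mem_Ici.2 (by positivity)) (Set.mem_Ici.2 (by positivity)) (by norm_num) (by norm_num) (by norm_num)
  have e : ∀ z : ℝ, (|z| ^ q) ^ (2 / q) = z ^ 2 := by
    intro z
    rw [← Real.rpow_mul (abs_nonneg _), mul_div_cancel₀ _ hq0.ne']
    simp
  rw [e, e] at h1
  have h2 : ((1/2:ℝ) * |a + b| ^ q + (1/2) * |a - b| ^ q) ^ (2 / q) ≤ (1 + c) * a ^ 2 := by
    nlinarith
  have h3 : (1/2:ℝ) * |a + b| ^ q + (1/2) * |a - b| ^ q ≤ ((1 + c) * a ^ 2) ^ (q / 2) := by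
    have := Real.rpow_le_rpow (by positivity) h2 (by positivity : 0 ≤ q / 2)
    rw [← Real.rpow_mul (by positivity)] at this
    have h : 2 / q * (q / 2) = 1 := by field_simp
    rwa [h, Real.rpow_one] at this
  have h4 : ((1 + c) * a ^ 2) ^ (q / 2) ≤ (1 + c) * |a| ^ q := by
    rw [Real.mul_rpow (by positivity) (by positivity)]
    have : (a ^ 2) ^ (q / 2) = |a| ^ q := by
      rw [← sq_abs, ← Real.rpow_natCast, ← Real.rpow_mul (abs_nonneg _)]
      congr 1; push_cast; ring
    rw [this]
    gcongr
    calc (1 + c) ^ (q / 2) ≤ (1 + c) ^ (1:ℝ) :=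
          Real.rpow_le_rpow_of_exponent_le (by linarith) (by linarith)
      _ = 1 + c := Real.rpow_one _
  linarith

lemma aux_small (q : ℝ) (hq2 : q < 2) (B C : ℝ) (hB : 0 ≤ B)
    (h : ∀ t : ℝ, 0 < t → t ^ q * B ≤ C * t ^ 2) : B = 0 := by
  have h' : ∀ t : ℝ, 0 < t → B ≤ C * t ^ (2 - q) := by
    intro t ht
    have := h t ht
    rw [Real.rpow_sub ht, Real.rpow_two, ← mul_div_assoc, le_div_iff₀ (by positivity)]
    linarith
  have hc : Filter.Tendsto (fun t : ℝ => C * t ^ (2 - q)) (nhdsWithin 0 (Set.Ioi 0)) (nhds (C * 0 ^ (2 - q))) := by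
    refine Filter.Tendsto.mono_left ?_ nhdsWithin_le_nhds
    exact ((Real.continuousAt_rpow_const 0 (2 - q) (Or.inr (by linarith))).tendsto).const_mul C
  have : B ≤ C * 0 ^ (2 - q) := by
    refine ge_of_tendsto hc ?_
    filter_upwards [self_mem_nhdsWithin] with t ht using h' t ht
  rw [Real.zero_rpow (by linarith)] at this
  linarith

lemma key_inv (d : ℕ)
    (N : (Fin d → ℝ) → ℝ)
    (hN_add : ∀ x y, N (x + y) ≤ N x + N y)
    (hN_smul : ∀ (c : ℝ) (x), N (c • x) = |c| * N x)
    (hN_def : ∀ x, N x = 0 → x = 0)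
    (hN_uncond : ∀ x y : Fin d → ℝ, (∀ i, |x i| ≤ |y i|) → N x ≤ N y)
    (q : ℝ) (hq1 : 1 < q) (hq2 : q < 2)
    (hN_qconc : ∀ (m : ℕ) (xs : Fin m → (Fin d → ℝ)),
      (∑ j, N (xs j) ^ q) ^ (1 / q) ≤
        N (fun i => (∑ j, |xs j i| ^ q) ^ (1 / q)))
    (P : (Fin d → ℝ) →ₗ[ℝ] (Fin d → ℝ))
    (hP_contr : ∀ x, N (P x) ≤ N x)
    (x : Fin d → ℝ) (hx : P x = x) (h : Fin d → ℝ) (hh : ∀ i, x i = 0 → h i = 0) :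
    ∀ i, x i = 0 → P h i = 0 := by
  have hq0 : 0 < q := by linarith
  have hN0 : N 0 = 0 := by simpa using hN_smul 0 0
  have hNn : ∀ y, 0 ≤ N y := fun y => by
    rw [← hN0]; exact hN_uncond _ _ (fun i => by simp)
  -- two-vector q-concavity
  have hq : ∀ u v w : Fin d → ℝ, (∀ i, |u i| ^ q + |v i| ^ q ≤ |w i| ^ q) →
      N u ^ q + N v ^ q ≤ N w ^ q := by
    intro u v w huv
    have h1 := hN_qconc 2 ![u, v]
    simp only [Fin.sum_univ_two, Matrix.cons_val_zero, Matrix.cons_val_one] at h1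
    have h2 : N (fun i => (|u i| ^ q + |v i| ^ q) ^ (1 / q)) ≤ N w := by
      apply hN_uncond
      intro i
      rw [abs_of_nonneg (by positivity)]
      calc (|u i| ^ q + |v i| ^ q) ^ (1 / q) ≤ (|w i| ^ q) ^ (1 / q) :=
            Real.rpow_le_rpow (by positivity) (huv i) (by positivity)
        _ = |w i| := by
            rw [← Real.rpow_mul (abs_nonneg _), mul_one_div_cancel hq0.ne', Real.rpow_one]
    have hp : 0 ≤ N u ^ q + N v ^ q :=
      add_nonneg (Real.rpow_nonneg (hNn _) _) (Real.rpow_nonneg (hNn _) _)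
    have h3 := Real.rpow_le_rpow (Real.rpow_nonneg hp _) (h1.trans h2) hq0.le
    rwa [← Real.rpow_mul hp, one_div_mul_cancel hq0.ne', Real.rpow_one] at h3
  set g := P h with hg
  let gA : Fin d → ℝ := fun i => if x i = 0 then 0 else g i
  let b : Fin d → ℝ := fun i => if x i = 0 then g i else 0
  let C : ℝ := ∑ i, (h i / x i) ^ 2
  have hC : 0 ≤ C := Finset.sum_nonneg (fun i _ => sq_nonneg _)
  -- upper bound
  have upper : ∀ t : ℝ, N (x + t • h) ^ q + N (x - t • h) ^ q ≤ 2 * (1 + C * t ^ 2) * N x ^ q := by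
    intro t
    have hK : 0 ≤ 2 * (1 + C * t ^ 2) := by positivity
    have h1 := hq (x + t • h) (x - t • h) ((2 * (1 + C * t ^ 2)) ^ (1 / q) • x) (by
      intro i
      have h2 := aux_scalar q hq1 hq2 (x i) (t * h i) (C * t ^ 2) (by
        by_cases hxi : x i = 0
        · simp [hxi, hh i hxi]
        · have h3 : (h i / x i) ^ 2 ≤ C :=
            Finset.single_le_sum (f := fun i => (h i / x i) ^ 2) (fun i _ => sq_nonneg _) (Finset.mem_univ i)
          rw [div_pow, div_le_iff₀ (by positivity)] at h3
          nlinarith [sq_nonneg t]) (by positivity)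
      simp only [Pi.add_apply, Pi.sub_apply, Pi.smul_apply, smul_eq_mul]
      refine h2.trans (le_of_eq ?_)
      rw [abs_mul, Real.mul_rpow (abs_nonneg _) (abs_nonneg _),
        abs_of_nonneg (Real.rpow_nonneg hK _), ← Real.rpow_mul hK, one_div_mul_cancel hq0.ne', Real.rpow_one])
    refine h1.trans (le_of_eq ?_)
    rw [hN_smul, Real.mul_rpow (abs_nonneg _) (hNn _),
        abs_of_nonneg (Real.rpow_nonneg hK _), ← Real.rpow_mul hK, one_div_mul_cancel hq0.ne', Real.rpow_one]
  have low1 : ∀ t : ℝ, N (x + t • gA) ^ q + |t| ^ q * N b ^ q ≤ N (x + t • h) ^ q := by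
    intro t
    have h1 := hq (x + t • gA) (t • b) (x + t • g) (by
      intro i
      by_cases hxi : x i = 0
      · simp [gA, b, hxi, Real.zero_rpow hq0.ne']
      · simp [gA, b, hxi, Real.zero_rpow hq0.ne'])
    rw [hN_smul, Real.mul_rpow (abs_nonneg _) (hNn _)] at h1
    refine h1.trans ?_
    refine Real.rpow_le_rpow (hNn _) ?_ hq0.le
    have h2 := hP_contr (x + t • h)
    rwa [map_add, map_smul, hx] at h2
  have low2 : ∀ t : ℝ, 2 * N x ^ q ≤ N (x + t • gA) ^ q + N (x - t • gA) ^ q := by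
    intro t
    have h1 : N x ≤ (1/2) * N (x + t • gA) + (1/2) * N (x - t • gA) := by
      have h2 := hN_add (x + t • gA) (x - t • gA)
      have h3 : (x + t • gA) + (x - t • gA) = (2:ℝ) • x := by
        rw [two_smul]; abel
      rw [h3, hN_smul, abs_two] at h2
      linarith
    have h4 : ((1/2:ℝ) * N (x + t • gA) + (1/2) * N (x - t • gA)) ^ q ≤
      (1/2) * (N (x + t • gA)) ^ q + (1/2) * (N (x - t • gA)) ^ q :=
      (convexOn_rpow hq1.le).2 (Set.mem_Ici.2 (hNn _)) (Set.mem_Ici.2 (hNn _))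
        (by norm_num) (by norm_num) (by norm_num)
    have h5 := Real.rpow_le_rpow (hNn _) h1 hq0.le
    linarith
  have hb : N b ^ q = 0 := by
    refine aux_small q hq2 _ (C * N x ^ q) (Real.rpow_nonneg (hNn _) _) ?_
    intro t ht
    have h1 := upper t
    have h2 := low1 t
    have h3 := low1 (-t)
    have h4 := low2 t
    rw [abs_neg, neg_smul, neg_smul, ← sub_eq_add_neg, ← sub_eq_add_neg] at h3
    rw [abs_of_pos ht] at h2 h3
    nlinarith
  have hb0 : b = 0 := hN_def _ ((Real.rpow_eq_zero (hNn _) hq0.ne').1 hb)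
  intro i hi
  have := congrFun hb0 i
  simpa [b, hi] using this

lemma min_vec (d : ℕ) (F : Submodule ℝ (Fin d → ℝ)) (i : Fin d) (hi : ∃ x ∈ F, x i ≠ 0) :
    ∃ x ∈ F, x i ≠ 0 ∧ ∀ y ∈ F, (∀ j, x j = 0 → y j = 0) → ∃ c : ℝ, y = c • x := by
  classical
  let s : (Fin d → ℝ) → ℕ := fun x => (Finset.univ.filter (fun j => x j ≠ 0)).card
  have hex : ∃ n, ∃ x ∈ F, x i ≠ 0 ∧ s x = n := by
    obtain ⟨x, hx, hxi⟩ := hi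
    exact ⟨_, x, hx, hxi, rfl⟩
  obtain ⟨x, hx, hxi, hs⟩ := Nat.find_spec hex
  refine ⟨x, hx, hxi, ?_⟩
  intro y hy hsub
  refine ⟨y i / x i, ?_⟩
  by_contra hne
  set z := y - (y i / x i) • x with hz
  have hzF : z ∈ F := F.sub_mem hy (F.smul_mem _ hx)
  have hzi : z i = 0 := by simp [hz, hxi]
  have hz0 : z ≠ 0 := fun h => hne (sub_eq_zero.1 h)
  obtain ⟨j, hj⟩ := Function.ne_iff.1 hz0
  simp only [Pi.zero_apply] at hj
  have hzs : ∀ k, x k = 0 → z k = 0 := fun k hk => by simp [hz, hk, hsub k hk]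
  have hxj : x j ≠ 0 := fun h => hj (hzs j h)
  let w := x - (x j / z j) • z
  have hwF : w ∈ F := F.sub_mem hx (F.smul_mem _ hzF)
  have hwi : w i ≠ 0 := by simp [w, hzi, hxi]
  have hlt : s w < s x := by
    apply Finset.card_lt_card
    rw [Finset.ssubset_iff_of_subset]
    · refine ⟨j, by simp [hxj], by simp [w, hj]⟩
    · intro k hk
      simp only [Finset.mem_filter, Finset.mem_univ, true_and] at hk ⊢
      intro h0
      exact hk (by simp [w, h0, hzs k h0])
  rw [hs] at hlt
  exact Nat.find_min hex hlt ⟨w, hwF, hwi, rfl⟩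



theorem stmt1 (d n : ℕ) (hd : 3 ≤ d)
    (N : (Fin d → ℝ) → ℝ)
    (hN_add : ∀ x y, N (x + y) ≤ N x + N y)
    (hN_smul : ∀ (c : ℝ) (x), N (c • x) = |c| * N x)
    (hN_def : ∀ x, N x = 0 → x = 0)
    (hN_uncond : ∀ x y : Fin d → ℝ, (∀ i, |x i| ≤ |y i|) → N x ≤ N y)
    (hN_strict : ∀ x y : Fin d → ℝ, (∀ i, |x i| ≤ |y i|) →
      (∃ i, |x i| < |y i|) → N x < N y)
    (q : ℝ) (hq1 : 1 < q) (hq2 : q < 2)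
    (hN_qconc : ∀ (m : ℕ) (xs : Fin m → (Fin d → ℝ)),
      (∑ j, N (xs j) ^ q) ^ (1 / q) ≤
        N (fun i => (∑ j, |xs j i| ^ q) ^ (1 / q)))
    (hN_smooth : ∀ i : Fin d, ∃! f : (Fin d → ℝ) →ₗ[ℝ] ℝ,
      (∀ y, |f y| ≤ N y) ∧ f ((Pi.single i 1 : Fin d → ℝ)) = N ((Pi.single i 1 : Fin d → ℝ)))
    (F : Submodule ℝ (Fin d → ℝ))
    (P : (Fin d → ℝ) →ₗ[ℝ] (Fin d → ℝ))
    (hP_proj : P ∘ₗ P = P)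
    (hP_range : LinearMap.range P = F)
    (hP_contr : ∀ x, N (P x) ≤ N x)
    (h_codim : Module.finrank ℝ ((Fin d → ℝ) ⧸ F) = n) :
    {i : Fin d | (Pi.single i 1 : Fin d → ℝ) ∉ F}.ncard ≤ 2 * n := by
  classical
  have hPF : ∀ x, P x ∈ F := fun x => hP_range ▸ LinearMap.mem_range_self P x
  have hPid : ∀ x ∈ F, P x = x := by
    intro x hx
    rw [← hP_range] at hx
    obtain ⟨y, rfl⟩ := hx
    exact LinearMap.congr_fun hP_proj y
  let e : Fin d → (Fin d → ℝ) := fun i => Pi.single i 1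
  have key := key_inv d N hN_add hN_smul hN_def hN_uncond q hq1 hq2 hN_qconc P hP_contr
  -- if x in F has x i nonzero then P e_i is nonzero
  have hPe : ∀ x ∈ F, ∀ i, x i ≠ 0 → P (e i) ≠ 0 := by
    intro x hx i hi h0
    have h1 : N (x - x i • e i) < N x := by
      apply hN_strict
      · intro j
        by_cases hj : j = i
        · subst hj; simp [e]
        · simp [e, hj]
      · exact ⟨i, by simp [e, hi]⟩
    have h2 := hP_contr (x - x i • e i)
    rw [map_sub, map_smul, h0, hPid x hx, smul_zero, sub_zero] at h2
    linarith
  -- trace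
  have htr : ∑ i, P (e i) i = (Module.finrank ℝ F : ℝ) := by
    have h1 : LinearMap.IsProj F P := ⟨hPF, hPid⟩
    rw [← h1.trace, LinearMap.trace_eq_matrix_trace ℝ (Pi.basisFun ℝ (Fin d)) P]
    simp [Matrix.trace, LinearMap.toMatrix_apply, e]
  have hdim : n + Module.finrank ℝ F = d := by
    have := Submodule.finrank_quotient_add_finrank F
    rw [h_codim] at this
    simpa using this
  let K : Finset (Fin d) := Finset.univ.filter (fun i => e i ∉ F)
  have hK : {i : Fin d | (Pi.single i 1 : Fin d → ℝ) ∉ F}.ncard = K.card := by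
    rw [← Set.ncard_coe_finset]; congr 1; ext i; simp [K, e]
  rw [hK]
  let S : Finset (Fin d) := K.filter (fun i => ∃ x ∈ F, x i ≠ 0)
  have hm : ∀ i : Fin d, ∃ x : Fin d → ℝ, (∃ x ∈ F, x i ≠ 0) → (x ∈ F ∧ x i ≠ 0 ∧
      ∀ y ∈ F, (∀ j, x j = 0 → y j = 0) → ∃ c : ℝ, y = c • x) := by
    intro i
    by_cases h : ∃ x ∈ F, x i ≠ 0
    · obtain ⟨x, h1, h2, h3⟩ := min_vec d F i h
      exact ⟨x, fun _ => ⟨h1, h2, h3⟩⟩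
    · exact ⟨0, fun h' => absurd h' h⟩
  choose m hm using hm
  let A : Fin d → Finset (Fin d) := fun i => Finset.univ.filter (fun j => m i j ≠ 0)
  have hmul : ∀ i ∈ S, ∀ j ∈ A i, ∃ c : ℝ, P (e j) = c • m i := by
    intro i hi j hj
    have hj' : m i j ≠ 0 := by simpa [A] using hj
    obtain ⟨h1, h2, h3⟩ := hm i (Finset.mem_filter.1 hi).2
    refine h3 _ (hPF _) (key (m i) (hPid _ h1) (e j) ?_)
    intro k hk
    have : k ≠ j := fun h => hj' (h ▸ hk)
    simp [e, this]
  have hAS : ∀ i ∈ S, A i ⊆ S := by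
    intro i hi j hj
    have hj' : m i j ≠ 0 := by simpa [A] using hj
    obtain ⟨h1, h2, h3⟩ := hm i (Finset.mem_filter.1 hi).2
    have hiK : e i ∉ F := by
      have := (Finset.mem_filter.1 hi).1
      simpa [K] using this
    refine Finset.mem_filter.2 ⟨?_, m i, h1, hj'⟩
    simp only [K, Finset.mem_filter, Finset.mem_univ, true_and]
    intro hjF
    obtain ⟨c, hc⟩ := hmul i hi j hj
    rw [hPid _ hjF] at hc
    have hcj : c ≠ 0 := by
      rintro rfl
      have := congrFun hc j
      simp [e] at this
    have hij : i = j := by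
      by_contra hne
      have := congrFun hc i
      simp [e, hne, hcj, h2] at this
    exact hiK (hij ▸ hjF)
  have hAeq : ∀ i ∈ S, ∀ j ∈ A i, A j = A i := by
    intro i hi j hj
    have hjS := hAS i hi hj
    obtain ⟨h1, h2, h3⟩ := hm j (Finset.mem_filter.1 hjS).2
    obtain ⟨c, hc⟩ := hmul i hi j hj
    obtain ⟨c', hc'⟩ := hmul j hjS j (by simpa [A] using h2)
    have hne := hPe _ h1 j h2
    have hc0 : c ≠ 0 := by rintro rfl; exact hne (by simpa using hc)
    have hc0' : c' ≠ 0 := by rintro rfl; exact hne (by simpa using hc')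
    ext k
    have := congrFun (hc.symm.trans hc') k
    simp only [Pi.smul_apply, smul_eq_mul] at this
    simp only [A, Finset.mem_filter, Finset.mem_univ, true_and]
    constructor
    · intro hk h0
      rw [h0, mul_zero] at this
      exact (mul_ne_zero hc0' hk) this.symm
    · intro hk h0
      rw [h0, mul_zero] at this
      exact (mul_ne_zero hc0 hk) this
  have hself : ∀ i ∈ S, i ∈ A i := by
    intro i hi
    have := (hm i (Finset.mem_filter.1 hi).2).2.1
    simpa [A] using this
  have hfib : ∀ i ∈ S, S.filter (fun j => A j = A i) = A i := by
    intro i hi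
    ext j
    simp only [Finset.mem_filter]
    constructor
    · rintro ⟨hj, hji⟩
      rw [← hji]; exact hself j hj
    · intro hj
      exact ⟨hAS i hi hj, hAeq i hi j hj⟩
  have hsum : ∀ i ∈ S, ∑ j ∈ A i, P (e j) j = 1 := by
    intro i hi
    obtain ⟨h1, h2, h3⟩ := hm i (Finset.mem_filter.1 hi).2
    have hc : ∀ j, ∃ c : ℝ, j ∈ A i → P (e j) = c • m i := by
      intro j
      by_cases hj : j ∈ A i
      · obtain ⟨c, hc⟩ := hmul i hi j hj
        exact ⟨c, fun _ => hc⟩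
      · exact ⟨0, fun h => absurd h hj⟩
    choose c hc using hc
    have hexp : m i = ∑ j ∈ A i, m i j • e j := by
      ext k
      simp only [Finset.sum_apply, Pi.smul_apply, smul_eq_mul, e, Pi.single_apply]
      by_cases hk : m i k = 0
      · rw [hk, Finset.sum_eq_zero]
        intro j hj
        have hj' : m i j ≠ 0 := by simpa [A] using hj
        have : k ≠ j := fun h => hj' (h ▸ hk)
        simp [this]
      · rw [Finset.sum_eq_single k]
        · simp
        · intro j _ hj; simp [hj.symm]
        · intro h; exact absurd (by simpa [A] using hk) h
    have h4 : m i = ∑ j ∈ A i, (m i j * c j) • m i := by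
      conv_lhs => rw [← hPid _ h1, hexp, map_sum]
      refine Finset.sum_congr rfl (fun j hj => ?_)
      rw [map_smul, hc j hj, smul_smul]
    have h5 := congrFun h4 i
    rw [← Finset.sum_smul, Pi.smul_apply, smul_eq_mul] at h5
    have h6 : ∑ j ∈ A i, m i j * c j = 1 := by
      have : (∑ j ∈ A i, m i j * c j - 1) * m i i = 0 := by linarith
      rcases mul_eq_zero.1 this with h | h
      · linarith
      · exact absurd h h2
    rw [← h6]
    refine Finset.sum_congr rfl (fun j hj => ?_)
    rw [hc j hj, Pi.smul_apply, smul_eq_mul, mul_comm]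
  have hcard2 : ∀ i ∈ S, 2 ≤ (A i).card := by
    intro i hi
    by_contra hlt
    have hiK : e i ∉ F := by
      have := (Finset.mem_filter.1 hi).1
      simpa [K] using this
    obtain ⟨h1, h2, h3⟩ := hm i (Finset.mem_filter.1 hi).2
    have hle : (A i).card ≤ 1 := by omega
    have huniq := Finset.card_le_one.1 hle
    apply hiK
    have : e i = (m i i)⁻¹ • m i := by
      ext k
      by_cases hk : k = i
      · subst hk; simp [e, h2]
      · have : m i k = 0 := by
          by_contra h
          exact hk (huniq k (by simpa [A] using h) i (hself i hi))
        simp [e, hk, this]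
    rw [this]
    exact F.smul_mem _ h1
  have hSsum : ∑ i ∈ S, P (e i) i = ((S.image A).card : ℝ) := by
    rw [← Finset.sum_fiberwise_of_maps_to (t := S.image A) (g := A)
      (fun i hi => Finset.mem_image_of_mem A hi)]
    rw [Finset.card_eq_sum_ones, Nat.cast_sum]
    refine Finset.sum_congr rfl (fun B hB => ?_)
    obtain ⟨i, hi, rfl⟩ := Finset.mem_image.1 hB
    rw [hfib i hi, hsum i hi]; simp
  have hScard : 2 * (S.image A).card ≤ S.card := by
    rw [Finset.card_eq_sum_card_image A S, mul_comm, ← smul_eq_mul]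
    refine Finset.card_nsmul_le_sum _ _ _ (fun B hB => ?_)
    obtain ⟨i, hi, rfl⟩ := Finset.mem_image.1 hB
    rw [hfib i hi]; exact hcard2 i hi
  have hKsum : ∑ i ∈ K, P (e i) i = ∑ i ∈ S, P (e i) i := by
    symm
    apply Finset.sum_subset (Finset.filter_subset _ _)
    intro i hiK hiS
    by_contra h
    exact hiS (Finset.mem_filter.2 ⟨hiK, _, hPF (e i), h⟩)
  have hKc : ∑ i ∈ Kᶜ, P (e i) i = (Kᶜ.card : ℝ) := by
    rw [Finset.card_eq_sum_ones, Nat.cast_sum]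
    refine Finset.sum_congr rfl (fun i hi => ?_)
    have hiF : e i ∈ F := by simpa [K] using hi
    rw [hPid _ hiF]; simp [e]
  have htot := Finset.sum_add_sum_compl K (fun i => P (e i) i)
  rw [hKsum, hSsum, hKc, htr] at htot
  have htot' : (S.image A).card + Kᶜ.card = Module.finrank ℝ F := by exact_mod_cast htot
  have hKK : K.card + Kᶜ.card = d := by simpa using Finset.card_add_card_compl K
  have hSK : S.card ≤ K.card := Finset.card_le_card (Finset.filter_subset _ _)
  omega
end

section
/- Let X = (Fin d → ℝ) carry a 1-unconditional norm which is one-p-convex for some p with 2 < p < ∞, and let P : X → X be a linear projection (P ∘ P = P). Suppose there exist x, y ∈ X with x ≠ 0, supp x ∩ supp y = ∅, P x = x, and supp x ⊆ supp (P y). Then ‖P‖ > 1; that is, there exists z ∈ X with ‖P z‖ > ‖z‖. -/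
lemma aux_coord (a s δ t p : ℝ) (hp : 2 < p) (hδ : 0 ≤ δ) (h : δ * t ^ 2 * a ^ 2 ≤ s ^ 2) :
    2 * (1 + δ * t ^ 2) * |a| ^ p ≤ |a + s| ^ p + |a - s| ^ p := by
  have hq : 1 ≤ p / 2 := by linarith
  have key : ∀ u : ℝ, |u| ^ p = (u ^ 2) ^ (p / 2) := by
    intro u
    rw [← sq_abs, ← Real.rpow_natCast, ← Real.rpow_mul (abs_nonneg u)]
    congr 1
    push_cast
    ring
  have hconv := convexOn_rpow hq
  have hhalf : (0 : ℝ) ≤ 1 / 2 := by norm_num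
  have hc := hconv.2 (Set.mem_Ici.2 (sq_nonneg (a + s))) (Set.mem_Ici.2 (sq_nonneg (a - s)))
    hhalf hhalf (by norm_num)
  simp only [smul_eq_mul] at hc
  have e : 1 / 2 * (a + s) ^ 2 + 1 / 2 * (a - s) ^ 2 = a ^ 2 + s ^ 2 := by ring
  rw [e] at hc
  have hnn : 0 ≤ δ * t ^ 2 := by positivity
  have h1 : ((1 + δ * t ^ 2) * a ^ 2) ^ (p / 2) ≤ (a ^ 2 + s ^ 2) ^ (p / 2) := by
    apply Real.rpow_le_rpow (by positivity) (by linarith) (by linarith)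
  rw [Real.mul_rpow (by positivity) (by positivity)] at h1
  have h2 : 1 + δ * t ^ 2 ≤ (1 + δ * t ^ 2) ^ (p / 2) :=
    Real.self_le_rpow_of_one_le (by linarith) hq
  rw [key, key, key]
  have h3 := mul_le_mul_of_nonneg_right h2 (Real.rpow_nonneg (sq_nonneg a) (p / 2))
  linarith

theorem stmt2 (d : ℕ)
    (N : (Fin d → ℝ) → ℝ)
    (hN_add : ∀ x y, N (x + y) ≤ N x + N y)
    (hN_smul : ∀ (c : ℝ) (x), N (c • x) = |c| * N x)
    (hN_def : ∀ x, N x = 0 → x = 0)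
    (hN_uncond : ∀ x y : Fin d → ℝ, (∀ i, |x i| ≤ |y i|) → N x ≤ N y)
    (p : ℝ) (hp : 2 < p)
    (hN_pconv : ∀ (m : ℕ) (xs : Fin m → (Fin d → ℝ)),
      N (fun i => (∑ j, |xs j i| ^ p) ^ (1 / p)) ≤
        (∑ j, N (xs j) ^ p) ^ (1 / p))
    (P : (Fin d → ℝ) →ₗ[ℝ] (Fin d → ℝ))
    (hP_proj : P ∘ₗ P = P)
    (x y : Fin d → ℝ)
    (hx : x ≠ 0)
    (hdisj : {i : Fin d | x i ≠ 0} ∩ {i : Fin d | y i ≠ 0} = ∅)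
    (hPx : P x = x)
    (hsupp : {i : Fin d | x i ≠ 0} ⊆ {i : Fin d | P y i ≠ 0}) :
    ∃ z : Fin d → ℝ, N z < N (P z) := by
  by_contra hcon
  push Not at hcon
  have hp0 : 0 < p := by linarith
  have hp0' : p ≠ 0 := hp0.ne'
  have hip : 0 < 1 / p := by positivity
  have hN0 : N 0 = 0 := by
    have := hN_smul 0 0
    simpa using this
  have hNn : ∀ v, 0 ≤ N v := by
    intro v
    rw [← hN0]
    exact hN_uncond 0 v (fun i => by simp)
  have hNx : 0 < N x := lt_of_le_of_ne (hNn x) (fun h => hx (hN_def x h.symm))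
  set w := P y with hw
  have hδ : ∃ δ : ℝ, 0 < δ ∧ ∀ i, δ * x i ^ 2 ≤ w i ^ 2 := by
    obtain ⟨i0, _⟩ : ∃ i, x i ≠ 0 := Function.ne_iff.1 hx
    have : Nonempty (Fin d) := ⟨i0⟩
    obtain ⟨j, hj⟩ := Finite.exists_min (fun i => if x i = 0 then (1 : ℝ) else (w i / x i) ^ 2)
    refine ⟨if x j = 0 then (1 : ℝ) else (w j / x j) ^ 2, ?_, fun i => ?_⟩
    · split_ifs with h
      · norm_num
      · have : w j ≠ 0 := hsupp h
        positivity
    · by_cases h : x i = 0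
      · rw [h]
        simp only [ne_eq, OfNat.ofNat_ne_zero, not_false_eq_true, zero_pow, mul_zero]
        positivity
      · have := hj i
        simp only [h, if_false] at this
        have h2 := mul_le_mul_of_nonneg_right this (sq_nonneg (x i))
        rwa [← mul_pow, div_mul_cancel₀ _ h] at h2
  obtain ⟨δ, hδ0, hδ⟩ := hδ
  have hxy : ∀ i, x i = 0 ∨ y i = 0 := by
    intro i
    by_contra h
    push Not at h
    have : i ∈ {i : Fin d | x i ≠ 0} ∩ {i : Fin d | y i ≠ 0} := ⟨h.1, h.2⟩
    rw [hdisj] at this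
    exact this
  -- upper estimate
  have hup : ∀ t : ℝ, N (x + t • w) ^ p ≤ N x ^ p + |t| ^ p * N y ^ p := by
    intro t
    have h1 : N (x + t • w) ≤ N (x + t • y) := by
      have := hcon (x + t • y)
      rwa [map_add, map_smul, hPx] at this
    have h2 := hN_pconv 2 ![x, t • y]
    simp only [Fin.sum_univ_two, Matrix.cons_val_zero, Matrix.cons_val_one] at h2
    have h3 : N (x + t • y) ≤ (N x ^ p + N (t • y) ^ p) ^ (1 / p) := by
      refine le_trans (hN_uncond _ _ fun i => ?_) h2
      rw [abs_of_nonneg (a := (_ : ℝ) ^ (1 / p)) (by positivity)]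
      rcases hxy i with h | h
      · simp only [Pi.add_apply, Pi.smul_apply, h, smul_eq_mul, abs_zero, Real.zero_rpow hp0',
          zero_add]
        rw [one_div, Real.rpow_rpow_inv (abs_nonneg _) hp0']
      · simp only [Pi.add_apply, Pi.smul_apply, h, smul_eq_mul, mul_zero, abs_zero,
          Real.zero_rpow hp0', add_zero]
        rw [one_div, Real.rpow_rpow_inv (abs_nonneg _) hp0']
    have h4 := Real.rpow_le_rpow (hNn _) (h1.trans h3) hp0.le
    have hnn : 0 ≤ N x ^ p + N (t • y) ^ p :=
      add_nonneg (Real.rpow_nonneg (hNn _) _) (Real.rpow_nonneg (hNn _) _)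
    rw [one_div, Real.rpow_inv_rpow hnn hp0', hN_smul,
      Real.mul_rpow (abs_nonneg _) (hNn _)] at h4
    exact h4
  have hmain : ∀ t : ℝ, 0 < t → δ * N x ^ p ≤ t ^ (p - 2) * N y ^ p := by
    intro t ht
    have h2 := hN_pconv 2 ![x + t • w, x + (-t) • w]
    simp only [Fin.sum_univ_two, Matrix.cons_val_zero, Matrix.cons_val_one] at h2
    have hA : 0 ≤ 2 * (1 + δ * t ^ 2) := by positivity
    have h3 : N (((2 * (1 + δ * t ^ 2)) ^ (1 / p)) • x) ≤
        (N (x + t • w) ^ p + N (x + (-t) • w) ^ p) ^ (1 / p) := by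
      refine le_trans (hN_uncond _ _ fun i => ?_) h2
      rw [abs_of_nonneg (a := (_ : ℝ) ^ (1 / p)) (by positivity)]
      have hc := aux_coord (x i) (t * w i) δ t p hp hδ0.le
        (by nlinarith [mul_le_mul_of_nonneg_left (hδ i) (sq_nonneg t)])
      have hc2 := Real.rpow_le_rpow (by positivity) hc hip.le
      rw [Real.mul_rpow hA (by positivity)] at hc2
      simp only [Pi.add_apply, Pi.smul_apply, smul_eq_mul, neg_mul, ← sub_eq_add_neg]
      rw [abs_mul, abs_of_nonneg (a := (_ : ℝ) ^ (1 / p)) (by positivity)]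
      refine le_trans (le_of_eq ?_) hc2
      congr 1
      rw [one_div, Real.rpow_rpow_inv (abs_nonneg _) hp0']
    have h4 := Real.rpow_le_rpow (hNn _) h3 hp0.le
    have hnn : 0 ≤ N (x + t • w) ^ p + N (x + (-t) • w) ^ p :=
      add_nonneg (Real.rpow_nonneg (hNn _) _) (Real.rpow_nonneg (hNn _) _)
    rw [one_div, Real.rpow_inv_rpow hnn hp0', hN_smul,
      Real.mul_rpow (abs_nonneg _) (hNn _),
      abs_of_nonneg (Real.rpow_nonneg hA _), Real.rpow_inv_rpow hA hp0'] at h4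
    have u1 := hup t
    have u2 := hup (-t)
    rw [abs_neg] at u2
    rw [abs_of_pos ht] at u1 u2
    have h5 : t ^ 2 * (δ * N x ^ p) ≤ t ^ p * N y ^ p := by linarith
    have h6 : t ^ p = t ^ 2 * t ^ (p - 2) := by
      rw [← Real.rpow_natCast t 2, ← Real.rpow_add ht]
      congr 1
      push_cast
      ring
    rw [h6, mul_assoc] at h5
    exact le_of_mul_le_mul_left h5 (by positivity)
  have hlim : Filter.Tendsto (fun t : ℝ => t ^ (p - 2) * N y ^ p)
      (nhdsWithin 0 (Set.Ioi 0)) (nhds (0 * N y ^ p)) := by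
    have h := (Real.continuousAt_rpow_const (0 : ℝ) (p - 2) (Or.inr (by linarith))).tendsto
    rw [Real.zero_rpow (by linarith)] at h
    exact (h.mono_left nhdsWithin_le_nhds).mul_const _
  have hle := ge_of_tendsto hlim (b := δ * N x ^ p)
    (by filter_upwards [self_mem_nhdsWithin] with t ht using hmain t ht)
  have : 0 < δ * N x ^ p := mul_pos hδ0 (Real.rpow_pos_of_pos hNx p)
  linarith
end

section
/- Let d ≥ 3 be a natural number and let X = (Fin d → ℝ) carry a 1-unconditional, strictly monotone norm which is either one-p-convex for some 2 < p < ∞, or one-q-concave for some 1 < q < 2 and smooth at each standard basis vector e_i. If g is a nonzero linear functional on X such that the hyperplane ker g is 1-complemented in X, then g is supported on at most two coordinates; that is, the set {i : g(e_i) ≠ 0} has at most 2 elements. -/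
theorem aux_deriv_nonneg (D : ℝ → ℝ) (D' : ℝ) (h : HasDerivAt D D' 0) (h0 : D 0 = 0)
    (hp : ∀ s, 0 < s → 0 ≤ D s) : 0 ≤ D' := by
  have h1 := (hasDerivAt_iff_tendsto_slope.1 h).mono_left
    (nhdsWithin_mono (0:ℝ) (show Set.Ioi (0:ℝ) ⊆ {0}ᶜ from fun x hx => ne_of_gt hx))
  refine ge_of_tendsto h1 ?_
  filter_upwards [self_mem_nhdsWithin] with s hs
  have hs : 0 < s := hs
  rw [slope_def_field, h0]
  have := hp s hs
  simp only [sub_zero]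
  positivity

theorem aux_norming (d : ℕ) (N : (Fin d → ℝ) → ℝ)
    (hN_add : ∀ x y, N (x + y) ≤ N x + N y)
    (hN_smul : ∀ (c : ℝ) (x), N (c • x) = |c| * N x)
    (x : Fin d → ℝ) (hx : x ≠ 0) :
    ∃ f : Fin d → ℝ, (∀ v, ∑ i, f i * v i ≤ N v) ∧ ∑ i, f i * x i = N x := by
  have hnn : ∀ x, 0 ≤ N x := by
    intro x
    have h1 := hN_add x ((-1:ℝ) • x)
    have h2 := hN_smul 0 x
    rw [hN_smul] at h1
    simp at h1 h2
    rw [h2] at h1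
    linarith
  obtain ⟨L, hL1, hL2⟩ := exists_extension_of_le_sublinear
    (LinearPMap.mkSpanSingleton (K := ℝ) x (N x) hx) N
    (fun c hc v => by rw [hN_smul, abs_of_pos hc]) hN_add (by
      rintro ⟨v, hv⟩
      obtain ⟨c, rfl⟩ := Submodule.mem_span_singleton.1 hv
      rw [LinearPMap.mkSpanSingleton'_apply]
      simp only [hN_smul, RingHom.id_apply, smul_eq_mul]
      exact mul_le_mul_of_nonneg_right (le_abs_self c) (hnn x))
  have hrep : ∀ v : Fin d → ℝ, L v = ∑ i, L (Pi.single i 1) * v i := by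
    intro v
    conv_lhs => rw [pi_eq_sum_univ' v]
    rw [map_sum]
    refine Finset.sum_congr rfl fun i _ => ?_
    rw [map_smul, smul_eq_mul, mul_comm]
  refine ⟨fun i => L (Pi.single i 1), fun v => ?_, ?_⟩
  · rw [← hrep]; exact hL2 v
  · rw [← hrep]
    have := hL1 ⟨x, Submodule.mem_span_singleton_self x⟩
    rw [this]
    exact LinearPMap.mkSpanSingleton_apply ℝ ℝ (x := x) hx (N x)

theorem aux_B (d : ℕ) (N : (Fin d → ℝ) → ℝ) (p : ℝ) (hp : 2 < p)
    (hN_smul : ∀ (c : ℝ) (x), N (c • x) = |c| * N x)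
    (hN_nn : ∀ x, 0 ≤ N x)
    (hN_uncond : ∀ x y : Fin d → ℝ, (∀ i, |x i| ≤ |y i|) → N x ≤ N y)
    (hconv : ∀ a b : Fin d → ℝ, N (fun i => (|a i| ^ p + |b i| ^ p) ^ (1 / p)) ≤
      (N a ^ p + N b ^ p) ^ (1 / p))
    (x f : Fin d → ℝ) (hx : 0 < N x) (hf : ∀ v, ∑ i, f i * v i ≤ N v)
    (hfx : ∑ i, f i * x i = N x) (v : Fin d → ℝ) :
    ∑ i, f i * x i * |x i| ^ (-p) * |v i| ^ p ≤ N x ^ (1 - p) * N v ^ p := by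
  have hp0 : 0 < p := by linarith
  let D : ℝ → ℝ := fun s => (N x ^ p + s * N v ^ p) ^ (1 / p) -
    ∑ i, f i * (SignType.sign (x i) : ℝ) * (|x i| ^ p + s * |v i| ^ p) ^ (1 / p)
  have key : ∀ a b : ℝ, 0 < a → HasDerivAt (fun s : ℝ => (a ^ p + s * b) ^ (1 / p))
      ((1 / p) * (a ^ (1 - p) * b)) 0 := by
    intro a b ha
    have h1 : HasDerivAt (fun s : ℝ => a ^ p + s * b) b 0 := by
      simpa using ((hasDerivAt_id (0:ℝ)).mul_const b).const_add (a ^ p)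
    have h2 := h1.rpow_const (p := 1 / p) (Or.inl (by simp; positivity))
    convert h2 using 1
    have : (a ^ p) ^ (1 / p - 1) = a ^ (1 - p) := by
      rw [← Real.rpow_mul ha.le]; congr 1; field_simp
    simp only [zero_mul, add_zero, this]; ring
  have hD : HasDerivAt D ((1 / p) * (N x ^ (1 - p) * N v ^ p) -
      ∑ i, (1 / p) * (f i * x i * |x i| ^ (-p) * |v i| ^ p)) 0 := by
    refine (key _ _ hx).sub (HasDerivAt.fun_sum fun i _ => ?_)
    by_cases hi : x i = 0
    · simp [hi, hasDerivAt_const]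
    · have := (key _ (|v i| ^ p) (abs_pos.2 hi)).const_mul (f i * (SignType.sign (x i) : ℝ))
      refine this.congr_deriv ?_
      have h3 : |x i| ^ (1 - p) = |x i| * |x i| ^ (-p) := by
        rw [sub_eq_add_neg, Real.rpow_add (abs_pos.2 hi), Real.rpow_one]
      have h4 : (SignType.sign (x i) : ℝ) * |x i| = x i := sign_mul_abs (x i)
      rw [h3]
      linear_combination ((1 / p) * f i * |x i| ^ (-p) * |v i| ^ p) * h4
  have := aux_deriv_nonneg D _ hD (by
    have e : ∀ a : ℝ, 0 ≤ a → (a ^ p) ^ (1 / p) = a := fun a ha => by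
      rw [← Real.rpow_mul ha]; field_simp; simp
    simp only [D, zero_mul, add_zero]
    rw [e _ hx.le, sub_eq_zero, ← hfx]
    refine Finset.sum_congr rfl fun i _ => ?_
    rw [e _ (abs_nonneg _), mul_assoc, sign_mul_abs]) (by
    intro s hs
    have hc := hconv x (s ^ (1 / p) • v)
    have hsp : (s ^ (1 / p)) ^ p = s := by
      rw [← Real.rpow_mul hs.le]; field_simp; simp
    have hs' : 0 < s ^ (1 / p) := Real.rpow_pos_of_pos hs _
    rw [hN_smul, abs_of_pos hs', Real.mul_rpow hs'.le (hN_nn _), hsp] at hc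
    simp only [Pi.smul_apply, smul_eq_mul, abs_mul, abs_of_pos hs',
      Real.mul_rpow hs'.le (abs_nonneg _), hsp] at hc
    have h6 := hf (fun i => (SignType.sign (x i) : ℝ) * (|x i| ^ p + s * |v i| ^ p) ^ (1 / p))
    have h7 : N (fun i => (SignType.sign (x i) : ℝ) * (|x i| ^ p + s * |v i| ^ p) ^ (1 / p)) ≤
        N (fun i => (|x i| ^ p + s * |v i| ^ p) ^ (1 / p)) := by
      refine hN_uncond _ _ fun i => ?_
      rw [abs_mul]
      refine mul_le_of_le_one_left (abs_nonneg _) ?_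
      rcases lt_trichotomy (x i) 0 with h | h | h <;> simp [h]
    simp only [← mul_assoc] at h6
    simp only [D]
    linarith)
  rw [← Finset.mul_sum, ← mul_sub] at this
  have h5 := nonneg_of_mul_nonneg_right this (by positivity)
  linarith

theorem aux_A0 (d : ℕ) (N : (Fin d → ℝ) → ℝ) (p : ℝ) (hp : 2 < p)
    (hN_smul : ∀ (c : ℝ) (x), N (c • x) = |c| * N x)
    (hN_nn : ∀ x, 0 ≤ N x)
    (hN_uncond : ∀ x y : Fin d → ℝ, (∀ i, |x i| ≤ |y i|) → N x ≤ N y)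
    (hconv : ∀ a b : Fin d → ℝ, N (fun i => (|a i| ^ p + |b i| ^ p) ^ (1 / p)) ≤
      (N a ^ p + N b ^ p) ^ (1 / p))
    (x f : Fin d → ℝ) (hx : 0 < N x) (hf : ∀ v, ∑ i, f i * v i ≤ N v)
    (hfx : ∑ i, f i * x i = N x) (i : Fin d) (hi : x i = 0) : f i = 0 := by
  have hp0 : 0 < p := by linarith
  have e : ∀ a : ℝ, 0 ≤ a → (a ^ p) ^ (1 / p) = a := fun a ha => by
    rw [← Real.rpow_mul ha]; field_simp; simp
  let c := N (Pi.single i 1)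
  let D : ℝ → ℝ := fun s => (N x ^ p + |s| ^ p * c ^ p) ^ (1 / p) - s * f i
  have hD : HasDerivAt D (- f i) 0 := by
    have h1 := ((hasDerivAt_abs_rpow (0:ℝ) (p := p) (by linarith)).mul_const (c ^ p)).const_add
      (N x ^ p)
    have h2 := h1.rpow_const (p := 1 / p) (Or.inl (by
      simp [Real.zero_rpow hp0.ne']; positivity))
    have h3 := h2.sub ((hasDerivAt_id (0:ℝ)).mul_const (f i))
    refine h3.congr_deriv ?_
    simp
  have hmin : IsLocalMin D 0 := by
    refine Filter.Eventually.of_forall fun s => ?_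
    have h0 : D 0 = N x := by simpa [D, Real.zero_rpow hp0.ne'] using e _ hx.le
    rw [h0]
    have h1 := hf (x + s • Pi.single i 1)
    have h2 : ∑ j, f j * (x + s • (Pi.single i 1 : Fin d → ℝ)) j = N x + s * f i := by
      simp [mul_add, Finset.sum_add_distrib, hfx, Pi.single_apply]; ring
    have h3 := hconv x (s • Pi.single i 1)
    rw [hN_smul, Real.mul_rpow (abs_nonneg s) (hN_nn _)] at h3
    have h4 : N (x + s • Pi.single i 1) ≤ N (fun j => (|x j| ^ p + |(s • (Pi.single i 1 : Fin d → ℝ)) j| ^ p) ^ (1 / p)) := by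
      refine hN_uncond _ _ fun j => ?_
      by_cases hj : j = i
      · subst hj
        simp [hi, Real.zero_rpow hp0.ne']
        have := e |s| (abs_nonneg s)
        rw [one_div] at this
        rw [this]; simp
      · simp [hj, Real.zero_rpow hp0.ne']
        have := e |x j| (abs_nonneg _)
        rw [one_div] at this
        rw [this]; simp
    simp only [D]
    linarith
  have := hmin.hasDerivAt_eq_zero hD
  linarith

theorem aux_sum3 {d : ℕ} (a : Fin d → ℝ) (i j k : Fin d) (hij : i ≠ j) (hik : i ≠ k) (hjk : j ≠ k)
    (h : ∀ l, l ≠ i → l ≠ j → l ≠ k → a l = 0) : ∑ l, a l = a i + a j + a k := by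
  have : ∑ l ∈ ({i, j, k} : Finset (Fin d)), a l = ∑ l, a l :=
    Finset.sum_subset (Finset.subset_univ _) fun l _ hl => by
      simp only [Finset.mem_insert, Finset.mem_singleton, not_or] at hl
      exact h l hl.1 hl.2.1 hl.2.2
  rw [← this, Finset.sum_insert (by simp [hij, hik]), Finset.sum_insert (by simp [hjk]),
    Finset.sum_singleton]
  ring

theorem aux_final (p θ C : ℝ) (hp : 2 < p) (hθ : 0 < θ) (hθ1 : θ < 1) (hC : 0 ≤ C)
    (h : ∀ t : ℝ, 0 < t → t ≤ 1 → 1 - θ + θ * (1 + t) ^ p ≤ (1 + θ * t + C * t ^ p) ^ p) :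
    False := by
  have h1 : ∀ t : ℝ, 0 < t → t ≤ 1 → θ * (1 - θ) ≤ (4 * C + C ^ 2) * t ^ (p - 2) := by
    intro t ht ht1
    have e1 := h t ht ht1
    have htp : 0 < t ^ p := Real.rpow_pos_of_pos ht _
    have htp1 : t ^ p ≤ 1 := Real.rpow_le_one ht.le ht1 (by linarith)
    have hB : 0 ≤ 1 + θ * t + C * t ^ p := by positivity
    have e2 : (1 - θ + θ * (1 + t) ^ 2) ^ (p / 2) ≤ 1 - θ + θ * (1 + t) ^ p := by
      have := (convexOn_rpow (p := p / 2) (by linarith)).2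
        (Set.mem_Ici.2 zero_le_one) (Set.mem_Ici.2 (show (0:ℝ) ≤ (1 + t) ^ 2 by positivity))
        (show 0 ≤ 1 - θ by linarith) hθ.le (by ring)
      simp only [smul_eq_mul, mul_one, Real.one_rpow] at this
      have e : ((1 + t) ^ 2) ^ (p / 2) = (1 + t) ^ p := by
        rw [← Real.rpow_natCast, ← Real.rpow_mul (by positivity)]; congr 1; push_cast; ring
      rwa [e] at this
    have e3 : (1 + θ * t + C * t ^ p) ^ p = ((1 + θ * t + C * t ^ p) ^ 2) ^ (p / 2) := by
      rw [← Real.rpow_natCast, ← Real.rpow_mul hB]; congr 1; push_cast; ring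
    have e4 : 1 - θ + θ * (1 + t) ^ 2 ≤ (1 + θ * t + C * t ^ p) ^ 2 := by
      rw [← Real.rpow_le_rpow_iff (z := p / 2) (by nlinarith [sq_nonneg t]) (by positivity)
        (by linarith), ← e3]
      exact e2.trans e1
    have e5 : θ * (1 - θ) * t ^ 2 ≤ (4 * C + C ^ 2) * t ^ p := by
      have a1 : C * t ^ p * (θ * t) ≤ C * t ^ p * 1 :=
        mul_le_mul_of_nonneg_left (by nlinarith) (by positivity)
      have a2 : C ^ 2 * t ^ p * t ^ p ≤ C ^ 2 * t ^ p * 1 :=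
        mul_le_mul_of_nonneg_left htp1 (by positivity)
      nlinarith
    have e6 : t ^ p = t ^ (p - 2) * t ^ 2 := by
      rw [← Real.rpow_natCast t 2, ← Real.rpow_add ht]; congr 1; push_cast; ring
    rw [e6, ← mul_assoc] at e5
    exact le_of_mul_le_mul_right e5 (by positivity)
  have h2 : Filter.Tendsto (fun t : ℝ => (4 * C + C ^ 2) * t ^ (p - 2)) (nhdsWithin 0 (Set.Ioi 0))
      (nhds 0) := by
    have : ContinuousAt (fun t : ℝ => (4 * C + C ^ 2) * t ^ (p - 2)) 0 :=
      continuousAt_const.mul (Real.continuousAt_rpow_const _ _ (Or.inr (by linarith)))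
    have h3 := this.tendsto
    simp only [Real.zero_rpow (show p - 2 ≠ 0 by linarith), mul_zero] at h3
    exact h3.mono_left nhdsWithin_le_nhds
  have h3 : θ * (1 - θ) ≤ 0 := by
    refine ge_of_tendsto h2 ?_
    filter_upwards [Ioc_mem_nhdsGT (zero_lt_one' ℝ)] with t ht
    exact h1 t ht.1 ht.2
  nlinarith

set_option maxHeartbeats 1000000 in
theorem aux_core (d : ℕ) (N : (Fin d → ℝ) → ℝ) (p : ℝ) (hp : 2 < p)
    (hN_add : ∀ x y, N (x + y) ≤ N x + N y)
    (hN_smul : ∀ (c : ℝ) (x), N (c • x) = |c| * N x)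
    (hN_pos : ∀ x, x ≠ 0 → 0 < N x)
    (hN_uncond : ∀ x y : Fin d → ℝ, (∀ i, |x i| ≤ |y i|) → N x ≤ N y)
    (hconv : ∀ a b : Fin d → ℝ, N (fun i => (|a i| ^ p + |b i| ^ p) ^ (1 / p)) ≤
      (N a ^ p + N b ^ p) ^ (1 / p))
    (g u : Fin d → ℝ) (hgu : ∑ l, g l * u l = 1)
    (hcontr : ∀ x, N (x - (∑ l, g l * x l) • u) ≤ N x)
    (i j k : Fin d) (hij : i ≠ j) (hik : i ≠ k) (hjk : j ≠ k)
    (hi : 0 < g i * u i) (hj : 0 < g j * u j) (hk : 0 < g k * u k) : False := by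
  have hp0 : 0 < p := by linarith
  have hN_nn : ∀ x, 0 ≤ N x := by
    intro x
    by_cases hx : x = 0
    · have := hN_smul 0 x
      rw [hx] at this ⊢
      simp at this; rw [this]
    · exact (hN_pos x hx).le
  have hgi : g i ≠ 0 := left_ne_zero_of_mul hi.ne'
  have hgj : g j ≠ 0 := left_ne_zero_of_mul hj.ne'
  have hgk : g k ≠ 0 := left_ne_zero_of_mul hk.ne'
  have norming : ∀ x : Fin d → ℝ, x ≠ 0 → ∑ l, g l * x l = 0 →
      ∃ f : Fin d → ℝ, (∀ v, ∑ i, f i * v i ≤ N v) ∧ ∑ i, f i * x i = N x ∧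
        ∑ i, f i * u i = 0 := by
    intro x hx hgx
    obtain ⟨f, hf, hfx⟩ := aux_norming d N hN_add hN_smul x hx
    have e : ∀ v : Fin d → ℝ, ∑ l, (f l - (∑ m, f m * u m) * g l) * v l =
        ∑ l, f l * (v - (∑ l, g l * v l) • u) l := by
      intro v
      simp only [sub_mul, mul_sub, Pi.sub_apply, Pi.smul_apply, smul_eq_mul,
        Finset.sum_sub_distrib]
      congr 1
      simp only [mul_assoc, ← Finset.mul_sum]
      rw [mul_comm, Finset.mul_sum]
      exact Finset.sum_congr rfl fun l _ => by ring
    refine ⟨fun l => f l - (∑ m, f m * u m) * g l, fun v => ?_, ?_, ?_⟩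
    · rw [e]; exact (hf _).trans (hcontr v)
    · rw [e, hgx]; simpa using hfx
    · rw [e, hgu]; simp
  let x : Fin d → ℝ := fun l => if l = i then 1 / g i else if l = j then -1 / g j else 0
  have xi : x i = 1 / g i := by simp [x]
  have xj : x j = -1 / g j := by simp [x, hij.symm]
  have x0 : ∀ l, l ≠ i → l ≠ j → x l = 0 := by intro l h1 h2; simp [x, h1, h2]
  have xk := x0 k hik.symm hjk.symm
  have hx : x ≠ 0 := fun h => by
    have := congrFun h i; rw [xi] at this; simp [hgi] at this
  have hgx : ∑ l, g l * x l = 0 := by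
    rw [aux_sum3 _ i j k hij hik hjk (fun l h1 h2 _ => by rw [x0 l h1 h2, mul_zero]), xi, xj, xk]
    field_simp; ring
  obtain ⟨f, hf, hfx, hfu⟩ := norming x hx hgx
  have hn := hN_pos x hx
  have f0 : ∀ l, l ≠ i → l ≠ j → f l = 0 := fun l h1 h2 =>
    aux_A0 d N p hp hN_smul hN_nn hN_uncond hconv x f hn hf hfx l (x0 l h1 h2)
  rw [aux_sum3 _ i j k hij hik hjk (fun l h1 h2 _ => by rw [x0 l h1 h2, mul_zero]), xi, xj, xk]
    at hfx
  rw [aux_sum3 _ i j k hij hik hjk (fun l h1 h2 _ => by rw [f0 l h1 h2, zero_mul]),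
    f0 k hik.symm hjk.symm] at hfu
  set n := N x with hndef
  set θ := g i * u i / (g i * u i + g j * u j) with hθ
  have hσ : 0 < g i * u i + g j * u j := by linarith
  have hθ0 : 0 < θ := by positivity
  have hθ1 : θ < 1 := by rw [hθ, div_lt_one hσ]; linarith
  have hfj : - (f j / g j) = n * θ := by
    rw [hθ, mul_div_assoc', eq_div_iff hσ.ne', ← hfx]
    field_simp
    linear_combination (-(g j)) * hfu
  have hfi : f i / g i = n * (1 - θ) := by
    have : f i / g i - f j / g j = n := by rw [← hfx]; ring
    linarith
  set m := N (Pi.single i (1 / g i)) with hm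
  have hm0 : 0 < m := hN_pos _ (fun h => by
    have := congrFun h i; simp [hgi] at this)
  set A := |1 / g k| ^ p * (m ^ (1 - p) * N (Pi.single k 1) ^ p) with hA
  have hA0 : 0 ≤ A := by have := hN_nn (Pi.single k 1); positivity
  set B := g k * u k / (g i * u i + g j * u j) + 1 with hB
  have hB0 : 0 ≤ B := by positivity
  refine aux_final p θ (A * B / n) hp hθ0 hθ1 (by positivity) fun t ht ht1 => ?_
  let y : Fin d → ℝ := fun l => if l = i then 1 / g i else if l = j then -(1 + t) / g j else
    if l = k then t / g k else 0
  have yi : y i = 1 / g i := by simp [y]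
  have yj : y j = -(1 + t) / g j := by simp [y, hij.symm]
  have yk : y k = t / g k := by simp [y, hik.symm, hjk.symm]
  have y0 : ∀ l, l ≠ i → l ≠ j → l ≠ k → y l = 0 := by intro l h1 h2 h3; simp [y, h1, h2, h3]
  have hy : y ≠ 0 := fun h => by
    have := congrFun h i; rw [yi] at this; simp [hgi] at this
  have hgy : ∑ l, g l * y l = 0 := by
    rw [aux_sum3 _ i j k hij hik hjk (fun l h1 h2 h3 => by rw [y0 l h1 h2 h3, mul_zero]), yi, yj, yk]
    field_simp; ring
  obtain ⟨h, hh, hhy, hhu⟩ := norming y hy hgy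
  have hny := hN_pos y hy
  have h0 : ∀ l, l ≠ i → l ≠ j → l ≠ k → h l = 0 := fun l h1 h2 h3 =>
    aux_A0 d N p hp hN_smul hN_nn hN_uncond hconv y h hny hh hhy l (y0 l h1 h2 h3)
  have hBk := aux_B d N p hp hN_smul hN_nn hN_uncond hconv y h hny hh hhy (Pi.single k 1)
  rw [Finset.sum_eq_single k (fun l _ hl => by simp [hl, Real.zero_rpow hp0.ne']) (by simp)] at hBk
  have hmy : m ≤ N y := hN_uncond _ _ fun l => by
    by_cases hl : l = i
    · subst hl; simp [yi]
    · simp [hl]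
  have htp : 0 < t ^ p := Real.rpow_pos_of_pos ht _
  have hyk : 0 < |y k| := by rw [yk]; positivity
  have hHk : h k * y k ≤ A * t ^ p := by
    have e1 : N y ^ (1 - p) ≤ m ^ (1 - p) :=
      Real.rpow_le_rpow_of_nonpos hm0 hmy (by linarith)
    have e2 : h k * y k * |y k| ^ (-p) ≤ m ^ (1 - p) * N (Pi.single k 1) ^ p := by
      have := mul_le_mul_of_nonneg_right e1 (Real.rpow_nonneg (hN_nn (Pi.single k 1)) p)
      simp only [Pi.single_eq_same, abs_one, Real.one_rpow, mul_one] at hBk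
      linarith
    have e3 : |y k| ^ (-p) * |y k| ^ p = 1 := by
      rw [← Real.rpow_add hyk]; simp
    have e4 : |y k| ^ p = |1 / g k| ^ p * t ^ p := by
      rw [← Real.mul_rpow (abs_nonneg _) ht.le, yk, abs_div, abs_div, abs_of_pos ht]; congr 1; simp
      ring
    have e5 := mul_le_mul_of_nonneg_right e2 (Real.rpow_nonneg (abs_nonneg (y k)) p)
    rw [mul_assoc, e3, mul_one, e4] at e5
    rw [hA]; linarith
  have hhx := hh x
  rw [aux_sum3 _ i j k hij hik hjk (fun l h1 h2 _ => by rw [x0 l h1 h2, mul_zero]), xi, xj, xk]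
    at hhx
  rw [aux_sum3 _ i j k hij hik hjk (fun l h1 h2 h3 => by rw [h0 l h1 h2 h3, zero_mul])] at hhu
  rw [aux_sum3 _ i j k hij hik hjk (fun l h1 h2 h3 => by rw [h0 l h1 h2 h3, zero_mul]), yi, yj]
    at hhy
  -- upper bound
  have hup : N y ≤ n * (1 + θ * t + A * B / n * t ^ p) := by
    obtain ⟨H1, rfl'⟩ : ∃ H1, h i = H1 * g i := ⟨h i / g i, by field_simp⟩
    obtain ⟨H2, rfl''⟩ : ∃ H2, h j = H2 * g j := ⟨h j / g j, by field_simp⟩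
    obtain ⟨H3, rfl3⟩ : ∃ H3, h k = H3 * g k := ⟨h k / g k, by field_simp⟩
    have hyk3 : h k * y k = t * H3 := by rw [rfl3, yk]; field_simp
    rw [hyk3] at hHk hhy
    rw [rfl', rfl'', rfl3] at hhu
    rw [rfl', rfl''] at hhx hhy
    have c1 : H1 - H2 ≤ n := by
      refine le_trans (le_of_eq ?_) hhx
      field_simp; ring
    have c2 : H1 - (1 + t) * H2 + t * H3 = N y := by
      rw [← hhy]; field_simp; ring
    have c3 : -H2 ≤ θ * n + H3 * (g k * u k / (g i * u i + g j * u j)) := by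
      rw [hθ, div_mul_eq_mul_div, mul_div_assoc', ← add_div, le_div_iff₀ hσ]
      have := mul_le_mul_of_nonneg_left c1 hi.le
      linarith
    have c4 : t * H3 * B ≤ A * t ^ p * B := mul_le_mul_of_nonneg_right hHk hB0
    have c5 : n * (1 + θ * t + A * B / n * t ^ p) = n + n * θ * t + A * t ^ p * B := by
      field_simp
    rw [c5, ← c2]
    have c6 := mul_le_mul_of_nonneg_left c3 ht.le
    have c7 : t * H3 * B = t * H3 * (g k * u k / (g i * u i + g j * u j)) + t * H3 := by
      rw [hB]; ring
    linarith
  have hlow := aux_B d N p hp hN_smul hN_nn hN_uncond hconv x f hn hf (by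
    rw [aux_sum3 _ i j k hij hik hjk (fun l h1 h2 _ => by rw [x0 l h1 h2, mul_zero]), xi, xj, xk,
      hfx]) y
  rw [aux_sum3 _ i j k hij hik hjk (fun l h1 h2 _ => by rw [x0 l h1 h2]; simp)] at hlow
  have l1 : f i * x i * |x i| ^ (-p) * |y i| ^ p = n * (1 - θ) := by
    have hxi : 0 < |x i| := by rw [xi]; positivity
    rw [yi, ← xi, mul_assoc, ← Real.rpow_add hxi, ← hfi, xi]; simp; ring
  have l2 : f j * x j * |x j| ^ (-p) * |y j| ^ p = n * θ * (1 + t) ^ p := by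
    have hxj : 0 < |x j| := by rw [xj]; have : -1 / g j ≠ 0 := div_ne_zero (by norm_num) hgj; positivity
    have : |y j| = |x j| * (1 + t) := by
      rw [yj, xj, abs_div, abs_div, abs_neg, abs_neg, abs_one, abs_of_pos (by positivity)]; ring
    rw [this, Real.mul_rpow hxj.le (by positivity), mul_assoc, ← mul_assoc (|x j| ^ (-p)),
      ← Real.rpow_add hxj, ← hfj, xj]; simp; ring
  rw [l1, l2, xk] at hlow
  simp only [mul_zero, zero_mul, add_zero] at hlow
  have l3 : N y ^ p ≤ n ^ p * (1 + θ * t + A * B / n * t ^ p) ^ p := by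
    rw [← Real.mul_rpow hn.le (by positivity)]
    exact Real.rpow_le_rpow hny.le hup hp0.le
  have l4 : n ^ (1 - p) * n ^ p = n := by
    rw [← Real.rpow_add hn]; simp
  have l5 : n * (1 - θ + θ * (1 + t) ^ p) ≤ n * (1 + θ * t + A * B / n * t ^ p) ^ p := by
    have := mul_le_mul_of_nonneg_left l3 (Real.rpow_nonneg hn.le (1 - p))
    rw [← mul_assoc, l4] at this
    linarith
  exact le_of_mul_le_mul_left l5 hn

theorem aux_dual (d : ℕ) (N : (Fin d → ℝ) → ℝ)
    (hN_smul : ∀ (c : ℝ) (x), N (c • x) = |c| * N x)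
    (hN_pos : ∀ x, x ≠ 0 → 0 < N x)
    (hN_uncond : ∀ x y : Fin d → ℝ, (∀ i, |x i| ≤ |y i|) → N x ≤ N y) :
    ∃ M : (Fin d → ℝ) → ℝ, (∀ f, 0 ≤ M f) ∧ (∀ f x, ∑ i, f i * x i ≤ M f * N x) ∧
      ∀ f c, 0 ≤ c → (∀ x, ∑ i, f i * x i ≤ c * N x) → M f ≤ c := by
  have hbdd : ∀ f : Fin d → ℝ, BddBelow {c : ℝ | 0 ≤ c ∧ ∀ x, ∑ i, f i * x i ≤ c * N x} :=
    fun f => ⟨0, fun c hc => hc.1⟩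
  have hne : ∀ f : Fin d → ℝ, {c : ℝ | 0 ≤ c ∧ ∀ x, ∑ i, f i * x i ≤ c * N x}.Nonempty := by
    intro f
    have he : ∀ i : Fin d, 0 < N (Pi.single i 1) := fun i => hN_pos _ (by simp)
    refine ⟨∑ i, |f i| / N (Pi.single i 1), Finset.sum_nonneg fun i _ =>
      div_nonneg (abs_nonneg _) (he i).le, fun x => ?_⟩
    rw [Finset.sum_mul]
    refine Finset.sum_le_sum fun i _ => ?_
    have h1 : |x i| * N (Pi.single i 1) ≤ N x := by
      rw [← hN_smul]
      refine hN_uncond _ _ fun j => ?_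
      by_cases hj : j = i
      · subst hj; simp
      · simp [hj]
    have h2 : |x i| ≤ N x / N (Pi.single i 1) := (le_div_iff₀ (he i)).2 h1
    calc f i * x i ≤ |f i| * |x i| := by rw [← abs_mul]; exact le_abs_self _
      _ ≤ |f i| * (N x / N (Pi.single i 1)) := mul_le_mul_of_nonneg_left h2 (abs_nonneg _)
      _ = _ := by ring
  refine ⟨fun f => sInf {c : ℝ | 0 ≤ c ∧ ∀ x, ∑ i, f i * x i ≤ c * N x}, fun f => ?_,
    fun f x => ?_, fun f c hc h => csInf_le (hbdd f) ⟨hc, h⟩⟩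
  · exact le_csInf (hne f) fun c hc => hc.1
  · by_cases hx : x = 0
    · have := hN_smul 0 x
      simp at this
      simp [hx, this]
    · rw [← div_le_iff₀ (hN_pos x hx)]
      refine le_csInf (hne f) fun c hc => ?_
      rw [div_le_iff₀ (hN_pos x hx)]
      exact hc.2 x

theorem aux_holder_eq (p q a b : ℝ) (hpq : p.HolderConjugate q) (ha : 0 ≤ a) (hb : 0 ≤ b) :
    ∃ α β : ℝ, 0 ≤ α ∧ 0 ≤ β ∧ α ^ q + β ^ q = 1 ∧ (a ^ p + b ^ p) ^ (1 / p) = a * α + b * β := by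
  have hp := hpq.pos
  have hq := hpq.symm.pos
  by_cases h0 : a = 0 ∧ b = 0
  · refine ⟨1, 0, zero_le_one, le_rfl, by simp [Real.zero_rpow hq.ne'], ?_⟩
    simp [h0.1, h0.2, Real.zero_rpow hp.ne', Real.zero_rpow (inv_ne_zero hp.ne')]
  have hS : 0 < a ^ p + b ^ p := by
    rcases ha.eq_or_lt with h | h
    · have : 0 < b := lt_of_le_of_ne hb fun h' => h0 ⟨h.symm, h'.symm⟩
      positivity
    · positivity
  set c := (a ^ p + b ^ p) ^ (1 / p) with hc
  have hc0 : 0 < c := by positivity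
  have hcp : c ^ p = a ^ p + b ^ p := by
    rw [hc, ← Real.rpow_mul hS.le]; field_simp; simp
  have e : (p - 1) * q = p := hpq.sub_one_mul_conj
  have e2 : ∀ z : ℝ, 0 ≤ z → ((z / c) ^ (p - 1)) ^ q = z ^ p / c ^ p := fun z hz => by
    rw [← Real.rpow_mul (by positivity), e, Real.div_rpow hz hc0.le]
  have e3 : ∀ z : ℝ, 0 ≤ z → z * (z / c) ^ (p - 1) = z ^ p / c ^ p * c := fun z hz => by
    rcases hz.eq_or_lt with h | h
    · simp [← h, Real.zero_rpow hp.ne']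
    · rw [Real.div_rpow hz hc0.le, Real.rpow_sub_one h.ne', Real.rpow_sub_one hc0.ne']
      field_simp
  refine ⟨(a / c) ^ (p - 1), (b / c) ^ (p - 1), by positivity, by positivity, ?_, ?_⟩
  · rw [e2 a ha, e2 b hb, ← add_div, ← hcp, div_self]; positivity
  · rw [e3 a ha, e3 b hb, ← add_mul, ← add_div, ← hcp, div_self (by positivity), one_mul]

theorem aux_dual_conv (d : ℕ) (N M : (Fin d → ℝ) → ℝ) (p q : ℝ) (hpq : p.HolderConjugate q)
    (hN_nn : ∀ x, 0 ≤ N x)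
    (hN_uncond : ∀ x y : Fin d → ℝ, (∀ i, |x i| ≤ |y i|) → N x ≤ N y)
    (hconc : ∀ a b : Fin d → ℝ, (N a ^ q + N b ^ q) ^ (1 / q) ≤
      N (fun i => (|a i| ^ q + |b i| ^ q) ^ (1 / q)))
    (hM_nn : ∀ f, 0 ≤ M f) (hM1 : ∀ f x, ∑ i, f i * x i ≤ M f * N x)
    (hM2 : ∀ f c, 0 ≤ c → (∀ x, ∑ i, f i * x i ≤ c * N x) → M f ≤ c)
    (hM_uncond : ∀ x y : Fin d → ℝ, (∀ i, |x i| ≤ |y i|) → M x ≤ M y)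
    (a b : Fin d → ℝ) : M (fun i => (|a i| ^ p + |b i| ^ p) ^ (1 / p)) ≤
      (M a ^ p + M b ^ p) ^ (1 / p) := by
  have hp := hpq.pos
  have hq := hpq.symm.pos
  have hMa := hM_nn a
  have hMb := hM_nn b
  refine hM2 _ _ (by positivity) fun x => ?_
  choose α β hα hβ h1 h2 using fun i => aux_holder_eq p q |a i| |b i| hpq (abs_nonneg _) (abs_nonneg _)
  have s1 : ∑ i, (|a i| ^ p + |b i| ^ p) ^ (1 / p) * x i =
      ∑ i, |a i| * (α i * x i) + ∑ i, |b i| * (β i * x i) := by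
    rw [← Finset.sum_add_distrib]
    exact Finset.sum_congr rfl fun i _ => by rw [h2]; ring
  have s2 := hM1 (fun i => |a i|) (fun i => α i * x i)
  have s3 := hM1 (fun i => |b i|) (fun i => β i * x i)
  have ea : M (fun i => |a i|) ≤ M a := hM_uncond _ _ fun i => by simp
  have eb : M (fun i => |b i|) ≤ M b := hM_uncond _ _ fun i => by simp
  set A := N (fun i => α i * x i) with hA
  set B := N (fun i => β i * x i) with hB
  have hA0 : 0 ≤ A := hN_nn _
  have hB0 : 0 ≤ B := hN_nn _
  have s4 := mul_le_mul_of_nonneg_right ea hA0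
  have s5 := mul_le_mul_of_nonneg_right eb hB0
  have s6 : M a * A + M b * B ≤ (M a ^ p + M b ^ p) ^ (1 / p) * (A ^ q + B ^ q) ^ (1 / q) := by
    have := Real.inner_le_Lp_mul_Lq Finset.univ ![M a, M b] ![A, B] hpq
    simpa [Fin.sum_univ_two, abs_of_nonneg, hMa, hMb, hA0, hB0] using this
  have s7 : (A ^ q + B ^ q) ^ (1 / q) ≤ N x := by
    refine (hconc _ _).trans (hN_uncond _ _ fun i => ?_)
    have : |α i * x i| ^ q + |β i * x i| ^ q = |x i| ^ q := by
      rw [abs_mul, abs_mul, abs_of_nonneg (hα i), abs_of_nonneg (hβ i),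
        Real.mul_rpow (hα i) (abs_nonneg _), Real.mul_rpow (hβ i) (abs_nonneg _), ← add_mul, h1,
        one_mul]
    rw [this, ← Real.rpow_mul (abs_nonneg _), mul_one_div_cancel hq.ne', Real.rpow_one, abs_abs]
  have s8 := mul_le_mul_of_nonneg_left s7
    (show 0 ≤ (M a ^ p + M b ^ p) ^ (1 / p) by positivity)
  rw [s1]
  linarith

theorem stmt3 (d : ℕ) (hd : 3 ≤ d)
    (N : (Fin d → ℝ) → ℝ)
    (hN_add : ∀ x y, N (x + y) ≤ N x + N y)
    (hN_smul : ∀ (c : ℝ) (x), N (c • x) = |c| * N x)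
    (hN_def : ∀ x, N x = 0 → x = 0)
    (hN_uncond : ∀ x y : Fin d → ℝ, (∀ i, |x i| ≤ |y i|) → N x ≤ N y)
    (hN_strict : ∀ x y : Fin d → ℝ, (∀ i, |x i| ≤ |y i|) →
      (∃ i, |x i| < |y i|) → N x < N y)
    (h_conv_or_conc :
      (∃ p : ℝ, 2 < p ∧
        (∀ (m : ℕ) (xs : Fin m → (Fin d → ℝ)),
        N (fun i => (∑ j, |xs j i| ^ p) ^ (1 / p)) ≤
          (∑ j, N (xs j) ^ p) ^ (1 / p))) ∨
      (∃ q : ℝ, 1 < q ∧ q < 2 ∧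
        (∀ (m : ℕ) (xs : Fin m → (Fin d → ℝ)),
        (∑ j, N (xs j) ^ q) ^ (1 / q) ≤
          N (fun i => (∑ j, |xs j i| ^ q) ^ (1 / q))) ∧
        (∀ i : Fin d, ∃! f : (Fin d → ℝ) →ₗ[ℝ] ℝ,
          (∀ y, |f y| ≤ N y) ∧ f ((Pi.single i 1 : Fin d → ℝ)) = N ((Pi.single i 1 : Fin d → ℝ)))))
    (g : (Fin d → ℝ) →ₗ[ℝ] ℝ) (hg : g ≠ 0)
    (P : (Fin d → ℝ) →ₗ[ℝ] (Fin d → ℝ))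
    (hP_proj : P ∘ₗ P = P)
    (hP_range : LinearMap.range P = LinearMap.ker g)
    (hP_contr : ∀ x, N (P x) ≤ N x) :
    {i : Fin d | g ((Pi.single i 1 : Fin d → ℝ)) ≠ 0}.ncard ≤ 2 := by
  classical
  by_contra hcard
  rw [not_le, Set.two_lt_ncard_iff] at hcard
  obtain ⟨i, j, k, hi, hj, hk, hij, hik, hjk⟩ := hcard
  simp only [Set.mem_ofPred_eq] at hi hj hk
  have hN0 : N 0 = 0 := by
    have := hN_smul 0 0
    simpa using this
  have hN_nn : ∀ x, 0 ≤ N x := by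
    intro x
    rw [← hN0]
    exact hN_uncond _ _ fun i => by simp
  have hN_pos : ∀ x, x ≠ 0 → 0 < N x := fun x hx =>
    lt_of_le_of_ne (hN_nn x) fun h => hx (hN_def x h.symm)
  have hrep : ∀ v : Fin d → ℝ, g v = ∑ i, g (Pi.single i 1) * v i := by
    intro v
    conv_lhs => rw [pi_eq_sum_univ' v]
    rw [map_sum]
    refine Finset.sum_congr rfl fun i _ => ?_
    rw [map_smul, smul_eq_mul, mul_comm]
  set G : Fin d → ℝ := fun i => g (Pi.single i 1) with hG
  obtain ⟨x0, hx0⟩ : ∃ x0, g x0 = 1 :=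
    ⟨(g (Pi.single i 1))⁻¹ • Pi.single i 1, by rw [map_smul, smul_eq_mul, inv_mul_cancel₀ hi]⟩
  have hgP : ∀ x, g (P x) = 0 := fun x => by
    have : P x ∈ LinearMap.ker g := hP_range ▸ LinearMap.mem_range_self P x
    exact this
  have hPP : ∀ x, P (P x) = P x := fun x => LinearMap.congr_fun hP_proj x
  set u := x0 - P x0 with hu
  have hgu : g u = 1 := by rw [hu, map_sub, hgP, hx0, sub_zero]
  have hPu : P u = 0 := by rw [hu, map_sub, hPP, sub_self]
  have hPx : ∀ x, P x = x - g x • u := by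
    intro x
    have : x - g x • u ∈ LinearMap.range P := by
      rw [hP_range, LinearMap.mem_ker, map_sub, map_smul, hgu]; simp
    obtain ⟨z, hz⟩ := this
    have h2 := hPP z
    rw [hz, map_sub, map_smul, hPu, smul_zero, sub_zero] at h2
    exact h2
  have hcontr : ∀ x, N (x - g x • u) ≤ N x := fun x => by rw [← hPx]; exact hP_contr x
  have hpos : ∀ l, G l ≠ 0 → 0 < G l * u l := by
    intro l hl
    by_contra hneg
    rw [not_lt] at hneg
    have h1 := hcontr (Pi.single l 1)
    change N (Pi.single l 1 - G l • u) ≤ _ at h1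
    refine absurd h1 (not_le.2 (hN_strict _ _ (fun m => ?_) ?_))
    · by_cases hm : m = l
      · subst hm
        simp only [Pi.single_eq_same, Pi.sub_apply, Pi.smul_apply, smul_eq_mul, abs_one]
        rw [abs_of_nonneg] <;> linarith
      · rw [Pi.single_eq_of_ne hm, abs_zero]; exact abs_nonneg _
    · by_contra hall
      push Not at hall
      have hu0 : u = 0 := by
        funext m
        have h3 := hall m
        by_cases hm : m = l
        · subst hm
          simp only [Pi.single_eq_same, Pi.sub_apply, Pi.smul_apply, smul_eq_mul, abs_one] at h3
          rw [abs_of_nonneg (by linarith)] at h3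
          have : G m * u m = 0 := by linarith
          exact (mul_eq_zero.1 this).resolve_left hl
        · simp only [Pi.single_eq_of_ne hm, Pi.sub_apply, Pi.smul_apply, smul_eq_mul, abs_zero,
            zero_sub, abs_neg] at h3
          have := abs_nonpos_iff.1 h3
          exact (mul_eq_zero.1 this).resolve_left hl
      rw [hu0, map_zero] at hgu
      exact zero_ne_one hgu
  rcases h_conv_or_conc with ⟨p, hp, hconv⟩ | ⟨q, hq1, hq2, hconc, -⟩
  · refine aux_core d N p hp hN_add hN_smul hN_pos hN_uncond (fun a b => ?_) G u
      (by rw [← hrep, hgu]) (fun x => by rw [← hrep]; exact hcontr x) i j k hij hik hjk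
      (hpos i hi) (hpos j hj) (hpos k hk)
    simpa [Fin.sum_univ_two] using hconv 2 ![a, b]
  · obtain ⟨M, hM_nn, hM1, hM2⟩ := aux_dual d N hN_smul hN_pos hN_uncond
    have hpq : (q.conjExponent).HolderConjugate q :=
      (Real.HolderConjugate.conjExponent hq1).symm
    have hp : 2 < q.conjExponent := by
      rw [Real.conjExponent, lt_div_iff₀ (by linarith)]; linarith
    have hM_uncond : ∀ x y : Fin d → ℝ, (∀ i, |x i| ≤ |y i|) → M x ≤ M y := by
      intro f h hfh
      refine hM2 _ _ (hM_nn _) fun x => ?_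
      have h1 := hM1 h (fun i => (SignType.sign (h i) : ℝ) * |x i|)
      have h2 : N (fun i => (SignType.sign (h i) : ℝ) * |x i|) ≤ N x := by
        refine hN_uncond _ _ fun i => ?_
        rw [abs_mul, abs_abs]
        refine mul_le_of_le_one_left (abs_nonneg _) ?_
        rcases lt_trichotomy (h i) 0 with h | h | h <;> simp [h]
      refine le_trans (Finset.sum_le_sum fun i _ => ?_)
        (h1.trans (mul_le_mul_of_nonneg_left h2 (hM_nn h)))
      rw [← mul_assoc, self_mul_sign]
      calc f i * x i ≤ |f i| * |x i| := by rw [← abs_mul]; exact le_abs_self _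
        _ ≤ _ := mul_le_mul_of_nonneg_right (hfh i) (abs_nonneg _)
    have hM_le : ∀ (c : ℝ) (f), M (c • f) ≤ |c| * M f := by
      intro c f
      refine hM2 _ _ (mul_nonneg (abs_nonneg _) (hM_nn _)) fun x => ?_
      have := hM1 f (c • x)
      rw [hN_smul] at this
      calc _ = ∑ i, f i * (c • x) i := Finset.sum_congr rfl fun i _ => by simp; ring
        _ ≤ _ := this
        _ = _ := by ring
    refine aux_core d M _ hp (fun f h => ?_) (fun c f => ?_) (fun f hf => ?_) hM_uncond
      (aux_dual_conv d N M _ q hpq hN_nn hN_uncond (fun a b => ?_) hM_nn hM1 hM2 hM_uncond) u G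
      ?_ (fun f => ?_) i j k hij hik hjk
      (by rw [mul_comm]; exact hpos i hi) (by rw [mul_comm]; exact hpos j hj)
      (by rw [mul_comm]; exact hpos k hk)
    · refine hM2 _ _ (add_nonneg (hM_nn _) (hM_nn _)) fun x => ?_
      simp only [Pi.add_apply, add_mul, Finset.sum_add_distrib]
      exact add_le_add (hM1 f x) (hM1 h x)
    · refine le_antisymm (hM_le c f) ?_
      by_cases hc : c = 0
      · subst hc; simpa using hM_nn 0
      · have := hM_le c⁻¹ (c • f)
        rw [inv_smul_smul₀ hc, abs_inv] at this
        have hc' := abs_pos.2 hc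
        calc |c| * M f ≤ |c| * (|c|⁻¹ * M (c • f)) := mul_le_mul_of_nonneg_left this hc'.le
          _ = _ := by field_simp
    · refine lt_of_le_of_ne (hM_nn f) fun h0 => hf ?_
      funext l
      have := hM1 f (Pi.single l (f l))
      rw [← h0, zero_mul, Finset.sum_eq_single l (fun m _ hm => by simp [hm]) (by simp)] at this
      simp only [Pi.single_eq_same] at this
      exact mul_self_eq_zero.1 (le_antisymm this (mul_self_nonneg _))
    · simpa [Fin.sum_univ_two] using hconc 2 ![a, b]
    · rw [← hgu, hrep]
      exact Finset.sum_congr rfl fun l _ => mul_comm _ _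
    · refine hM2 _ _ (hM_nn f) fun x => ?_
      have h1 := (hM1 f (x - g x • u)).trans (mul_le_mul_of_nonneg_left (hcontr x) (hM_nn f))
      refine le_trans (le_of_eq ?_) h1
      simp only [sub_mul, mul_sub, Pi.sub_apply, Pi.smul_apply, smul_eq_mul,
        Finset.sum_sub_distrib]
      congr 1
      simp only [mul_assoc, ← Finset.mul_sum]
      rw [← hrep, mul_comm, Finset.mul_sum]
      exact Finset.sum_congr rfl fun l _ => by ring
end

section
/- Let X = (Fin d → ℝ) carry a 1-unconditional, strictly monotone norm, and let P : X → X be a linear map with ‖P x‖ ≤ ‖x‖ for all x. If for some index l the l-th coordinate of P e_l equals 1, then P e_l = e_l. -/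
theorem stmt4 (d : ℕ)
    (N : (Fin d → ℝ) → ℝ)
    (hN_add : ∀ x y, N (x + y) ≤ N x + N y)
    (hN_smul : ∀ (c : ℝ) (x), N (c • x) = |c| * N x)
    (hN_def : ∀ x, N x = 0 → x = 0)
    (hN_uncond : ∀ x y : Fin d → ℝ, (∀ i, |x i| ≤ |y i|) → N x ≤ N y)
    (hN_strict : ∀ x y : Fin d → ℝ, (∀ i, |x i| ≤ |y i|) →
      (∃ i, |x i| < |y i|) → N x < N y)
    (P : (Fin d → ℝ) →ₗ[ℝ] (Fin d → ℝ))
    (hP_contr : ∀ x, N (P x) ≤ N x)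
    (l : Fin d)
    (hl : P ((Pi.single l 1 : Fin d → ℝ)) l = 1) :
    P ((Pi.single l 1 : Fin d → ℝ)) = (Pi.single l 1 : Fin d → ℝ) := by
  by_contra hne
  obtain ⟨i, hi⟩ := Function.ne_iff.mp hne
  have hil : i ≠ l := by
    rintro rfl
    exact hi (by rw [hl, Pi.single_eq_same])
  refine absurd (hN_strict (Pi.single l 1) (P (Pi.single l 1)) ?_ ⟨i, ?_⟩)
    (not_lt.mpr (hP_contr _))
  · intro j
    by_cases hj : j = l
    · subst hj
      rw [hl, Pi.single_eq_same]
    · rw [Pi.single_eq_of_ne hj, abs_zero]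
      exact abs_nonneg _
  · rw [Pi.single_eq_of_ne hil] at hi ⊢
    rw [abs_zero]
    exact abs_pos.mpr hi
end

section
/- Let X = (Fin d → ℝ) and Y = (Fin d → ℝ) carry 1-unconditional norms with normalized standard bases (e_i) and (f_i) respectively. Assume that every surjective linear isometry of X onto itself is elementary, or that every surjective linear isometry of Y onto itself is elementary. Let T : X → Y be a surjective linear isometry. Then for every index i, one of the following holds: (1) there exist an index k and a sign ε ∈ {−1, 1} with T e_i = ε f_k; or (2) there exist indices j ≠ i and k ≠ l and signs δ, ε ∈ {−1, 1} such that T e_i = (δ/‖f_k + f_l‖)(f_k + ε f_l) and T e_j = (δ/‖f_k + f_l‖)(f_k − ε f_l). Moreover, the two-element sets {i, j} (respectively {k, l}) arising in case (2) for different indices are either equal or disjoint, so they partition the set of indices not covered by case (1), and distinct indices in case (1) are sent to multiples of distinct basis vectors. -/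
def FormV {d : ℕ} (v : Fin d → ℝ) : Prop :=
  (∃ k, v k ≠ 0 ∧ ∀ n, n ≠ k → v n = 0) ∨
  (∃ k l, ∃ ε : ℝ, k ≠ l ∧ (ε = 1 ∨ ε = -1) ∧ v k ≠ 0 ∧ v l = ε * v k ∧
    ∀ n, n ≠ k → n ≠ l → v n = 0)

lemma FormV.smul {d : ℕ} {v w : Fin d → ℝ} (h : FormV v) (c : ℝ) (hc : c ≠ 0)
    (hw : ∀ m, w m = c * v m) : FormV w := by
  rcases h with ⟨k, hk, h⟩ | ⟨k, l, ε, hkl, hε, hk, hl, h⟩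
  · left
    refine ⟨k, by rw [hw]; exact mul_ne_zero hc hk, fun n hn => by rw [hw, h n hn, mul_zero]⟩
  · right
    refine ⟨k, l, ε, hkl, hε, by rw [hw]; exact mul_ne_zero hc hk, by rw [hw, hw, hl]; ring,
      fun n hn hn' => by rw [hw, h n hn hn', mul_zero]⟩

lemma refl_form {d : ℕ} (p v : Fin d → ℝ) (hpv : ∑ m, p m * v m = 1)
    (σ : Equiv.Perm (Fin d)) (a : Fin d → ℝ) (ha : ∀ m, |a m| = 1)
    (h : ∀ m n, (Pi.single m 1 : Fin d → ℝ) n - 2 * p m * v n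
      = a m * (Pi.single (σ m) 1 : Fin d → ℝ) n) :
    ∃ c : ℝ, c ≠ 0 ∧ (∀ m, p m = c * v m) ∧ FormV v := by
  obtain ⟨k, hk⟩ : ∃ k, p k * v k ≠ 0 := by
    by_contra! hcon
    simp [hcon] at hpv
  have hpk : p k ≠ 0 := left_ne_zero_of_mul hk
  have hvk : v k ≠ 0 := right_ne_zero_of_mul hk
  -- if v m = 0 then p m = 0
  have key : ∀ m, v m = 0 → p m = 0 := by
    intro m hm
    have h1 := h m m
    have h2 := h m k
    have hmk : k ≠ m := by rintro rfl; exact hvk hm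
    by_cases hs : σ m = m
    · simp [hs, Pi.single_apply, hmk, hvk] at h2
      exact h2
    · simp [hm, Pi.single_apply, Ne.symm hs] at h1
  by_cases hs : σ k = k
  · have hv : ∀ n, n ≠ k → v n = 0 := by
      intro n hn
      have h1 := h k n
      simp [hs, Pi.single_apply, hn, hpk] at h1
      exact h1
    refine ⟨p k / v k, div_ne_zero hpk hvk, ?_, Or.inl ⟨k, hvk, hv⟩⟩
    intro m
    by_cases hm : m = k
    · subst hm; field_simp
    · rw [hv m hm, key m (hv m hm), mul_zero]
  · have hv : ∀ n, n ≠ k → n ≠ σ k → v n = 0 := by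
      intro n hn hn'
      have h1 := h k n
      simp [Pi.single_apply, hn, hn', hpk] at h1
      exact h1
    have h1 := h k k
    have h2 := h k (σ k)
    simp [Pi.single_apply, Ne.symm hs] at h1
    simp [Pi.single_apply, hs] at h2
    have hε : -a k = 1 ∨ -a k = -1 := by
      rcases (abs_eq (zero_le_one)).1 (ha k) with h | h <;> simp [h]
    have hvl : v (σ k) = (-a k) * v k := by
      have : p k * (v (σ k) - (-a k) * v k) = 0 := by
        linear_combination (-1/2 : ℝ) * h2 - (1/2 : ℝ) * a k * h1
      rcases mul_eq_zero.1 this with h | h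
      · exact absurd h hpk
      · linarith
    have hsum : p k * v k + p (σ k) * v (σ k) = 1 := by
      rw [← hpv]
      symm
      apply Finset.sum_eq_add_of_mem k (σ k) (Finset.mem_univ _) (Finset.mem_univ _) (Ne.symm hs)
      intro c _ hc
      rw [hv c hc.1 hc.2, mul_zero]
    have hsq : (a k) * (a k) = 1 := by
      have := ha k
      rw [← abs_mul_abs_self, this, mul_one]
    refine ⟨p k / v k, div_ne_zero hpk hvk, ?_,
      Or.inr ⟨k, σ k, -a k, Ne.symm hs, hε, hvk, hvl, hv⟩⟩
    intro m
    by_cases hm : m = k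
    · subst hm; field_simp
    · by_cases hm' : m = σ k
      · subst hm'
        rw [hvl] at hsum ⊢
        have h3 : v k * (p (σ k) + a k * p k) = 0 := by
          linear_combination (-a k) * hsum - (v k * p (σ k)) * hsq - a k * h1
        have h4 : p (σ k) = - a k * p k := by
          rcases mul_eq_zero.1 h3 with h | h
          · exact absurd h hvk
          · linarith
        rw [h4]; field_simp
      · rw [hv m hm hm', key m (hv m hm hm'), mul_zero]

def refl' {d : ℕ} (φ : (Fin d → ℝ) →ₗ[ℝ] ℝ) (v : Fin d → ℝ) :
    (Fin d → ℝ) →ₗ[ℝ] (Fin d → ℝ) :=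
  LinearMap.id - ((2 : ℝ) • φ).smulRight v

lemma refl'_apply {d : ℕ} (φ : (Fin d → ℝ) →ₗ[ℝ] ℝ) (v x : Fin d → ℝ) :
    refl' φ v x = x - (2 * φ x) • v := by
  simp [refl']

lemma N_congr {d : ℕ} {N : (Fin d → ℝ) → ℝ}
    (hu : ∀ x y : Fin d → ℝ, (∀ i, |x i| ≤ |y i|) → N x ≤ N y) {x y : Fin d → ℝ}
    (h : ∀ i, |x i| = |y i|) : N x = N y :=
  le_antisymm (hu _ _ fun i => (h i).le) (hu _ _ fun i => (h i).ge)

lemma single_expand {d : ℕ} (φ : (Fin d → ℝ) →ₗ[ℝ] ℝ) (v : Fin d → ℝ) :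
    φ v = ∑ m, φ (Pi.single m 1) * v m := by
  conv_lhs => rw [pi_eq_sum_univ' v]
  simp only [map_sum, map_smul, smul_eq_mul]
  refine Finset.sum_congr rfl fun m _ => ?_
  rw [mul_comm]

lemma caseX {d : ℕ} (N1 N2 : (Fin d → ℝ) → ℝ)
    (hs1 : ∀ (c : ℝ) (x), N1 (c • x) = |c| * N1 x)
    (hu2 : ∀ x y : Fin d → ℝ, (∀ i, |x i| ≤ |y i|) → N2 x ≤ N2 y)
    (hn1 : ∀ i : Fin d, N1 ((Pi.single i 1 : Fin d → ℝ)) = 1)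
    (h_elem :
      (∀ S : (Fin d → ℝ) →ₗ[ℝ] (Fin d → ℝ), Function.Surjective S →
        (∀ x, N1 (S x) = N1 x) →
        ∃ (σ : Equiv.Perm (Fin d)) (a : Fin d → ℝ),
          ∀ i, S ((Pi.single i 1 : Fin d → ℝ)) = a i • (Pi.single (σ i) 1 : Fin d → ℝ)))
    (E : (Fin d → ℝ) ≃ₗ[ℝ] (Fin d → ℝ)) (hE : ∀ x, N2 (E x) = N1 x) (k : Fin d) :
    ∃ c : ℝ, c ≠ 0 ∧ (∀ m, E (Pi.single m 1) k = c * E.symm (Pi.single k 1) m) ∧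
      FormV (E.symm (Pi.single k 1)) := by
  set v := E.symm (Pi.single k 1) with hv
  let φ : (Fin d → ℝ) →ₗ[ℝ] ℝ := (LinearMap.proj k).comp E.toLinearMap
  have hφ : ∀ x, φ x = E x k := fun x => rfl
  have hφv : φ v = 1 := by simp [hφ, hv]
  have hinv : ∀ x, refl' φ v (refl' φ v x) = x := by
    intro x
    simp only [refl'_apply, map_sub, map_smul, hφv, smul_eq_mul]
    ext n
    simp
    ring
  have hiso : ∀ x, N1 (refl' φ v x) = N1 x := by
    intro x
    rw [← hE, ← hE x]
    apply N_congr hu2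
    intro i
    simp only [refl'_apply, map_sub, map_smul, hv, LinearEquiv.apply_symm_apply, hφ]
    by_cases hi : i = k
    · subst hi
      simp
      rw [← abs_neg]; congr 1; ring
    · simp [Pi.single_apply, hi]
  obtain ⟨σ, a, ha⟩ := h_elem (refl' φ v) (fun x => ⟨_, hinv x⟩) hiso
  refine refl_form (fun m => E (Pi.single m 1) k) v ?_ σ a ?_ ?_
  · exact (single_expand φ v).symm.trans hφv
  · intro m
    have := hiso (Pi.single m 1)
    rw [ha, hs1, hn1, hn1, mul_one] at this
    exact this
  · intro m n
    have := congrFun (ha m) n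
    rw [refl'_apply] at this
    simpa [hφ] using this

lemma comb {d : ℕ} (u : Fin d → Fin d → ℝ)
    (horth : ∀ i j, i ≠ j → ∑ m, u i m * u j m = 0)
    (htot : ∀ w : Fin d → ℝ, (∀ i, ∑ m, u i m * w m = 0) → w = 0)
    (hform : ∀ i, FormV (u i)) (i : Fin d) :
    (∃ k, u i k ≠ 0 ∧ (∀ m, m ≠ k → u i m = 0) ∧ ∀ j, j ≠ i → u j k = 0) ∨
    (∃ j k l, ∃ ε : ℝ, j ≠ i ∧ k ≠ l ∧ (ε = 1 ∨ ε = -1) ∧ u i k ≠ 0 ∧ u i l = ε * u i k ∧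
      u j k ≠ 0 ∧ u j l = -ε * u j k ∧ (∀ m, m ≠ k → m ≠ l → u i m = 0 ∧ u j m = 0) ∧
      ∀ n, n ≠ i → n ≠ j → u n k = 0 ∧ u n l = 0) := by
  rcases hform i with ⟨k, hk, h⟩ | ⟨k, l, ε, hkl, hε, hk, hl, h⟩
  · left
    refine ⟨k, hk, h, fun j hj => ?_⟩
    have := horth i j (Ne.symm hj)
    rw [Finset.sum_eq_single k (fun b _ hb => by rw [h b hb, zero_mul]) (by simp)] at this
    exact (mul_eq_zero.1 this).resolve_left hk
  · right
    have hεε : ε * ε = 1 := by rcases hε with h | h <;> rw [h] <;> norm_num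
    have two : ∀ (i : Fin d) (w : Fin d → ℝ), (∀ n, n ≠ k → n ≠ l → u i n = 0) →
        ∑ m, u i m * w m = u i k * w k + u i l * w l := by
      intro i w h
      apply Finset.sum_eq_add_of_mem k l (Finset.mem_univ _) (Finset.mem_univ _) hkl
      intro c _ hc
      rw [h c hc.1 hc.2, zero_mul]
    have hplus : ∀ n, n ≠ i → u n k + ε * u n l = 0 := by
      intro n hn
      have := horth i n (Ne.symm hn)
      rw [two i _ h, hl] at this
      have h2 : u i k * (u n k + ε * u n l) = 0 := by linear_combination this
      exact (mul_eq_zero.1 h2).resolve_left hk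
    obtain ⟨j, hj⟩ : ∃ j, u j k - ε * u j l ≠ 0 := by
      by_contra! hcon
      have := htot (Pi.single k 1 - ε • Pi.single l 1) (fun i => by
        simp only [Pi.sub_apply, Pi.smul_apply, smul_eq_mul, mul_sub, Finset.sum_sub_distrib]
        simp [Pi.single_apply]
        linarith [hcon i])
      have := congrFun this k
      simp [Pi.single_apply, hkl] at this
    have hji : j ≠ i := by
      rintro rfl
      apply hj; rw [hl]; linear_combination -(u j k) * hεε
    have hp := hplus j hji
    have hjk : u j k ≠ 0 := by
      intro h0; apply hj; linarith
    have hjl : u j l = -ε * u j k := by linear_combination ε * hp - u j l * hεε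
    have hjl0 : u j l ≠ 0 := by
      rw [hjl]; rcases hε with h | h <;> rw [h] <;> simpa using hjk
    have hjz : ∀ n, n ≠ k → n ≠ l → u j n = 0 := by
      intro n hnk hnl
      rcases hform j with ⟨k', hk', h'⟩ | ⟨k', l', ε', hkl', hε', hk', hl', h'⟩
      · have h1 : k = k' := by by_contra hh; exact hjk (h' _ hh)
        have h2 : l = k' := by by_contra hh; exact hjl0 (h' _ hh)
        exact absurd (h1.trans h2.symm) hkl
      · have h1 : k = k' ∨ k = l' := by by_contra! hh; exact hjk (h' _ hh.1 hh.2)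
        have h2 : l = k' ∨ l = l' := by by_contra! hh; exact hjl0 (h' _ hh.1 hh.2)
        apply h' <;> grind
    refine ⟨j, k, l, ε, hji, hkl, hε, hk, hl, hjk, hjl, fun m h1 h2 => ⟨h m h1 h2, hjz m h1 h2⟩, ?_⟩
    intro n hni hnj
    have h1 := hplus n hni
    have h2 := horth j n (Ne.symm hnj)
    rw [two j _ hjz, hjl] at h2
    have h3 : u j k * (u n k - ε * u n l) = 0 := by linear_combination h2
    have h4 := (mul_eq_zero.1 h3).resolve_left hjk
    have h5 : u n k = 0 := by linarith
    refine ⟨h5, ?_⟩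
    have h6 : ε * u n l = 0 := by linarith
    rcases hε with h | h <;> rw [h] at h6 <;> linarith

/-- weak block form at column `i` of the matrix `M`. -/
def BlockW {d : ℕ} (M : Fin d → Fin d → ℝ) (i : Fin d) : Prop :=
  (∃ k, M k i ≠ 0 ∧ (∀ m, m ≠ k → M m i = 0) ∧ ∀ j, j ≠ i → M k j = 0) ∨
  (∃ j k l, j ≠ i ∧ k ≠ l ∧ M k i ≠ 0 ∧ |M l i| = |M k i| ∧ |M k j| = |M k i| ∧
    |M l j| = |M k i| ∧ M k i * M k j + M l i * M l j = 0 ∧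
    (∀ m, m ≠ k → m ≠ l → M m i = 0 ∧ M m j = 0) ∧
    ∀ n, n ≠ i → n ≠ j → M k n = 0 ∧ M l n = 0)

def BlockS {d : ℕ} (M : Fin d → Fin d → ℝ) (i j k l : Fin d) : Prop :=
  j ≠ i ∧ k ≠ l ∧ M k i ≠ 0 ∧ M k j = M k i ∧ (M l i = M k i ∨ M l i = - M k i) ∧
    M l j = - M l i ∧
    (∀ m, m ≠ k → m ≠ l → M m i = 0 ∧ M m j = 0) ∧
    ∀ n, n ≠ i → n ≠ j → M k n = 0 ∧ M l n = 0

lemma BlockW.strong {d : ℕ} {M : Fin d → Fin d → ℝ} {i : Fin d} (h : BlockW M i) :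
    (∃ k, M k i ≠ 0 ∧ (∀ m, m ≠ k → M m i = 0) ∧ ∀ j, j ≠ i → M k j = 0) ∨
    ∃ j k l, BlockS M i j k l := by
  rcases h with h | ⟨j, k, l, hji, hkl, h0, h1, h2, h3, h4, h5, h6⟩
  · exact Or.inl h
  · right
    have h1' := abs_eq_abs.1 h1
    have hl0 : M l i ≠ 0 := by
      rw [← abs_pos, h1]; exact abs_pos.2 h0
    rcases abs_eq_abs.1 h2 with e | e
    · refine ⟨j, k, l, hji, hkl, h0, e, h1', ?_, h5, h6⟩
      rw [e] at h4
      rcases h1' with f | f <;> rw [f] at h4 ⊢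
      · have : M k i * (M k i + M l j) = 0 := by linear_combination h4
        have := (mul_eq_zero.1 this).resolve_left h0
        linarith
      · have : M k i * (M k i - M l j) = 0 := by linear_combination h4
        have := (mul_eq_zero.1 this).resolve_left h0
        linarith
    · refine ⟨j, l, k, hji, hkl.symm, hl0, ?_, ?_, e, fun m a b => h5 m b a,
        fun n a b => (h6 n a b).symm⟩
      · rw [e] at h4
        rcases h1' with f | f <;> rw [f] at h4 ⊢
        · have : M k i * (M k i - M l j) = 0 := by linear_combination -h4
          have := (mul_eq_zero.1 this).resolve_left h0
          linarith
        · have : M k i * (M k i + M l j) = 0 := by linear_combination -h4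
          have := (mul_eq_zero.1 this).resolve_left h0
          linarith
      · rcases h1' with f | f <;> rw [f] <;> simp

lemma N_two {d : ℕ} {N : (Fin d → ℝ) → ℝ}
    (hs : ∀ (c : ℝ) (x), N (c • x) = |c| * N x)
    (hu : ∀ x y : Fin d → ℝ, (∀ i, |x i| ≤ |y i|) → N x ≤ N y)
    {k l : Fin d} (hkl : k ≠ l) (w : Fin d → ℝ) (hw : |w l| = |w k|)
    (h0 : ∀ m, m ≠ k → m ≠ l → w m = 0) :
    N w = |w k| * N (Pi.single k 1 + Pi.single l 1) := by
  rw [← hs]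
  apply N_congr hu
  intro m
  by_cases h1 : m = k
  · subst h1; simp [Pi.single_apply, hkl]
  · by_cases h2 : m = l
    · subst h2; simp [Pi.single_apply, h1, hw]
    · simp [Pi.single_apply, h1, h2, h0 m h1 h2]


theorem stmt5 (d : ℕ)
    (NX NY : (Fin d → ℝ) → ℝ)
    (hNX_add : ∀ x y, NX (x + y) ≤ NX x + NX y)
    (hNX_smul : ∀ (c : ℝ) (x), NX (c • x) = |c| * NX x)
    (hNX_def : ∀ x, NX x = 0 → x = 0)
    (hNY_add : ∀ x y, NY (x + y) ≤ NY x + NY y)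
    (hNY_smul : ∀ (c : ℝ) (x), NY (c • x) = |c| * NY x)
    (hNY_def : ∀ x, NY x = 0 → x = 0)
    (hNX_uncond : ∀ x y : Fin d → ℝ, (∀ i, |x i| ≤ |y i|) → NX x ≤ NX y)
    (hNY_uncond : ∀ x y : Fin d → ℝ, (∀ i, |x i| ≤ |y i|) → NY x ≤ NY y)
    (hNX_normal : ∀ i : Fin d, NX ((Pi.single i 1 : Fin d → ℝ)) = 1)
    (hNY_normal : ∀ i : Fin d, NY ((Pi.single i 1 : Fin d → ℝ)) = 1)
    (h_elem :
      (∀ S : (Fin d → ℝ) →ₗ[ℝ] (Fin d → ℝ), Function.Surjective S →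
        (∀ x, NX (S x) = NX x) →
        ∃ (σ : Equiv.Perm (Fin d)) (a : Fin d → ℝ),
          ∀ i, S ((Pi.single i 1 : Fin d → ℝ)) = a i • (Pi.single (σ i) 1 : Fin d → ℝ)) ∨
      (∀ S : (Fin d → ℝ) →ₗ[ℝ] (Fin d → ℝ), Function.Surjective S →
        (∀ x, NY (S x) = NY x) →
        ∃ (σ : Equiv.Perm (Fin d)) (a : Fin d → ℝ),
          ∀ i, S ((Pi.single i 1 : Fin d → ℝ)) = a i • (Pi.single (σ i) 1 : Fin d → ℝ)))
    (T : (Fin d → ℝ) →ₗ[ℝ] (Fin d → ℝ))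
    (hT_surj : Function.Surjective T)
    (hT_isom : ∀ x, NY (T x) = NX x) :
    ∃ (A : Set (Fin d)) (σ τ κ lam : Fin d → Fin d),
      Set.InjOn σ A ∧
      (∀ i ∈ A, ∃ ε : ℝ, (ε = 1 ∨ ε = -1) ∧
        T ((Pi.single i 1 : Fin d → ℝ)) = ε • (Pi.single (σ i) 1 : Fin d → ℝ)) ∧
      (∀ i ∉ A, τ i ∉ A ∧ τ i ≠ i ∧ τ (τ i) = i ∧ κ i ≠ lam i ∧
        κ (τ i) = κ i ∧ lam (τ i) = lam i ∧
        κ i ∉ σ '' A ∧ lam i ∉ σ '' A ∧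
        ∃ δ ε : ℝ, (δ = 1 ∨ δ = -1) ∧ (ε = 1 ∨ ε = -1) ∧
          T ((Pi.single i 1 : Fin d → ℝ)) =
            (δ / NY ((Pi.single (κ i) 1 : Fin d → ℝ) + (Pi.single (lam i) 1 : Fin d → ℝ))) •
              ((Pi.single (κ i) 1 : Fin d → ℝ) + ε • (Pi.single (lam i) 1 : Fin d → ℝ)) ∧
          T ((Pi.single (τ i) 1 : Fin d → ℝ)) =
            (δ / NY ((Pi.single (κ i) 1 : Fin d → ℝ) + (Pi.single (lam i) 1 : Fin d → ℝ))) •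
              ((Pi.single (κ i) 1 : Fin d → ℝ) - ε • (Pi.single (lam i) 1 : Fin d → ℝ))) ∧
      (∀ i ∉ A, ∀ j ∉ A, j ≠ i → j ≠ τ i →
        ({κ i, lam i} : Set (Fin d)) ∩ {κ j, lam j} = ∅) ∧
      (∀ k : Fin d, k ∉ σ '' A → ∃ i, i ∉ A ∧ (k = κ i ∨ k = lam i)) := by

  have hTinj : Function.Injective T := by
    rw [injective_iff_map_eq_zero]
    intro x hx
    apply hNX_def
    rw [← hT_isom, hx]
    simpa using hNY_smul 0 0
  set E := LinearEquiv.ofBijective T ⟨hTinj, hT_surj⟩ with hEdef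
  have hET : ∀ x, E x = T x := fun x => rfl
  have hE : ∀ x, NY (E x) = NX x := hT_isom
  have hE' : ∀ x, NX (E.symm x) = NY x := fun x => by rw [← hE, E.apply_symm_apply]
  let M : Fin d → Fin d → ℝ := fun k i => T (Pi.single i 1) k
  have hMdef : ∀ k i, M k i = T (Pi.single i 1) k := fun _ _ => rfl
  have hTx : ∀ x k, T x k = ∑ m, M k m * x m := fun x k =>
    single_expand ((LinearMap.proj k).comp T) x
  have hcol : ∀ k, ∃ i, M k i ≠ 0 := by
    intro k
    by_contra! hcon
    obtain ⟨x, hx⟩ := hT_surj (Pi.single k 1)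
    have := hTx x k
    rw [hx] at this
    simp [hcon] at this
  have hblock : ∀ i, BlockW M i := by
    rcases h_elem with hX | hY
    · have hc := caseX NX NY hNX_smul hNY_uncond hNX_normal hX E hE
      have hform : ∀ k, FormV (M k) := by
        intro k
        obtain ⟨c, hc0, hc1, hf⟩ := hc k
        exact hf.smul c hc0 hc1
      have horth : ∀ k l, k ≠ l → ∑ m, M k m * M l m = 0 := by
        intro k l hkl
        obtain ⟨c, hc0, hc1, hf⟩ := hc l
        have h1 := hTx (E.symm (Pi.single l 1)) k
        rw [← hET, E.apply_symm_apply, Pi.single_apply, if_neg hkl] at h1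
        have h2 : ∀ m, M k m * M l m = c * (M k m * E.symm (Pi.single l 1) m) := by
          intro m
          have := hc1 m
          rw [hET, ← hMdef] at this
          rw [this]; ring
        simp_rw [h2]
        rw [← Finset.mul_sum, ← h1, mul_zero]
      have htot : ∀ w : Fin d → ℝ, (∀ i, ∑ m, M i m * w m = 0) → w = 0 := by
        intro w hw
        apply hTinj
        rw [map_zero]
        ext k
        rw [hTx, hw]; rfl
      have hcomb := comb M horth htot hform
      intro i
      obtain ⟨k, hk⟩ : ∃ k, M k i ≠ 0 := by
        by_contra! hcon
        have : T (Pi.single i 1) = 0 := by ext k; exact hcon k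
        have h2 := hNX_normal i
        rw [← hT_isom, this] at h2
        have h3 := hNY_smul 0 0
        simp at h3
        rw [h3] at h2
        norm_num at h2
      rcases hcomb k with ⟨p, hp, hz, hr⟩ | ⟨l, p, q, ε, hlk, hpq, hε, h0, h1, h2, h3, h4, h5⟩
      · have : i = p := by by_contra hh; exact hk (hz _ hh)
        subst this
        exact Or.inl ⟨k, hp, hr, hz⟩
      · right
        have hεε : ε * ε = 1 := by rcases hε with h | h <;> rw [h] <;> norm_num
        have hεa : |ε| = 1 := by rcases hε with h | h <;> rw [h] <;> norm_num
        have hcols : ∀ (w : Fin d → ℝ), (∀ m, m ≠ p → m ≠ q → w m = 0) → ∀ r,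
            T w r = M r p * w p + M r q * w q := by
          intro w hw r
          rw [hTx]
          apply Finset.sum_eq_add_of_mem p q (Finset.mem_univ _) (Finset.mem_univ _) hpq
          intro c _ hc
          rw [hw c hc.1 hc.2, mul_zero]
        have habs : |M l p| = |M k p| := by
          have hw : ∀ t : ℝ, |t| = 1 → NX (Pi.single p 1 + t • Pi.single q 1)
              = NX (Pi.single p 1 + Pi.single q 1) := by
            intro t ht
            rw [N_two hNX_smul hNX_uncond hpq]
            · simp [Pi.single_apply, hpq]
            · simp [Pi.single_apply, hpq, hpq.symm, ht]
            · intro m a b; simp [Pi.single_apply, a, b]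
          have hT1 : ∀ t : ℝ, ∀ r, T (Pi.single p 1 + t • Pi.single q 1) r
              = M r p + t * M r q := by
            intro t r
            rw [hcols _ (fun m a b => by simp [Pi.single_apply, a, b])]
            simp [Pi.single_apply, hpq, hpq.symm]; ring
          have hTk : T (Pi.single p 1 + ε • Pi.single q 1) = (2 * M k p) • Pi.single k 1 := by
            ext r
            rw [hT1]
            by_cases hr : r = k
            · subst hr; simp [h1]; linear_combination M r p * hεε
            · by_cases hr' : r = l
              · subst hr'; simp [Pi.single_apply, hr, h3]; linear_combination -M r p * hεε
              · simp [Pi.single_apply, hr, h5 r hr hr']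
          have hTl : T (Pi.single p 1 + (-ε) • Pi.single q 1) = (2 * M l p) • Pi.single l 1 := by
            ext r
            rw [hT1]
            by_cases hr : r = k
            · subst hr; simp [Pi.single_apply, hlk.symm, h1]; linear_combination -M r p * hεε
            · by_cases hr' : r = l
              · subst hr'; simp [h3]; linear_combination M r p * hεε
              · simp [Pi.single_apply, hr', h5 r hr hr']
          have e1 := hw ε hεa
          have e2 := hw (-ε) (by rw [abs_neg, hεa])
          rw [← hT_isom, hTk, hNY_smul, hNY_normal, abs_mul] at e1
          rw [← hT_isom, hTl, hNY_smul, hNY_normal, abs_mul] at e2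
          simp at e1 e2
          linarith
        have hkq : |M k q| = |M k p| := by rw [h1, abs_mul, hεa, one_mul]
        have hlq : |M l q| = |M k p| := by rw [h3, abs_mul, abs_neg, hεa, one_mul, habs]
        have hMkq : M k q ≠ 0 := by rw [← abs_pos, hkq]; exact abs_pos.2 h0
        have hsq : M l p * M l p = M k p * M k p := by
          rw [← abs_mul_abs_self, habs, abs_mul_abs_self]
        have hsum : M k p * M k q + M l p * M l q = 0 := by
          rw [h1, h3]; linear_combination -ε * hsq
        have hi : i = p ∨ i = q := by
          by_contra! hh
          exact hk (h4 i hh.1 hh.2).1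
        rcases hi with rfl | rfl
        · exact ⟨q, k, l, hpq.symm, hlk.symm, h0, habs, hkq, hlq, hsum, h5, h4⟩
        · refine ⟨p, k, l, hpq, hlk.symm, hMkq, hlq.trans hkq.symm, hkq.symm, habs.trans hkq.symm,
            by linarith, fun m a b => (h5 m a b).symm, fun n a b => h4 n b a⟩
    · have hc := caseX NY NX hNY_smul hNX_uncond hNY_normal hY E.symm hE'
      simp only [LinearEquiv.symm_symm] at hc
      have hform : ∀ i, FormV (fun k => M k i) := by
        intro i
        obtain ⟨c, hc0, hc1, hf⟩ := hc i
        exact hf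
      have horth : ∀ i j, i ≠ j → ∑ m, M m i * M m j = 0 := by
        intro i j hij
        obtain ⟨c, hc0, hc1, hf⟩ := hc i
        have h1 := single_expand ((LinearMap.proj i).comp E.symm.toLinearMap) (E (Pi.single j 1))
        simp [Pi.single_apply, hij] at h1
        have h2 : ∀ m, E.symm (Pi.single m 1) i * E (Pi.single j 1) m = c * (M m i * M m j) := by
          intro m
          rw [hc1]
          simp only [hET, hMdef]; ring
        have h1' : 0 = ∑ m, c * (M m i * M m j) := by
          rw [h1]
          refine Finset.sum_congr rfl fun m _ => ?_
          rw [← h2]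
        rw [← Finset.mul_sum] at h1'
        exact (mul_eq_zero.1 h1'.symm).resolve_left hc0
      have htot : ∀ w : Fin d → ℝ, (∀ i, ∑ m, M m i * w m = 0) → w = 0 := by
        intro w hw
        obtain ⟨x, hx⟩ := hT_surj w
        have : ∑ k, w k * w k = 0 := by
          have h1 : ∀ k, w k * w k = ∑ m, x m * (M k m * w k) := by
            intro k
            nth_rewrite 1 [← hx]
            rw [hTx, Finset.sum_mul]
            exact Finset.sum_congr rfl fun m _ => by ring
          simp_rw [h1]
          rw [Finset.sum_comm]
          simp_rw [← Finset.mul_sum, hw]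
          simp
        rw [Finset.sum_eq_zero_iff_of_nonneg (fun i _ => mul_self_nonneg _)] at this
        ext k
        simpa using this k (Finset.mem_univ _)
      intro i
      rcases comb (fun i k => M k i) horth htot hform i with h |
        ⟨j, k, l, ε, hji, hkl, hε, h0, h1, h2, h3, h4, h5⟩
      · exact Or.inl h
      · right
        have hεa : |ε| = 1 := by rcases hε with h | h <;> rw [h] <;> norm_num
        have hli : |M l i| = |M k i| := by rw [h1, abs_mul, hεa, one_mul]
        have hlj : |M l j| = |M k j| := by rw [h3, abs_mul, abs_neg, hεa, one_mul]
        have e1 := N_two hNY_smul hNY_uncond hkl (T (Pi.single i 1)) hli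
          (fun m a b => (h4 m a b).1)
        have e2 := N_two hNY_smul hNY_uncond hkl (T (Pi.single j 1)) hlj
          (fun m a b => (h4 m a b).2)
        rw [hT_isom, hNX_normal] at e1 e2
        have hkj : |M k j| = |M k i| := by
          have hne : NY (Pi.single k 1 + Pi.single l 1) ≠ 0 := by
            intro h; rw [h] at e1; simp at e1
          exact mul_right_cancel₀ hne (e2.symm.trans e1)
        refine ⟨j, k, l, hji, hkl, h0, hli, hkj, hlj.trans hkj, ?_, h4, h5⟩
        have := horth i j hji.symm
        rw [Finset.sum_eq_add_of_mem k l (Finset.mem_univ _) (Finset.mem_univ _) hkl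
          (fun c _ hc => by rw [(h4 c hc.1 hc.2).1, zero_mul])] at this
        exact this
  have hstr := fun i => (hblock i).strong
  clear hblock h_elem
  let A : Set (Fin d) := {i | ∃ k, M k i ≠ 0 ∧ (∀ m, m ≠ k → M m i = 0) ∧ ∀ j, j ≠ i → M k j = 0}
  have hA1 : ∀ i, ∃ k, i ∈ A →
      M k i ≠ 0 ∧ (∀ m, m ≠ k → M m i = 0) ∧ ∀ j, j ≠ i → M k j = 0 := by
    intro i
    by_cases hi : i ∈ A
    · obtain ⟨k, hk⟩ := hi
      exact ⟨k, fun _ => hk⟩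
    · exact ⟨i, fun h => absurd h hi⟩
  have hA2 : ∀ i, ∃ j k l, i ∉ A → BlockS M i j k l := by
    intro i
    by_cases hi : i ∈ A
    · exact ⟨i, i, i, fun h => absurd hi h⟩
    · obtain ⟨j, k, l, h⟩ := (hstr i).resolve_left hi
      exact ⟨j, k, l, fun _ => h⟩
  choose σ hσ using hA1
  choose τ κ lam hB using hA2
  -- nonzero entries
  have hBnz : ∀ i, i ∉ A → M (lam i) i ≠ 0 ∧ M (κ i) (τ i) ≠ 0 ∧ M (lam i) (τ i) ≠ 0 := by
    intro i hi
    obtain ⟨h1, h2, h3, h4, h5, h6, h7, h8⟩ := hB i hi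
    have : M (lam i) i ≠ 0 := by
      rcases h5 with h | h <;> rw [h] <;> simpa using h3
    exact ⟨this, by rw [h4]; exact h3, by rw [h6]; simpa using this⟩
  have hτA : ∀ i, i ∉ A → τ i ∉ A := by
    rintro i hi ⟨k, h1, h2, h3⟩
    obtain ⟨n1, n2, n3⟩ := hBnz i hi
    have a1 : κ i = k := by by_contra h; exact n2 (h2 _ h)
    have a2 : lam i = k := by by_contra h; exact n3 (h2 _ h)
    exact (hB i hi).2.1 (a1.trans a2.symm)
  have hττ : ∀ i, i ∉ A → τ (τ i) = i ∧ κ (τ i) = κ i ∧ lam (τ i) = lam i := by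
    intro i hi
    obtain ⟨n1, n2, n3⟩ := hBnz i hi
    obtain ⟨h1, h2, h3, h4, h5, h6, h7, h8⟩ := hB i hi
    obtain ⟨n1', n2', n3'⟩ := hBnz _ (hτA i hi)
    obtain ⟨g1, g2, g3, g4, g5, g6, g7, g8⟩ := hB _ (hτA i hi)
    have c1 : κ (τ i) = κ i ∨ κ (τ i) = lam i := by
      by_contra! h; exact g3 (h7 _ h.1 h.2).2
    have c2 : lam (τ i) = κ i ∨ lam (τ i) = lam i := by
      by_contra! h; exact n1' (h7 _ h.1 h.2).2
    have c3 : τ (τ i) = i := by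
      by_contra h
      rcases c1 with c | c <;> rw [c] at n2'
      · exact n2' (h8 _ h g1).1
      · exact n2' (h8 _ h g1).2
    have c4 : κ (τ i) = κ i := by
      rcases c1 with c | c
      · exact c
      · exfalso
        rw [c3, c, h6] at g4
        apply n1; linarith
    refine ⟨c3, c4, ?_⟩
    rcases c2 with c | c
    · exact absurd (c4.trans c.symm) g2
    · exact c
  have hrow : ∀ i, i ∉ A → ∀ r, (r = κ i ∨ r = lam i) → ∀ n, M r n ≠ 0 → n = i ∨ n = τ i := by
    intro i hi r hr n hn
    by_contra! h
    have := (hB i hi).2.2.2.2.2.2.2 n h.1 h.2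
    rcases hr with rfl | rfl
    · exact hn this.1
    · exact hn this.2
  have hrownz : ∀ i, i ∉ A → ∀ r, (r = κ i ∨ r = lam i) → M r i ≠ 0 ∧ M r (τ i) ≠ 0 := by
    intro i hi r hr
    obtain ⟨n1, n2, n3⟩ := hBnz i hi
    rcases hr with rfl | rfl
    · exact ⟨(hB i hi).2.2.1, n2⟩
    · exact ⟨n1, n3⟩
  have hnotσ : ∀ i, i ∉ A → ∀ r, (r = κ i ∨ r = lam i) → r ∉ σ '' A := by
    rintro i hi r hr ⟨a, ha, rfl⟩
    have := (hσ a ha).2.2 i (by rintro rfl; exact hi ha)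
    exact (hrownz i hi _ hr).1 this
  refine ⟨A, σ, τ, κ, lam, ?_, ?_, ?_, ?_, ?_⟩
  · intro a ha b hb hab
    by_contra h
    have := (hσ a ha).2.2 b (Ne.symm h)
    rw [hab] at this
    exact (hσ b hb).1 this
  · intro i hi
    obtain ⟨h1, h2, h3⟩ := hσ i hi
    have hT : T (Pi.single i 1) = M (σ i) i • Pi.single (σ i) 1 := by
      ext r
      by_cases hr : r = σ i
      · subst hr; simp [hMdef]
      · simp [Pi.single_apply, hr]; exact h2 r hr
    refine ⟨M (σ i) i, ?_, hT⟩
    have := hT_isom (Pi.single i 1)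
    rw [hT, hNY_smul, hNY_normal, hNX_normal, mul_one] at this
    exact (abs_eq zero_le_one).1 this
  · intro i hi
    obtain ⟨h1, h2, h3, h4, h5, h6, h7, h8⟩ := hB i hi
    obtain ⟨t1, t2, t3⟩ := hττ i hi
    refine ⟨hτA i hi, h1, t1, h2, t2, t3, hnotσ i hi _ (Or.inl rfl), hnotσ i hi _ (Or.inr rfl), ?_⟩
    obtain ⟨ε, hε, hεM⟩ : ∃ ε : ℝ, (ε = 1 ∨ ε = -1) ∧ M (lam i) i = ε * M (κ i) i := by
      rcases h5 with h | h
      · exact ⟨1, Or.inl rfl, by rw [h, one_mul]⟩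
      · exact ⟨-1, Or.inr rfl, by rw [h]; ring⟩
    have hli : |M (lam i) i| = |M (κ i) i| := by rcases h5 with h | h <;> simp [h]
    have e1 := N_two hNY_smul hNY_uncond h2 (T (Pi.single i 1)) hli
          (fun m a b => (h7 m a b).1)
    rw [hT_isom, hNX_normal, ← hMdef] at e1
    set Q := NY (Pi.single (κ i) 1 + Pi.single (lam i) 1) with hQ
    have hQ0 : Q ≠ 0 := by intro h; rw [h] at e1; simp at e1
    obtain ⟨δ, hδ, hδM⟩ : ∃ δ : ℝ, (δ = 1 ∨ δ = -1) ∧ δ / Q = M (κ i) i := by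
      refine ⟨M (κ i) i * Q, ?_, by field_simp⟩
      rcases abs_choice (M (κ i) i) with h | h <;> rw [h] at e1
      · left; linarith
      · right; linarith
    refine ⟨δ, ε, hδ, hε, ?_, ?_⟩
    · rw [hδM]
      ext r
      by_cases hr : r = κ i
      · subst hr; simp [Pi.single_apply, h2, hMdef]
      · by_cases hr' : r = lam i
        · subst hr'; simp [Pi.single_apply, hr]; rw [← hMdef, hεM]; ring
        · simp [Pi.single_apply, hr, hr']; exact (h7 r hr hr').1
    · rw [hδM]
      ext r
      by_cases hr : r = κ i
      · subst hr; simp [Pi.single_apply, h2]; exact h4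
      · by_cases hr' : r = lam i
        · subst hr'; simp [Pi.single_apply, hr]; rw [← hMdef, h6, hεM]; ring
        · simp [Pi.single_apply, hr, hr']; exact (h7 r hr hr').2
  · intro i hi j hj hji hjτ
    ext r
    simp only [Set.mem_inter_iff, Set.mem_insert_iff, Set.mem_singleton_iff, Set.mem_empty_iff_false,
      iff_false, not_and]
    intro hr hr'
    rcases hrow i hi r hr j (hrownz j hj r hr').1 with h | h
    · exact hji h
    · exact hjτ h
  · intro k hk
    obtain ⟨i, hi⟩ := hcol k
    by_cases hiA : i ∈ A
    · exfalso
      apply hk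
      refine ⟨i, hiA, ?_⟩
      by_contra h
      exact hi ((hσ i hiA).2.1 k (Ne.symm h))
    · refine ⟨i, hiA, ?_⟩
      by_contra! h
      exact hi ((hB i hiA).2.2.2.2.2.2.1 k h.1 h.2).1
end

section
/- Let X = (Fin d → ℝ) and Y = (Fin d → ℝ) carry 1-unconditional norms with standard bases (e_i) and (f_i), and let T : X → Y be a surjective linear isometry. Suppose there are indices i ≠ j and k ≠ l, a real c ≠ 0, and a sign ε ∈ {−1, 1} such that T e_i = c (f_k + ε f_l) and T e_j = c (f_k − ε f_l). Then the pair (k, l) is interchangeable in Y, and the pair (i, j) is interchangeable in X. -/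
theorem aux6 (d : ℕ)
    (NX NY : (Fin d → ℝ) → ℝ)
    (hNY_add : ∀ x y, NY (x + y) ≤ NY x + NY y)
    (hNY_smul : ∀ (c : ℝ) (x), NY (c • x) = |c| * NY x)
    (hNY_def : ∀ x, NY x = 0 → x = 0)
    (hNX_uncond : ∀ x y : Fin d → ℝ, (∀ i, |x i| ≤ |y i|) → NX x ≤ NX y)
    (hNY_uncond : ∀ x y : Fin d → ℝ, (∀ i, |x i| ≤ |y i|) → NY x ≤ NY y)
    (T : (Fin d → ℝ) ≃ₗ[ℝ] (Fin d → ℝ))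
    (hT_isom : ∀ x, NY (T x) = NX x)
    (i j k l : Fin d) (hij : i ≠ j) (hkl : k ≠ l)
    (c c' : ℝ) (hc : c ≠ 0) (hc' : c' ≠ 0) (ε : ℝ) (hε : ε = 1 ∨ ε = -1)
    (hTi : T ((Pi.single i 1 : Fin d → ℝ)) = c • ((Pi.single k 1 : Fin d → ℝ) + ε • (Pi.single l 1 : Fin d → ℝ)))
    (hTj : T ((Pi.single j 1 : Fin d → ℝ)) = c' • ((Pi.single k 1 : Fin d → ℝ) - ε • (Pi.single l 1 : Fin d → ℝ))) :
    (∀ y z : Fin d → ℝ, |y k| = |z l| → |y l| = |z k| →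
      (∀ m, m ≠ k → m ≠ l → |y m| = |z m|) → NY y = NY z) := by
  have hXeq : ∀ x y : Fin d → ℝ, (∀ i, |x i| = |y i|) → NX x = NX y := fun x y h =>
    le_antisymm (hNX_uncond _ _ fun i => (h i).le) (hNX_uncond _ _ fun i => (h i).ge)
  have hYeq : ∀ x y : Fin d → ℝ, (∀ i, |x i| = |y i|) → NY x = NY y := fun x y h =>
    le_antisymm (hNY_uncond _ _ fun i => (h i).le) (hNY_uncond _ _ fun i => (h i).ge)
  have hεε : ε * ε = 1 := by rcases hε with h | h <;> simp [h]
  have hεa : |ε| = 1 := by rcases hε with h | h <;> simp [h]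
  set ej : Fin d → ℝ := Pi.single j 1 with hej
  set ei : Fin d → ℝ := Pi.single i 1 with hei
  set v := T ej with hv
  obtain ⟨φ, hφ⟩ : ∃ φ : (Fin d → ℝ) →ₗ[ℝ] ℝ, ∀ y, φ y = T.symm y j :=
    ⟨(LinearMap.proj j).comp T.symm.toLinearMap, fun y => rfl⟩
  have hU : ∀ y, NY (y - (2 * φ y) • v) = NY y := by
    intro y
    have h1 : y - (2 * φ y) • v = T (T.symm y - (2 * φ y) • ej) := by
      simp [hv]
    have h2 : NY y = NX (T.symm y) := by rw [← hT_isom]; simp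
    rw [h1, hT_isom, h2]
    apply hXeq
    intro m
    by_cases hm : m = j
    · subst hm
      simp only [Pi.sub_apply, Pi.smul_apply, hej, Pi.single_eq_same, hφ, smul_eq_mul]
      rw [← abs_neg]; congr 1; ring
    · simp [hej, hm]
  have φv : φ v = 1 := by simp [hφ, hv, hej]
  have φu : φ (T ei) = 0 := by simp [hφ, hei, hij]
  have hvk : v k = c' := by simp [hTj, hkl]
  have hvl : v l = -(c' * ε) := by simp [hTj, hkl.symm]
  have hvm : ∀ m, m ≠ k → m ≠ l → v m = 0 := by
    intro m h1 h2; simp [hTj, h1, h2]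
  have hv0 : NY v ≠ 0 := by
    intro h
    have := congrFun (hNY_def _ h) k
    rw [hvk] at this; exact hc' this
  have hNY_nonneg : ∀ y, 0 ≤ NY y := by
    intro y
    have h0 := hNY_smul 0 y
    simp at h0
    have := hNY_uncond 0 y (by intro i; simp)
    linarith
  have key : ∀ y : Fin d → ℝ, y k = 0 → y l = 0 → φ y = 0 := by
    intro y hyk hyl
    have step : ∀ s : ℝ, NY (y + (s + 2 * φ y) • v) = NY (y + s • v) := by
      intro s
      rw [← hU (y + s • v)]
      apply hYeq
      intro m
      simp only [map_add, map_smul, φv, Pi.add_apply, Pi.sub_apply, Pi.smul_apply, smul_eq_mul]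
      by_cases h1 : m = k
      · subst h1; rw [hyk, ← abs_neg]; congr 1; ring
      by_cases h2 : m = l
      · subst h2; rw [hyl, ← abs_neg]; congr 1; ring
      rw [hvm m h1 h2]; simp
    have it : ∀ n : ℕ, NY (y + (n * (2 * φ y)) • v) = NY y := by
      intro n
      induction n with
      | zero => simp
      | succ n ih =>
        refine Eq.trans ?_ ((step _).trans ih); congr 3; push_cast; ring
    have bd : ∀ n : ℕ, n * (|2 * φ y| * NY v) ≤ 2 * NY y := by
      intro n
      have h1 := hNY_add (y + (n * (2 * φ y)) • v) ((-1 : ℝ) • y)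
      rw [it, hNY_smul] at h1
      have h2 : y + (n * (2 * φ y)) • v + (-1 : ℝ) • y = (n * (2 * φ y)) • v := by
        ext m; simp
      rw [h2, hNY_smul, abs_mul, Nat.abs_cast] at h1
      simp at h1 ⊢
      linarith
    by_contra hne
    have hpos : 0 < |2 * φ y| * NY v :=
      mul_pos (by positivity) (lt_of_le_of_ne (hNY_nonneg v) (Ne.symm hv0))
    obtain ⟨n, hn⟩ := exists_nat_gt (2 * NY y / (|2 * φ y| * NY v))
    rw [div_lt_iff₀ hpos] at hn
    linarith [bd n]
  have φk : φ (Pi.single k 1) = 1 / (2 * c') := by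
    have : (Pi.single k 1 : Fin d → ℝ) = (1 / (2 * c)) • T ei + (1 / (2 * c')) • v := by
      rw [hTi, hTj]; ext m; simp; field_simp; ring
    rw [this]; simp [φu, φv]
  have φl : φ (Pi.single l 1) = -ε / (2 * c') := by
    have : (Pi.single l 1 : Fin d → ℝ) = (ε / (2 * c)) • T ei + (-ε / (2 * c')) • v := by
      rw [hTi, hTj]; ext m; simp; field_simp
      linear_combination (-2 * (Pi.single l 1 : Fin d → ℝ) m) * hεε
    rw [this]; simp [φu, φv]
  have φy : ∀ y, φ y = (y k - ε * y l) / (2 * c') := by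
    intro y
    have h := key (y - y k • Pi.single k 1 - y l • Pi.single l 1) (by simp [hkl]) (by simp [hkl.symm])
    rw [map_sub, map_sub, map_smul, map_smul, φk, φl] at h
    simp only [smul_eq_mul] at h
    linear_combination h
  intro y z h1 h2 h3
  rw [← hU y]
  apply hYeq
  intro m
  simp only [Pi.sub_apply, Pi.smul_apply, smul_eq_mul, φy]
  by_cases hm : m = k
  · subst hm
    rw [hvk, ← h2]
    have : y m - 2 * ((y m - ε * y l) / (2 * c')) * c' = ε * y l := by field_simp; ring
    rw [this, abs_mul, hεa, one_mul]
  by_cases hm2 : m = l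
  · subst hm2
    rw [hvl, ← h1]
    have : y m - 2 * ((y k - ε * y m) / (2 * c')) * -(c' * ε) = ε * y k := by
      field_simp; linear_combination (-y m) * hεε
    rw [this, abs_mul, hεa, one_mul]
  rw [hvm m hm hm2, ← h3 m hm hm2]; simp

theorem stmt6 (d : ℕ)
    (NX NY : (Fin d → ℝ) → ℝ)
    (hNX_add : ∀ x y, NX (x + y) ≤ NX x + NX y)
    (hNX_smul : ∀ (c : ℝ) (x), NX (c • x) = |c| * NX x)
    (hNX_def : ∀ x, NX x = 0 → x = 0)
    (hNY_add : ∀ x y, NY (x + y) ≤ NY x + NY y)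
    (hNY_smul : ∀ (c : ℝ) (x), NY (c • x) = |c| * NY x)
    (hNY_def : ∀ x, NY x = 0 → x = 0)
    (hNX_uncond : ∀ x y : Fin d → ℝ, (∀ i, |x i| ≤ |y i|) → NX x ≤ NX y)
    (hNY_uncond : ∀ x y : Fin d → ℝ, (∀ i, |x i| ≤ |y i|) → NY x ≤ NY y)
    (T : (Fin d → ℝ) →ₗ[ℝ] (Fin d → ℝ))
    (hT_surj : Function.Surjective T)
    (hT_isom : ∀ x, NY (T x) = NX x)
    (i j k l : Fin d) (hij : i ≠ j) (hkl : k ≠ l)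
    (c : ℝ) (hc : c ≠ 0) (ε : ℝ) (hε : ε = 1 ∨ ε = -1)
    (hTi : T ((Pi.single i 1 : Fin d → ℝ)) = c • ((Pi.single k 1 : Fin d → ℝ) + ε • (Pi.single l 1 : Fin d → ℝ)))
    (hTj : T ((Pi.single j 1 : Fin d → ℝ)) = c • ((Pi.single k 1 : Fin d → ℝ) - ε • (Pi.single l 1 : Fin d → ℝ))) :
    (∀ y z : Fin d → ℝ, |y k| = |z l| → |y l| = |z k| →
      (∀ m, m ≠ k → m ≠ l → |y m| = |z m|) → NY y = NY z) ∧
    (∀ x w : Fin d → ℝ, |x i| = |w j| → |x j| = |w i| →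
      (∀ m, m ≠ i → m ≠ j → |x m| = |w m|) → NX x = NX w) := by

  have hinj : Function.Injective T := LinearMap.injective_iff_surjective.mpr hT_surj
  have hεε : ε * ε = 1 := by rcases hε with h | h <;> simp [h]
  have hε0 : ε ≠ 0 := by rcases hε with h | h <;> simp [h]
  let E := LinearEquiv.ofBijective T ⟨hinj, hT_surj⟩
  have hE : ∀ x, E x = T x := fun x => rfl
  refine ⟨aux6 d NX NY hNY_add hNY_smul hNY_def hNX_uncond hNY_uncond E hT_isom i j k l hij hkl
    c c hc hc ε hε hTi hTj, ?_⟩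
  refine aux6 d NY NX hNX_add hNX_smul hNX_def hNY_uncond hNX_uncond E.symm ?_ k l i j hkl hij
    (1 / (2 * c)) (ε / (2 * c)) (by positivity) (by positivity) 1 (Or.inl rfl) ?_ ?_
  · intro y
    rw [← hT_isom, ← hE, E.apply_symm_apply]
  · rw [LinearEquiv.symm_apply_eq, hE]
    simp only [map_smul, map_add, hTi, hTj]
    ext m; simp; field_simp; ring
  · rw [LinearEquiv.symm_apply_eq, hE]
    simp only [map_smul, map_sub, hTi, hTj]
    ext m; simp; field_simp
    linear_combination (-2 * (Pi.single l 1 : Fin d → ℝ) m) * hεε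
end

section
/- Let X = (Fin d → ℝ) and Y = (Fin d → ℝ) carry 1-unconditional norms with standard bases (e_i) and (f_i), assume that every surjective linear isometry of Y onto itself is elementary, and let T : X → Y be a surjective linear isometry. Then for every index i the support of T e_i contains at most two indices; that is, there exist indices k, l and reals α_k, α_l with T e_i = α_k f_k + α_l f_l. -/
theorem stmt9 (d : ℕ)
    (NX NY : (Fin d → ℝ) → ℝ)
    (hNX_add : ∀ x y, NX (x + y) ≤ NX x + NX y)
    (hNX_smul : ∀ (c : ℝ) (x), NX (c • x) = |c| * NX x)
    (hNX_def : ∀ x, NX x = 0 → x = 0)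
    (hNY_add : ∀ x y, NY (x + y) ≤ NY x + NY y)
    (hNY_smul : ∀ (c : ℝ) (x), NY (c • x) = |c| * NY x)
    (hNY_def : ∀ x, NY x = 0 → x = 0)
    (hNX_uncond : ∀ x y : Fin d → ℝ, (∀ i, |x i| ≤ |y i|) → NX x ≤ NX y)
    (hNY_uncond : ∀ x y : Fin d → ℝ, (∀ i, |x i| ≤ |y i|) → NY x ≤ NY y)
    (hY_elem :
      (∀ S : (Fin d → ℝ) →ₗ[ℝ] (Fin d → ℝ), Function.Surjective S →
        (∀ x, NY (S x) = NY x) →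
        ∃ (σ : Equiv.Perm (Fin d)) (a : Fin d → ℝ),
          ∀ i, S ((Pi.single i 1 : Fin d → ℝ)) = a i • (Pi.single (σ i) 1 : Fin d → ℝ)))
    (T : (Fin d → ℝ) →ₗ[ℝ] (Fin d → ℝ))
    (hT_surj : Function.Surjective T)
    (hT_isom : ∀ x, NY (T x) = NX x) :
    ∀ i : Fin d, ∃ (k l : Fin d) (αk αl : ℝ),
      T ((Pi.single i 1 : Fin d → ℝ)) = αk • (Pi.single k 1 : Fin d → ℝ) + αl • (Pi.single l 1 : Fin d → ℝ) := by
  intro i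
  have hinj : Function.Injective T := LinearMap.injective_iff_surjective.mpr hT_surj
  let e := LinearEquiv.ofBijective T ⟨hinj, hT_surj⟩
  have he : ∀ x, e.symm (T x) = x := fun x => e.symm_apply_apply x
  set ei : Fin d → ℝ := Pi.single i 1 with hei
  let φ : (Fin d → ℝ) →ₗ[ℝ] ℝ := (LinearMap.proj i).comp e.symm.toLinearMap
  have hφ : ∀ x, φ (T x) = x i := fun x => by
    change e.symm (T x) i = x i
    rw [he]
  have hφu : φ (T ei) = 1 := by rw [hφ, hei]; simp
  let S : (Fin d → ℝ) →ₗ[ℝ] (Fin d → ℝ) := LinearMap.id - ((2:ℝ) • φ).smulRight (T ei)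
  have hS : ∀ y, S y = y - (2 * φ y) • T ei := fun y => by simp [S]
  have hSS : ∀ y, S (S y) = y := fun y => by
    rw [hS (S y), hS y, map_sub, map_smul, hφu]
    simp only [smul_eq_mul]
    module
  have hST : ∀ x, S (T x) = T (x - (2 * x i) • ei) := fun x => by
    rw [hS, hφ, map_sub, map_smul]
  have habs : ∀ (x : Fin d → ℝ) j, |(x - (2 * x i) • ei) j| = |x j| := fun x j => by
    by_cases h : j = i
    · subst h
      have : x j - 2 * x j = - x j := by ring
      simp [hei, this]
    · simp [hei, h]
  obtain ⟨σ, a, h⟩ := hY_elem S (fun y => ⟨S y, hSS y⟩) (fun y => by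
    obtain ⟨x, rfl⟩ := hT_surj y
    rw [hST, hT_isom, hT_isom]
    exact le_antisymm (hNX_uncond _ _ fun j => (habs x j).le)
      (hNX_uncond _ _ fun j => (habs x j).ge))
  have hex : ∃ j, φ (Pi.single j 1) ≠ 0 := by
    by_contra! hcon
    have : φ = 0 := by
      apply LinearMap.pi_ext'
      intro j
      ext
      simpa using hcon j
    rw [this] at hφu
    simp at hφu
  obtain ⟨j, hj⟩ := hex
  refine ⟨j, σ j, (2 * φ (Pi.single j 1))⁻¹, -((2 * φ (Pi.single j 1))⁻¹ * a j), ?_⟩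
  have h2 := h j
  rw [hS] at h2
  have h3 : (2 * φ (Pi.single j 1)) ≠ 0 := mul_ne_zero two_ne_zero hj
  rw [neg_smul, mul_smul, ← h2, smul_sub, smul_smul, inv_mul_cancel₀ h3]
  module
end

section
/- Let X = (Fin d → ℝ) and Y = (Fin d → ℝ) carry 1-unconditional norms with standard bases (e_i) and (f_i), assume that every surjective linear isometry of Y onto itself is elementary, and let T : X → Y be a surjective linear isometry such that for every index n the support of T e_n has at most two elements. Suppose for an index i there are indices k ≠ l and reals α_k ≠ 0, α_l ≠ 0 with T e_i = α_k f_k + α_l f_l. Then there exists a unique index j ≠ i such that T e_j = β_k f_k + β_l f_l for some reals β_k, β_l, and moreover for this j one has β_k ≠ 0 and β_l ≠ 0. -/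
theorem stmt11 (d : ℕ)
    (NX NY : (Fin d → ℝ) → ℝ)
    (hNX_add : ∀ x y, NX (x + y) ≤ NX x + NX y)
    (hNX_smul : ∀ (c : ℝ) (x), NX (c • x) = |c| * NX x)
    (hNX_def : ∀ x, NX x = 0 → x = 0)
    (hNY_add : ∀ x y, NY (x + y) ≤ NY x + NY y)
    (hNY_smul : ∀ (c : ℝ) (x), NY (c • x) = |c| * NY x)
    (hNY_def : ∀ x, NY x = 0 → x = 0)
    (hNX_uncond : ∀ x y : Fin d → ℝ, (∀ i, |x i| ≤ |y i|) → NX x ≤ NX y)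
    (hNY_uncond : ∀ x y : Fin d → ℝ, (∀ i, |x i| ≤ |y i|) → NY x ≤ NY y)
    (hY_elem :
      (∀ S : (Fin d → ℝ) →ₗ[ℝ] (Fin d → ℝ), Function.Surjective S →
        (∀ x, NY (S x) = NY x) →
        ∃ (σ : Equiv.Perm (Fin d)) (a : Fin d → ℝ),
          ∀ i, S ((Pi.single i 1 : Fin d → ℝ)) = a i • (Pi.single (σ i) 1 : Fin d → ℝ)))
    (T : (Fin d → ℝ) →ₗ[ℝ] (Fin d → ℝ))
    (hT_surj : Function.Surjective T)
    (hT_isom : ∀ x, NY (T x) = NX x)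
    (h_supp : ∀ n : Fin d, {m : Fin d | T ((Pi.single n 1 : Fin d → ℝ)) m ≠ 0}.ncard ≤ 2)
    (i k l : Fin d) (hkl : k ≠ l)
    (αk αl : ℝ) (hαk : αk ≠ 0) (hαl : αl ≠ 0)
    (hTi : T ((Pi.single i 1 : Fin d → ℝ)) = αk • (Pi.single k 1 : Fin d → ℝ) + αl • (Pi.single l 1 : Fin d → ℝ)) :
    ∃ j : Fin d,
      (j ≠ i ∧ ∃ βk βl : ℝ, βk ≠ 0 ∧ βl ≠ 0 ∧
        T ((Pi.single j 1 : Fin d → ℝ)) = βk • (Pi.single k 1 : Fin d → ℝ) + βl • (Pi.single l 1 : Fin d → ℝ)) ∧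
      (∀ j' : Fin d, j' ≠ i →
        (∃ βk βl : ℝ,
          T ((Pi.single j' 1 : Fin d → ℝ)) = βk • (Pi.single k 1 : Fin d → ℝ) + βl • (Pi.single l 1 : Fin d → ℝ)) →
        j' = j) := by
  have hT_inj : Function.Injective T := LinearMap.injective_iff_surjective.mpr hT_surj
  let e := LinearEquiv.ofBijective T ⟨hT_inj, hT_surj⟩
  have he : ∀ x, T (e.symm x) = x := fun x => e.apply_symm_apply x
  have he' : ∀ x, e.symm (T x) = x := fun x => e.symm_apply_apply x
  let w : (Fin d → ℝ) →ₗ[ℝ] ℝ := (LinearMap.proj i) ∘ₗ e.symm.toLinearMap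
  have hwT : ∀ x, w (T x) = x i := by
    intro x
    change (e.symm (T x)) i = x i
    rw [he']
  obtain ⟨v, hv⟩ : ∃ v, v = T (Pi.single i 1 : Fin d → ℝ) := ⟨_, rfl⟩
  have hwv : w v = 1 := by rw [hv, hwT]; simp
  let S : (Fin d → ℝ) →ₗ[ℝ] (Fin d → ℝ) := LinearMap.id - (2 : ℝ) • w.smulRight v
  have hS : ∀ x, S x = x - (2 : ℝ) • (w x • v) := fun x => rfl
  have hSS : ∀ x, S (S x) = x := by
    intro x
    have h1 : w (S x) = - w x := by
      rw [hS, map_sub, map_smul, map_smul, hwv]; simp; ring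
    rw [hS (S x), h1, hS]
    ext m; simp
  have hSiso : ∀ x, NY (S x) = NY x := by
    intro x
    obtain ⟨y, rfl⟩ := hT_surj x
    have h1 : S (T y) = T (y - (2 * y i) • (Pi.single i 1 : Fin d → ℝ)) := by
      rw [hS, hwT, map_sub, map_smul, ← hv, smul_smul]
    rw [h1, hT_isom, hT_isom]
    have h2 : ∀ m, |(y - (2 * y i) • (Pi.single i 1 : Fin d → ℝ)) m| = |y m| := by
      intro m
      by_cases hm : m = i
      · subst hm
        simp only [Pi.sub_apply, Pi.smul_apply, Pi.single_eq_same, smul_eq_mul]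
        rw [← abs_neg]; congr 1; ring
      · simp [hm]
    exact le_antisymm (hNX_uncond _ _ fun m => (h2 m).le) (hNX_uncond _ _ fun m => (h2 m).ge)
  obtain ⟨σ, a, hσ⟩ := hY_elem S (fun x => ⟨S x, hSS x⟩) hSiso
  have hprod : ∀ m p q : Fin d, p ≠ q →
      S (Pi.single m 1 : Fin d → ℝ) p * S (Pi.single m 1 : Fin d → ℝ) q = 0 := by
    intro m p q hpq
    rw [hσ]
    by_cases hp : p = σ m
    · have hq : q ≠ σ m := fun h => hpq (hp.trans h.symm)
      simp [hq]
    · simp [hp]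
  have hvk : v k = αk := by rw [hv, hTi]; simp [hkl]
  have hvl : v l = αl := by rw [hv, hTi]; simp [hkl.symm]
  obtain ⟨u, hu⟩ : ∃ u : Fin d → ℝ, ∀ m, u m = w (Pi.single m 1) := ⟨_, fun _ => rfl⟩
  have hSa : ∀ m p, S (Pi.single m 1 : Fin d → ℝ) p =
      (Pi.single m 1 : Fin d → ℝ) p - 2 * (u m * v p) := by
    intro m p; rw [hS, hu]; simp
  have hum : ∀ m, m ≠ k → m ≠ l → u m = 0 := by
    intro m hk hl
    have h := hprod m k l hkl
    rw [hSa, hSa, hvk, hvl] at h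
    simpa [hk.symm, hl.symm, hαk, hαl] using h
  have hwu : ∀ x, w x = u k * x k + u l * x l := by
    intro x
    have h1 : w x = ∑ m, x m * u m := by
      conv_lhs => rw [pi_eq_sum_univ' x]
      rw [map_sum]
      refine Finset.sum_congr rfl fun m _ => ?_
      rw [map_smul, hu, smul_eq_mul]
    rw [h1, ← Finset.sum_subset (Finset.subset_univ {k, l}), Finset.sum_pair hkl]
    · ring
    · intro m _ hm
      simp only [Finset.mem_insert, Finset.mem_singleton, not_or] at hm
      rw [hum m hm.1 hm.2, mul_zero]
  have h1 : u k * αk + u l * αl = 1 := by rw [← hvk, ← hvl, ← hwu, hwv]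
  have hk := hprod k k l hkl
  rw [hSa, hSa, hvk, hvl] at hk
  simp [hkl.symm, hαl] at hk
  have hl := hprod l k l hkl
  rw [hSa, hSa, hvk, hvl] at hl
  simp [hkl, hαk] at hl
  have huk : u k ≠ 0 := by
    intro h0
    rw [h0] at h1
    rcases hl with h | h
    · rw [h] at h1; norm_num at h1
    · linarith
  have hul : u l ≠ 0 := by
    intro h0
    rw [h0] at h1
    rcases hk with h | h
    · linarith
    · rw [h] at h1; norm_num at h1
  have horth : ∀ j, j ≠ i → u k * T (Pi.single j 1) k + u l * T (Pi.single j 1) l = 0 := by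
    intro j hj
    rw [← hwu, hwT]; simp [hj.symm]
  have hex : ∃ j, j ≠ i ∧ T (Pi.single j 1) k ≠ 0 := by
    by_contra hcon
    push Not at hcon
    have hl0 : ∀ j, j ≠ i → T (Pi.single j 1) l = 0 := by
      intro j hj
      have := horth j hj
      rw [hcon j hj] at this
      simpa [hul] using this
    let φ : (Fin d → ℝ) →ₗ[ℝ] ℝ :=
      (αl • (LinearMap.proj k : (Fin d → ℝ) →ₗ[ℝ] ℝ) - αk • LinearMap.proj l) ∘ₗ T
    have hφ : ∀ x, φ x = αl * T x k - αk * T x l := fun x => rfl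
    have hφ0 : φ = 0 := by
      apply LinearMap.pi_ext'
      intro j
      ext
      change φ (Pi.single j 1) = 0
      rw [hφ]
      by_cases hj : j = i
      · rw [hj, ← hv, hvk, hvl]; ring
      · rw [hcon j hj, hl0 j hj]; ring
    obtain ⟨y, hy⟩ := hT_surj (Pi.single k 1)
    have h2 := hφ y
    rw [hφ0, hy] at h2
    simp [hkl.symm] at h2
    exact hαl h2.symm
  obtain ⟨j, hj, hjk⟩ := hex
  have hjl : T (Pi.single j 1) l ≠ 0 := by
    intro h0
    have := horth j hj
    rw [h0] at this
    simp [huk, hjk] at this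
  have hj0 : ∀ m, m ≠ k → m ≠ l → T (Pi.single j 1) m = 0 := by
    intro m hmk hml
    by_contra hm
    have hsub : (({m, k, l} : Finset (Fin d)) : Set (Fin d)) ⊆
        {m : Fin d | T ((Pi.single j 1 : Fin d → ℝ)) m ≠ 0} := by
      intro p hp
      simp at hp
      rcases hp with rfl | rfl | rfl <;> assumption
    have h3 := Set.ncard_le_ncard hsub (Set.toFinite _)
    rw [Set.ncard_coe_finset, Finset.card_eq_three.mpr ⟨m, k, l, hmk, hml, hkl, rfl⟩] at h3
    have := h_supp j
    omega
  refine ⟨j, ⟨hj, _, _, hjk, hjl, ?_⟩, ?_⟩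
  · ext m
    by_cases hmk : m = k
    · subst hmk; simp [hkl]
    · by_cases hml : m = l
      · subst hml; simp [hmk]
      · simp [hmk, hml, hj0 m hmk hml]
  · rintro j' hj' ⟨βk, βl, hβ⟩
    by_contra hne
    have ho' := horth j' hj'
    have ho := horth j hj
    have hbk : T (Pi.single j' 1) k = βk := by rw [hβ]; simp [hkl]
    have hbl : T (Pi.single j' 1) l = βl := by rw [hβ]; simp [hkl.symm]
    rw [hbk, hbl] at ho'
    have hz : T (T (Pi.single j 1) k • (Pi.single j' 1 : Fin d → ℝ) - βk • Pi.single j 1) = T 0 := by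
      rw [map_sub, map_smul, map_smul, map_zero]
      ext m
      simp only [Pi.sub_apply, Pi.smul_apply, smul_eq_mul, Pi.zero_apply]
      by_cases hmk : m = k
      · subst hmk; rw [hbk]; ring
      · by_cases hml : m = l
        · subst hml
          rw [hbl]
          apply mul_left_cancel₀ hul
          linear_combination T (Pi.single j 1) k * ho' - βk * ho
        · rw [hj0 m hmk hml, hβ]; simp [hmk, hml]
    have h4 := congrFun (hT_inj hz) j'
    simp [hne, hjk] at h4
end

section
/- Let d ≥ 3 be a natural number and let X = (Fin d → ℝ) and Y = (Fin d → ℝ) carry 1-unconditional, strictly monotone norms with normalized standard bases (e_i) and (f_i), and suppose both X and Y are one-p-convex for some p with 2 < p < ∞. Then every surjective linear isometry U : X → Y is elementary with coefficients ±1: there exist a bijection σ : Fin d → Fin d and signs ε_k ∈ {−1, 1} such that U e_k = ε_k f_{σ(k)} for every k (equivalently, U(∑_k a_k e_k) = ∑_k ε_k a_k f_{σ(k)} for all coefficients a_k). -/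
theorem aux_scalar_s12 (p : ℝ) (hp : 2 < p) (a b w : ℝ) (hw : 0 ≤ w) (h : w ^ 2 ≤ a ^ 2 + b ^ 2) :
    (2 : ℝ) ^ (1 / p) * w ≤ (|a + b| ^ p + |a - b| ^ p) ^ (1 / p) := by
  have hp0 : 0 < p := by linarith
  have key : 2 * w ^ p ≤ |a + b| ^ p + |a - b| ^ p := by
    have h1 := (convexOn_rpow (show 1 ≤ p / 2 by linarith)).2
      (show |a + b| ^ 2 ∈ Set.Ici (0 : ℝ) from Set.mem_Ici.mpr (by positivity))
      (show |a - b| ^ 2 ∈ Set.Ici (0 : ℝ) from Set.mem_Ici.mpr (by positivity))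
      (show (0 : ℝ) ≤ 1 / 2 by norm_num) (show (0 : ℝ) ≤ 1 / 2 by norm_num) (by norm_num)
    simp only [smul_eq_mul] at h1
    have e : ∀ x : ℝ, 0 ≤ x → (x ^ 2) ^ (p / 2) = x ^ p := by
      intro x hx
      rw [← Real.rpow_natCast, ← Real.rpow_mul hx]
      congr 1
      push_cast
      ring
    rw [e _ (abs_nonneg _), e _ (abs_nonneg _)] at h1
    have h2 : w ^ p ≤ (1 / 2 * |a + b| ^ 2 + 1 / 2 * |a - b| ^ 2) ^ (p / 2) := by
      rw [← e w hw]
      apply Real.rpow_le_rpow (by positivity) _ (by linarith)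
      rw [sq_abs, sq_abs]
      nlinarith
    linarith
  calc (2 : ℝ) ^ (1 / p) * w = (2 * w ^ p) ^ (1 / p) := by
        rw [Real.mul_rpow (by norm_num) (by positivity), one_div, Real.rpow_rpow_inv hw hp0.ne']
    _ ≤ _ := Real.rpow_le_rpow (by positivity) key (by positivity)

theorem aux_disj (d : ℕ) (NX NY : (Fin d → ℝ) → ℝ)
    (hNY_add : ∀ x y, NY (x + y) ≤ NY x + NY y)
    (hNX_smul : ∀ (c : ℝ) (x), NX (c • x) = |c| * NX x)
    (hNY_smul : ∀ (c : ℝ) (x), NY (c • x) = |c| * NY x)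
    (hNX_uncond : ∀ x y : Fin d → ℝ, (∀ i, |x i| ≤ |y i|) → NX x ≤ NX y)
    (hNY_uncond : ∀ x y : Fin d → ℝ, (∀ i, |x i| ≤ |y i|) → NY x ≤ NY y)
    (hNY_strict : ∀ x y : Fin d → ℝ, (∀ i, |x i| ≤ |y i|) →
      (∃ i, |x i| < |y i|) → NY x < NY y)
    (hNX_normal : ∀ i : Fin d, NX ((Pi.single i 1 : Fin d → ℝ)) = 1)
    (p : ℝ) (hp : 2 < p)
    (hNX_pconv : ∀ (m : ℕ) (xs : Fin m → (Fin d → ℝ)),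
      NX (fun i => (∑ j, |xs j i| ^ p) ^ (1 / p)) ≤
        (∑ j, NX (xs j) ^ p) ^ (1 / p))
    (hNY_pconv : ∀ (m : ℕ) (xs : Fin m → (Fin d → ℝ)),
      NY (fun i => (∑ j, |xs j i| ^ p) ^ (1 / p)) ≤
        (∑ j, NY (xs j) ^ p) ^ (1 / p))
    (U : (Fin d → ℝ) →ₗ[ℝ] (Fin d → ℝ))
    (hU_isom : ∀ x, NY (U x) = NX x) (k l : Fin d) (hkl : k ≠ l) (i : Fin d)
    (hu : U (Pi.single k 1) i ≠ 0) (hv : U (Pi.single l 1) i ≠ 0) : False := by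
  have hp0 : 0 < p := by linarith
  have hpi : 0 < 1 / p := by positivity
  have nY0 : ∀ x, 0 ≤ NY x := by
    intro x
    have h0 : NY 0 = 0 := by simpa using hNY_smul 0 0
    rw [← h0]
    exact hNY_uncond _ _ (fun i => by simp)
  have L1 : ∀ t : ℝ, NX (Pi.single k 1 + t • Pi.single l 1) ^ p ≤ 1 + |t| ^ p := by
    intro t
    have h := hNX_pconv 2 ![Pi.single k 1, t • Pi.single l 1]
    simp only [Fin.sum_univ_two, Matrix.cons_val_zero, Matrix.cons_val_one, hNX_smul,
      hNX_normal, Real.one_rpow, mul_one] at h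
    have h2 : NX (Pi.single k 1 + t • Pi.single l 1) ≤ (1 + |t| ^ p) ^ (1 / p) := by
      refine le_trans (hNX_uncond _ _ ?_) h
      intro j
      have hz : (0 : ℝ) ^ p = 0 := Real.zero_rpow hp0.ne'
      have hr : (|t| ^ p) ^ (p⁻¹) = |t| := Real.rpow_rpow_inv (abs_nonneg _) hp0.ne'
      have hz' : (0 : ℝ) ^ (p⁻¹) = 0 := Real.zero_rpow (by positivity)
      by_cases h1 : j = k
      · subst h1
        simp [Pi.single_apply, hkl, hz]
      · by_cases h2 : j = l
        · subst h2
          simp [Pi.single_apply, h1, hz, hr]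
        · simp [Pi.single_apply, h1, h2, hz, hz']
    calc _ ≤ ((1 + |t| ^ p) ^ (1 / p)) ^ p :=
          Real.rpow_le_rpow (by rw [← hU_isom]; exact nY0 _) h2 hp0.le
      _ = _ := by rw [one_div, Real.rpow_inv_rpow (by positivity) hp0.ne']
  set u := U (Pi.single k 1) with hudef
  set v := U (Pi.single l 1) with hvdef
  have Nu : NY u = 1 := by rw [hudef, hU_isom, hNX_normal]
  have L2 : ∀ t : ℝ, NY (u + t • v) ^ p ≤ 1 + |t| ^ p := by
    intro t
    have := L1 t
    rwa [← hU_isom, map_add, map_smul] at this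
  -- the modulus of u
  set A : Fin d → ℝ := fun j => |u j| with hA
  have NA : NY A = 1 := by
    rw [← Nu]
    exact le_antisymm (hNY_uncond _ _ (fun j => by simp [hA]))
      (hNY_uncond _ _ (fun j => by simp [hA]))
  have L3 : ∀ t s : ℝ, 0 < t → 0 ≤ s → (|u i| + s) ^ 2 ≤ (u i) ^ 2 + (t * v i) ^ 2 →
      NY (A + s • Pi.single i 1) ≤ 1 + t ^ p := by
    intro t s ht hs hst
    have h := hNY_pconv 2 ![u + t • v, u - t • v]
    simp only [Fin.sum_univ_two, Matrix.cons_val_zero, Matrix.cons_val_one] at h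
    have h1 := L2 t
    have h2 := L2 (-t)
    rw [neg_smul, ← sub_eq_add_neg, abs_neg] at h2
    rw [abs_of_pos ht] at h1 h2
    have tp : 0 < t ^ p := by positivity
    have h3 : (NY (u + t • v) ^ p + NY (u - t • v) ^ p) ^ (1 / p)
        ≤ 2 ^ (1 / p) * (1 + t ^ p) := by
      calc _ ≤ (2 * (1 + t ^ p)) ^ (1 / p) := by
            apply Real.rpow_le_rpow _ (by linarith) hpi.le
            have := Real.rpow_nonneg (nY0 (u + t • v)) p
            have := Real.rpow_nonneg (nY0 (u - t • v)) p
            linarith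
        _ = 2 ^ (1 / p) * (1 + t ^ p) ^ (1 / p) :=
            Real.mul_rpow (by norm_num) (by positivity)
        _ ≤ _ := by
            gcongr
            apply Real.rpow_le_self_of_one_le (by linarith)
            rw [div_le_one hp0]; linarith
    have h4 : NY ((2 : ℝ) ^ (1 / p) • (A + s • Pi.single i 1)) ≤
        NY (fun i => (|(u + t • v) i| ^ p + |(u - t • v) i| ^ p) ^ (1 / p)) := by
      apply hNY_uncond
      intro j
      have hn : 0 ≤ (A + s • Pi.single i 1 : Fin d → ℝ) j := by
        simp only [hA, Pi.add_apply, Pi.smul_apply, smul_eq_mul, Pi.single_apply]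
        split_ifs <;> positivity
      refine le_trans ?_ (le_abs_self _)
      rw [Pi.smul_apply, smul_eq_mul, abs_of_nonneg (by positivity)]
      simp only [Pi.add_apply u, Pi.sub_apply u, Pi.smul_apply t v, smul_eq_mul]
      apply aux_scalar_s12 p hp _ _ _ hn
      by_cases hj : j = i
      · subst hj
        simpa [hA] using hst
      · simp [hA, Pi.single_apply, hj]
        positivity
    rw [hNY_smul, abs_of_pos (by positivity)] at h4
    have h5 := (h4.trans h).trans h3
    exact le_of_mul_le_mul_left h5 (by positivity)
  set B : Fin d → ℝ := fun j => if j = i then 0 else |u j| with hB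
  have NB : NY B < 1 := by
    rw [← NA]
    apply hNY_strict
    · intro j
      by_cases hj : j = i <;> simp [hA, hB, hj]
    · exact ⟨i, by simpa [hA, hB] using hu⟩
  have ha : 0 < |u i| := abs_pos.mpr hu
  set a := |u i| with hadef
  have L4 : ∀ s : ℝ, 0 ≤ s → a + s ≤ s * NY B + a * NY (A + s • Pi.single i 1) := by
    intro s hs
    have h := hNY_add (s • B) (a • (A + s • Pi.single i 1))
    have e : s • B + a • (A + s • Pi.single i 1) = (a + s) • A := by
      funext j
      by_cases hj : j = i
      · subst hj
        simp [hA, hB, ← hadef]; ring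
      · simp [hA, hB, hj]; ring
    rw [e, hNY_smul, hNY_smul, hNY_smul, NA, abs_of_nonneg hs, abs_of_pos ha,
      abs_of_nonneg (by linarith)] at h
    linarith
  set b := v i with hb
  have hb2 : 0 < b ^ 2 := by positivity
  set c := b ^ 2 / (2 * a + 1 + b ^ 2) with hc
  have hc0 : 0 < c := by positivity
  have hc1 : c ≤ 1 := by rw [hc, div_le_one (by positivity)]; linarith
  have hcb : c * (2 * a + 1) ≤ b ^ 2 := by
    rw [hc, div_mul_eq_mul_div, div_le_iff₀ (by positivity)]
    nlinarith
  have main : ∀ t : ℝ, 0 < t → t ≤ 1 → c * (1 - NY B) / a ≤ t ^ (p - 2) := by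
    intro t ht ht1
    have h2 : t ^ 2 ≤ 1 := by nlinarith
    have h3 := L3 t (c * t ^ 2) ht (by positivity) (by
      have : u i ^ 2 = a ^ 2 := by rw [hadef, sq_abs]
      rw [this]
      have h5 : c * (c * t ^ 2) ≤ c * 1 := by
        apply mul_le_mul_of_nonneg_left _ hc0.le
        nlinarith [sq_nonneg t]
      have h6 : t ^ 2 * (c * (2 * a) + c * (c * t ^ 2)) ≤ t ^ 2 * b ^ 2 := by
        apply mul_le_mul_of_nonneg_left _ (sq_nonneg t)
        linarith
      linarith)
    have h4 := L4 (c * t ^ 2) (by positivity)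
    have e : t ^ p = t ^ (p - 2) * t ^ 2 := by
      rw [← Real.rpow_natCast t 2, ← Real.rpow_add ht]
      congr 1
      push_cast
      ring
    have h7 : a * NY (A + (c * t ^ 2) • Pi.single i 1) ≤ a * (1 + t ^ p) :=
      mul_le_mul_of_nonneg_left h3 ha.le
    rw [div_le_iff₀ ha]
    rw [e] at h7
    have t2 : 0 < t ^ 2 := by positivity
    refine le_of_mul_le_mul_right ?_ t2
    linarith
  set δ := c * (1 - NY B) / a with hδ
  have hδ0 : 0 < δ := div_pos (mul_pos hc0 (by linarith)) ha
  have hm : 0 < min 1 (δ / 2) := by positivity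
  have hq : 0 < p - 2 := by linarith
  have := main ((min 1 (δ / 2)) ^ ((p - 2)⁻¹)) (by positivity)
    (Real.rpow_le_one hm.le (min_le_left _ _) (by positivity))
  rw [Real.rpow_inv_rpow hm.le hq.ne'] at this
  have := min_le_right 1 (δ / 2)
  linarith

theorem stmt12 (d : ℕ) (hd : 3 ≤ d)
    (NX NY : (Fin d → ℝ) → ℝ)
    (hNX_add : ∀ x y, NX (x + y) ≤ NX x + NX y)
    (hNX_smul : ∀ (c : ℝ) (x), NX (c • x) = |c| * NX x)
    (hNX_def : ∀ x, NX x = 0 → x = 0)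
    (hNY_add : ∀ x y, NY (x + y) ≤ NY x + NY y)
    (hNY_smul : ∀ (c : ℝ) (x), NY (c • x) = |c| * NY x)
    (hNY_def : ∀ x, NY x = 0 → x = 0)
    (hNX_uncond : ∀ x y : Fin d → ℝ, (∀ i, |x i| ≤ |y i|) → NX x ≤ NX y)
    (hNY_uncond : ∀ x y : Fin d → ℝ, (∀ i, |x i| ≤ |y i|) → NY x ≤ NY y)
    (hNX_strict : ∀ x y : Fin d → ℝ, (∀ i, |x i| ≤ |y i|) →
      (∃ i, |x i| < |y i|) → NX x < NX y)
    (hNY_strict : ∀ x y : Fin d → ℝ, (∀ i, |x i| ≤ |y i|) →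
      (∃ i, |x i| < |y i|) → NY x < NY y)
    (hNX_normal : ∀ i : Fin d, NX ((Pi.single i 1 : Fin d → ℝ)) = 1)
    (hNY_normal : ∀ i : Fin d, NY ((Pi.single i 1 : Fin d → ℝ)) = 1)
    (p : ℝ) (hp : 2 < p)
    (hNX_pconv : ∀ (m : ℕ) (xs : Fin m → (Fin d → ℝ)),
      NX (fun i => (∑ j, |xs j i| ^ p) ^ (1 / p)) ≤
        (∑ j, NX (xs j) ^ p) ^ (1 / p))
    (hNY_pconv : ∀ (m : ℕ) (xs : Fin m → (Fin d → ℝ)),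
      NY (fun i => (∑ j, |xs j i| ^ p) ^ (1 / p)) ≤
        (∑ j, NY (xs j) ^ p) ^ (1 / p))
    (U : (Fin d → ℝ) →ₗ[ℝ] (Fin d → ℝ))
    (hU_surj : Function.Surjective U)
    (hU_isom : ∀ x, NY (U x) = NX x) :
    ∃ (σ : Equiv.Perm (Fin d)) (ε : Fin d → ℝ),
      (∀ k, ε k = 1 ∨ ε k = -1) ∧
      ∀ k, U ((Pi.single k 1 : Fin d → ℝ)) = ε k • (Pi.single (σ k) 1 : Fin d → ℝ) := by
  have disj := fun k l hkl i => aux_disj d NX NY hNY_add hNX_smul hNY_smul hNX_uncond hNY_uncond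
    hNY_strict hNX_normal p hp hNX_pconv hNY_pconv U hU_isom k l hkl i
  have hne : ∀ k, ∃ i, U (Pi.single k 1) i ≠ 0 := by
    intro k
    by_contra! h
    have h1 : U (Pi.single k 1) = 0 := funext h
    have h2 := hU_isom (Pi.single k 1)
    rw [h1, hNX_normal] at h2
    have h0 : NY 0 = 0 := by simpa using hNY_smul 0 0
    linarith
  choose f hf using hne
  have finj : Function.Injective f := by
    intro k l h
    by_contra hkl
    exact disj k l hkl (f k) (hf k) (h ▸ hf l)
  have fbij : Function.Bijective f := Finite.injective_iff_bijective.mp finj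
  have hrep : ∀ k, U (Pi.single k 1) = U (Pi.single k 1) (f k) • Pi.single (f k) 1 := by
    intro k
    funext j
    obtain ⟨l, rfl⟩ := fbij.2 j
    by_cases h : l = k
    · subst h; simp
    · have h1 : f l ≠ f k := fun e => h (finj e)
      have h2 : U (Pi.single k 1) (f l) = 0 := by
        by_contra h3
        exact disj l k h (f l) (hf l) h3
      simp [h1, h2]
  refine ⟨Equiv.ofBijective f fbij, fun k => U (Pi.single k 1) (f k), ?_, fun k => hrep k⟩
  intro k
  have h := hU_isom (Pi.single k 1)
  rw [hrep k, hNY_smul, hNX_normal, hNY_normal, mul_one] at h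
  exact eq_or_eq_neg_of_abs_eq h
end

section
/- Let d ≥ 3 be a natural number and let X = (Fin d → ℝ) and Y = (Fin d → ℝ) carry 1-unconditional, strictly monotone norms with normalized standard bases (e_i) and (f_i); suppose both X and Y are one-q-concave for some q with 1 < q < 2 and both are smooth at each of their standard basis vectors. Then every surjective linear isometry U : X → Y is elementary with coefficients ±1: there exist a bijection σ : Fin d → Fin d and signs ε_k ∈ {−1, 1} such that U e_k = ε_k f_{σ(k)} for every k. -/
theorem aux_lower (d : ℕ) (N : (Fin d → ℝ) → ℝ)
    (hsmul : ∀ (c : ℝ) (x), N (c • x) = |c| * N x)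
    (hunc : ∀ x y : Fin d → ℝ, (∀ i, |x i| ≤ |y i|) → N x ≤ N y)
    (hnorm : ∀ i : Fin d, N ((Pi.single i 1 : Fin d → ℝ)) = 1)
    (q : ℝ) (hq1 : 1 < q)
    (hq : ∀ (m : ℕ) (xs : Fin m → (Fin d → ℝ)),
      (∑ j, N (xs j) ^ q) ^ (1 / q) ≤
        N (fun i => (∑ j, |xs j i| ^ q) ^ (1 / q)))
    (x : Fin d → ℝ) (hx : N x = 1) : ∑ j, |x j| ^ q ≤ 1 := by
  have hq0 : q ≠ 0 := by linarith
  have h := hq d (fun j => x j • (Pi.single j 1 : Fin d → ℝ))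
  simp only [hsmul, hnorm, mul_one] at h
  have h2 : (fun i => (∑ j, |(x j • (Pi.single j 1 : Fin d → ℝ)) i| ^ q) ^ (1 / q))
      = fun i => |x i| := by
    funext i
    rw [Finset.sum_eq_single i]
    · simp [← Real.rpow_mul (abs_nonneg _), hq0]
    · intro j _ hj
      simp [Pi.single_apply, hj.symm, Real.zero_rpow hq0]
    · simp
  rw [h2] at h
  have h3 : N (fun i => |x i|) ≤ N x := hunc _ _ (fun i => by simp)
  by_contra hc
  push Not at hc
  have := Real.one_lt_rpow hc (z := 1 / q) (by positivity)
  linarith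

theorem aux_entry (q a : ℝ) (hq2 : q < 2) (hq1 : 1 < q) (ha : |a| ≤ 1) :
    a ^ 2 ≤ |a| ^ q ∧ (|a| ^ q ≤ a ^ 2 → a = 0 ∨ |a| = 1) := by
  rcases eq_or_ne a 0 with h | h
  · subst h
    simp [Real.zero_rpow (by linarith : q ≠ 0)]
  · have hp : 0 < |a| := abs_pos.mpr h
    have e : a ^ 2 = |a| ^ (2 : ℝ) := by
      rw [Real.rpow_two, sq_abs]
    rw [e]
    refine ⟨Real.rpow_le_rpow_of_exponent_ge hp ha hq2.le, fun hh => Or.inr ?_⟩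
    by_contra hc
    have := Real.rpow_lt_rpow_of_exponent_gt hp (lt_of_le_of_ne ha hc) hq2
    linarith

theorem aux_le_one {d : ℕ} (q : ℝ) (hq1 : 1 < q) (x : Fin d → ℝ)
    (h : ∑ j, |x j| ^ q ≤ 1) (k : Fin d) : |x k| ≤ 1 := by
  have h1 : |x k| ^ q ≤ ∑ j, |x j| ^ q :=
    Finset.single_le_sum (f := fun j => |x j| ^ q) (fun j _ => by positivity) (Finset.mem_univ k)
  by_contra hc
  push Not at hc
  have := Real.one_lt_rpow hc (z := q) (by linarith)
  linarith

theorem stmt13 (d : ℕ) (hd : 3 ≤ d)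
    (NX NY : (Fin d → ℝ) → ℝ)
    (hNX_add : ∀ x y, NX (x + y) ≤ NX x + NX y)
    (hNX_smul : ∀ (c : ℝ) (x), NX (c • x) = |c| * NX x)
    (hNX_def : ∀ x, NX x = 0 → x = 0)
    (hNY_add : ∀ x y, NY (x + y) ≤ NY x + NY y)
    (hNY_smul : ∀ (c : ℝ) (x), NY (c • x) = |c| * NY x)
    (hNY_def : ∀ x, NY x = 0 → x = 0)
    (hNX_uncond : ∀ x y : Fin d → ℝ, (∀ i, |x i| ≤ |y i|) → NX x ≤ NX y)
    (hNY_uncond : ∀ x y : Fin d → ℝ, (∀ i, |x i| ≤ |y i|) → NY x ≤ NY y)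
    (hNX_strict : ∀ x y : Fin d → ℝ, (∀ i, |x i| ≤ |y i|) →
      (∃ i, |x i| < |y i|) → NX x < NX y)
    (hNY_strict : ∀ x y : Fin d → ℝ, (∀ i, |x i| ≤ |y i|) →
      (∃ i, |x i| < |y i|) → NY x < NY y)
    (hNX_normal : ∀ i : Fin d, NX ((Pi.single i 1 : Fin d → ℝ)) = 1)
    (hNY_normal : ∀ i : Fin d, NY ((Pi.single i 1 : Fin d → ℝ)) = 1)
    (q : ℝ) (hq1 : 1 < q) (hq2 : q < 2)
    (hNX_qconc : ∀ (m : ℕ) (xs : Fin m → (Fin d → ℝ)),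
      (∑ j, NX (xs j) ^ q) ^ (1 / q) ≤
        NX (fun i => (∑ j, |xs j i| ^ q) ^ (1 / q)))
    (hNY_qconc : ∀ (m : ℕ) (xs : Fin m → (Fin d → ℝ)),
      (∑ j, NY (xs j) ^ q) ^ (1 / q) ≤
        NY (fun i => (∑ j, |xs j i| ^ q) ^ (1 / q)))
    (hNX_smooth : ∀ i : Fin d, ∃! f : (Fin d → ℝ) →ₗ[ℝ] ℝ,
      (∀ y, |f y| ≤ NX y) ∧ f ((Pi.single i 1 : Fin d → ℝ)) = NX ((Pi.single i 1 : Fin d → ℝ)))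
    (hNY_smooth : ∀ i : Fin d, ∃! f : (Fin d → ℝ) →ₗ[ℝ] ℝ,
      (∀ y, |f y| ≤ NY y) ∧ f ((Pi.single i 1 : Fin d → ℝ)) = NY ((Pi.single i 1 : Fin d → ℝ)))
    (U : (Fin d → ℝ) →ₗ[ℝ] (Fin d → ℝ))
    (hU_surj : Function.Surjective U)
    (hU_isom : ∀ x, NY (U x) = NX x) :
    ∃ (σ : Equiv.Perm (Fin d)) (ε : Fin d → ℝ),
      (∀ k, ε k = 1 ∨ ε k = -1) ∧
      ∀ k, U ((Pi.single k 1 : Fin d → ℝ)) = ε k • (Pi.single (σ k) 1 : Fin d → ℝ) := by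
  have hUinj : Function.Injective U := by
    rw [injective_iff_map_eq_zero]
    intro x hx
    apply hNX_def
    rw [← hU_isom, hx]
    simpa using hNY_smul 0 0
  let E := LinearEquiv.ofBijective U ⟨hUinj, hU_surj⟩
  have hE : ∀ x, E x = U x := fun x => rfl
  have hV : ∀ y, NX (E.symm y) = NY y := by
    intro y
    rw [← hU_isom, ← hE, E.apply_symm_apply]
  -- a i k = (U e_i)_k,  b k i = (U⁻¹ f_k)_i
  obtain ⟨a, ha⟩ : ∃ a : Fin d → Fin d → ℝ, ∀ i, a i = U (Pi.single i 1) := ⟨_, fun _ => rfl⟩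
  obtain ⟨b, hb⟩ : ∃ b : Fin d → Fin d → ℝ, ∀ k, b k = E.symm (Pi.single k 1) :=
    ⟨_, fun _ => rfl⟩
  have hA : ∀ i, ∑ k, |a i k| ^ q ≤ 1 := fun i =>
    aux_lower d NY hNY_smul hNY_uncond hNY_normal q hq1 hNY_qconc (a i)
      (by rw [ha, hU_isom, hNX_normal])
  have hB : ∀ k, ∑ i, |b k i| ^ q ≤ 1 := fun k =>
    aux_lower d NX hNX_smul hNX_uncond hNX_normal q hq1 hNX_qconc (b k)
      (by rw [hb, hV, hNY_normal])
  have hdec : ∀ x : Fin d → ℝ, x = ∑ k, x k • (Pi.single k 1 : Fin d → ℝ) :=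
    fun x => pi_eq_sum_univ' x
  have hab : ∀ i, ∑ k, a i k * b k i = 1 := by
    intro i
    have h1 : E.symm (a i) = Pi.single i 1 := by
      rw [ha, ← hE, E.symm_apply_apply]
    rw [hdec (a i), map_sum] at h1
    simp only [map_smul, ← hb] at h1
    have := congrFun h1 i
    simpa [Finset.sum_apply] using this
  have hnn : ∀ i k, 0 ≤ |a i k| ^ q + |b k i| ^ q - 2 * (a i k * b k i) := by
    intro i k
    have h1 := (aux_entry q _ hq2 hq1 (aux_le_one q hq1 _ (hA i) k)).1
    have h2 := (aux_entry q _ hq2 hq1 (aux_le_one q hq1 _ (hB k) i)).1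
    nlinarith [sq_nonneg (a i k - b k i)]
  have htot : ∑ i, ∑ k, (|a i k| ^ q + |b k i| ^ q - 2 * (a i k * b k i)) ≤ 0 := by
    simp only [Finset.sum_sub_distrib, Finset.sum_add_distrib, ← Finset.mul_sum, hab]
    rw [Finset.sum_comm (f := fun i k => |b k i| ^ q)]
    have h1 := Finset.sum_le_sum (s := Finset.univ) (fun i _ => hA i)
    have h2 := Finset.sum_le_sum (s := Finset.univ) (fun i _ => hB i)
    linarith
  have hz : ∀ i k, |a i k| ^ q + |b k i| ^ q - 2 * (a i k * b k i) = 0 := by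
    intro i k
    have h1 := le_antisymm htot (Finset.sum_nonneg fun i _ => Finset.sum_nonneg fun k _ => hnn i k)
    rw [Finset.sum_eq_zero_iff_of_nonneg
      (fun i _ => Finset.sum_nonneg fun k _ => hnn i k)] at h1
    have h2 := h1 i (Finset.mem_univ i)
    rw [Finset.sum_eq_zero_iff_of_nonneg (fun k _ => hnn i k)] at h2
    exact h2 k (Finset.mem_univ k)
  have h01 : ∀ i k, a i k = 0 ∨ |a i k| = 1 := by
    intro i k
    have h1 := (aux_entry q _ hq2 hq1 (aux_le_one q hq1 _ (hA i) k)).2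
    have h2 := (aux_entry q _ hq2 hq1 (aux_le_one q hq1 _ (hB k) i)).1
    apply h1
    nlinarith [sq_nonneg (a i k - b k i), hz i k]
  have hex : ∀ i, ∃ k, |a i k| = 1 ∧ ∀ l, l ≠ k → a i l = 0 := by
    intro i
    have hne : ∃ k, a i k ≠ 0 := by
      by_contra hc
      push Not at hc
      have := hab i
      simp [hc] at this
    obtain ⟨k, hk⟩ := hne
    have hk1 := (h01 i k).resolve_left hk
    refine ⟨k, hk1, fun l hl => ?_⟩
    by_contra hc
    have hl1 := (h01 i l).resolve_left hc
    have h1 : ∑ j ∈ {l, k}, |a i j| ^ q ≤ ∑ j, |a i j| ^ q :=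
      Finset.sum_le_sum_of_subset_of_nonneg (Finset.subset_univ _) (fun j _ _ => by positivity)
    rw [Finset.sum_pair hl, hk1, hl1, Real.one_rpow] at h1
    linarith [hA i]
  choose s hs1 hs2 using hex
  have hform : ∀ i, U (Pi.single i 1) = a i (s i) • (Pi.single (s i) 1 : Fin d → ℝ) := by
    intro i
    rw [← ha]
    funext l
    by_cases h : l = s i
    · subst h; simp
    · simp [hs2 i l h, h]
  have hsinj : Function.Injective s := by
    intro i j hij
    by_contra hne
    have h1 : U (a j (s j) • (Pi.single i 1 : Fin d → ℝ)) =
        U (a i (s i) • (Pi.single j 1 : Fin d → ℝ)) := by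
      rw [map_smul, map_smul, hform i, hform j, hij, smul_smul, smul_smul, mul_comm]
    have h2 := congrFun (hUinj h1) i
    have h3 := hs1 j
    simp [hne] at h2
    simp [h2] at h3
  refine ⟨Equiv.ofBijective s (Finite.injective_iff_bijective.mp hsinj), fun i => a i (s i),
    fun k => eq_or_eq_neg_of_abs_eq (hs1 k), fun k => hform k⟩
end
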